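/- Let β be an irrational real number, let λ1, λ2, λ3 ≥ 0 with at least one of them positive, and suppose λ1 + λ3 ≤ 1 and λ2 ≤ 1 (region I of extended Harper's model); note that then 4λ1λ3 ≤ 1. Let θ ∈ ℝ and let H be any bounded linear operator on ℓ²(ℤ, ℂ) satisfying (Hψ)_k = 2cos(2π(θ+βk))·ψ_k + c(θ+βk)·ψ_{k+1} + conj(c(θ+β(k−1)))·ψ_{k−1} for all ψ ∈ ℓ²(ℤ,ℂ) and k ∈ ℤ. Then for every real E in the spectrum of H, the Lyapunov exponent of the transfer-matrix cocycle satisfies L(β, A^E) = log((1 + √(1 − 4λ1λ3))/2). -/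

import Mathlib

open MeasureTheory Filter Complex
open scoped ENNReal Real NNReal

noncomputable section

attribute [local instance] Matrix.frobeniusNormedAddCommGroup

/-- The `n`-step cocycle iterate `D^{(n)}_β(x) = D(x+(n-1)β)⋯D(x)`. -/
def cocycleIter (D : ℝ → Matrix (Fin 2) (Fin 2) ℂ) (β : ℝ) : ℕ → ℝ → Matrix (Fin 2) (Fin 2) ℂ
  | 0, _ => 1
  | n + 1, x => cocycleIter D β n (x + β) * D x

/-- The extended-real-valued integral `∫₀¹ log (g x) dx`, with value `-∞` allowed
(the positive and negative parts are integrated separately; `log 0 = -∞`). -/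
def logIntegral (g : ℝ → ℝ) : EReal :=
  ((∫⁻ x in Set.Ioc (0 : ℝ) 1, ENNReal.ofReal (Real.log (g x))) : EReal) -
    ((∫⁻ x in Set.Ioc (0 : ℝ) 1,
        if g x = 0 then (⊤ : ℝ≥0∞) else ENNReal.ofReal (-Real.log (g x))) : EReal)

/-- The Lyapunov exponent `L(β, D) = inf_{n ≥ 1} (1/n) ∫₀¹ log ‖D^{(n)}_β(x)‖ dx ∈ ℝ ∪ {-∞}`. -/
def lyapunov (β : ℝ) (D : ℝ → Matrix (Fin 2) (Fin 2) ℂ) : EReal :=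
  ⨅ n : ℕ, ((((n : ℝ) + 1)⁻¹ : ℝ) : EReal) * logIntegral fun x => ‖cocycleIter D β (n + 1) x‖

/-- `c(z) = λ₃ e^{-2πi(z+β/2)} + λ₂ + λ₁ e^{2πi(z+β/2)}` of extended Harper's model. -/
def harperC (lam1 lam2 lam3 β : ℝ) (z : ℂ) : ℂ :=
  (lam3 : ℂ) * Complex.exp (-(2 * (π : ℂ) * Complex.I) * (z + (β : ℂ) / 2)) + (lam2 : ℂ) +
    (lam1 : ℂ) * Complex.exp ((2 * (π : ℂ) * Complex.I) * (z + (β : ℂ) / 2))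

/-- `c̃(z) = λ₃ e^{2πi(z+β/2)} + λ₂ + λ₁ e^{-2πi(z+β/2)}`, the entire extension of
`x ↦ conj (c x)` from `ℝ`. -/
def harperCt (lam1 lam2 lam3 β : ℝ) (z : ℂ) : ℂ :=
  (lam3 : ℂ) * Complex.exp ((2 * (π : ℂ) * Complex.I) * (z + (β : ℂ) / 2)) + (lam2 : ℂ) +
    (lam1 : ℂ) * Complex.exp (-(2 * (π : ℂ) * Complex.I) * (z + (β : ℂ) / 2))

/-- The transfer matrix `A^E(z) = [[E - 2cos(2πz), -c̃(z-β)], [c(z), 0]]`. -/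
def harperA (lam1 lam2 lam3 β : ℝ) (E : ℂ) (z : ℂ) : Matrix (Fin 2) (Fin 2) ℂ :=
  !![E - 2 * Complex.cos (2 * (π : ℂ) * z), -harperCt lam1 lam2 lam3 β (z - (β : ℂ));
     harperC lam1 lam2 lam3 β z, 0]

section MatrixNorm

variable (M N W : Matrix (Fin 2) (Fin 2) ℂ)

theorem frobenius_norm_sq :
    ‖M‖ ^ 2 = ‖M 0 0‖ ^ 2 + ‖M 0 1‖ ^ 2 + ‖M 1 0‖ ^ 2 + ‖M 1 1‖ ^ 2 := by
  have hnn : 0 ≤ ∑ i, ∑ j, ‖M i j‖ ^ (2 : ℝ) := by positivity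
  rw [Matrix.frobenius_norm_def, ← Real.sqrt_eq_rpow, Real.sq_sqrt hnn]
  simp [Fin.sum_univ_two]
  ring

theorem frobenius_norm_eq_sqrt :
    ‖M‖ = √(‖M 0 0‖ ^ 2 + ‖M 0 1‖ ^ 2 + ‖M 1 0‖ ^ 2 + ‖M 1 1‖ ^ 2) := by
  rw [← frobenius_norm_sq, Real.sqrt_sq (norm_nonneg _)]

theorem frobenius_norm_apply_le (i j : Fin 2) : ‖M i j‖ ≤ ‖M‖ := by
  apply le_of_sq_le_sq _ (norm_nonneg _)
  rw [frobenius_norm_sq]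
  fin_cases i <;> fin_cases j <;> simp <;> nlinarith [sq_nonneg ‖M 0 0‖, sq_nonneg ‖M 0 1‖,
    sq_nonneg ‖M 1 0‖, sq_nonneg ‖M 1 1‖]

theorem frobenius_norm_le_of_apply_le {a : ℝ} (h : ∀ i j, ‖M i j‖ ≤ a) : ‖M‖ ≤ 2 * a := by
  have ha : 0 ≤ a := (norm_nonneg _).trans (h 0 0)
  apply le_of_sq_le_sq _ (by positivity)
  rw [frobenius_norm_sq]
  have := fun i j => pow_le_pow_left₀ (norm_nonneg _) (h i j) 2
  nlinarith [this 0 0, this 0 1, this 1 0, this 1 1]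

theorem frobenius_norm_adjugate : ‖M.adjugate‖ = ‖M‖ := by
  rw [frobenius_norm_eq_sqrt, frobenius_norm_eq_sqrt, Matrix.adjugate_fin_two]
  simp
  ring_nf

theorem norm_det_le_frobenius_norm_sq : ‖M.det‖ ≤ ‖M‖ ^ 2 := by
  rw [Matrix.det_fin_two, frobenius_norm_sq]
  calc _ ≤ ‖M 0 0 * M 1 1‖ + ‖M 0 1 * M 1 0‖ := norm_sub_le _ _
    _ ≤ _ := by
      rw [norm_mul, norm_mul]
      nlinarith [sq_nonneg (‖M 0 0‖ - ‖M 1 1‖), sq_nonneg (‖M 0 1‖ - ‖M 1 0‖)]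

theorem mul_conjTranspose_add_adjugate :
    W * W.conjTranspose + W.adjugate.conjTranspose * W.adjugate
      = ((‖W‖ ^ 2 : ℝ) : ℂ) • (1 : Matrix (Fin 2) (Fin 2) ℂ) := by
  rw [frobenius_norm_sq, Matrix.adjugate_fin_two]
  have h : ∀ z : ℂ, ((‖z‖ ^ 2 : ℝ) : ℂ) = z * (starRingEnd ℂ) z := fun z => by
    rw [Complex.mul_conj, Complex.normSq_eq_norm_sq]
  push_cast at h ⊢
  rw [h, h, h, h]
  ext i j
  fin_cases i <;> fin_cases j <;>
    simp [Matrix.mul_apply, Fin.sum_univ_two, Matrix.conjTranspose_apply] <;> ring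

/-- A vector (encoded as a nonzero matrix `W`) along which a product is large must either be
expanded by the left factor or be contracted backwards by the right one. -/
theorem frobenius_norm_mul_product_le :
    ‖W‖ * ‖N * M‖ ≤ ‖N * W‖ * ‖M‖ + ‖N‖ * ‖M.adjugate * W‖ := by
  rcases eq_or_ne W 0 with rfl | hW
  · simp
  have hW' : 0 < ‖W‖ := norm_pos_iff.2 hW
  have key : (((‖W‖ ^ 2 : ℝ) : ℂ)) • (N * M)
      = (N * W) * (W.conjTranspose * M)
        + N * (W.adjugate.conjTranspose * (W.adjugate * M)) := by
    have := mul_conjTranspose_add_adjugate W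
    calc _ = N * ((((‖W‖ ^ 2 : ℝ) : ℂ)) • (1 : Matrix (Fin 2) (Fin 2) ℂ)) * M := by simp
      _ = _ := by rw [← this]; noncomm_ring
  have h2 : ‖W.adjugate * M‖ = ‖M.adjugate * W‖ := by
    rw [← frobenius_norm_adjugate, Matrix.adjugate_mul_distrib]
    congr 2
    rw [Matrix.adjugate_adjugate' W]
    simp
  have h3 : ‖W‖ ^ 2 * ‖N * M‖ ≤ ‖N * W‖ * (‖W‖ * ‖M‖) + ‖N‖ * (‖W‖ * ‖M.adjugate * W‖) := by
    have e : ‖(((‖W‖ ^ 2 : ℝ) : ℂ)) • (N * M)‖ = ‖W‖ ^ 2 * ‖N * M‖ := by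
      simp only [frobenius_norm_eq_sqrt (_ • _), Matrix.smul_apply, smul_eq_mul, norm_mul, mul_pow,
        ← mul_add]
      rw [Real.sqrt_mul (by positivity), Real.sqrt_sq (by positivity), ← frobenius_norm_eq_sqrt]
      simp
    rw [← e, key]
    refine (norm_add_le _ _).trans (add_le_add ?_ ?_)
    · refine (Matrix.frobenius_norm_mul _ _).trans ?_
      gcongr
      refine (Matrix.frobenius_norm_mul _ _).trans ?_
      rw [Matrix.frobenius_norm_conjTranspose]
    · refine (Matrix.frobenius_norm_mul _ _).trans ?_
      gcongr
      refine (Matrix.frobenius_norm_mul _ _).trans ?_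
      rw [Matrix.frobenius_norm_conjTranspose, frobenius_norm_adjugate, h2]
  nlinarith [h3]

/-- The two eigenvalues of a `2 × 2` matrix, with (matrices of) eigenvectors. -/
theorem exists_eigenvalues :
    ∃ x y : ℂ, x + y = M.trace ∧ x * y = M.det ∧
      (∃ W, W ≠ 0 ∧ M * W = x • W) ∧ (∃ W, W ≠ 0 ∧ M * W = y • W) := by
  obtain ⟨s, hs⟩ := IsAlgClosed.exists_pow_nat_eq (M.trace ^ 2 - 4 * M.det) (n := 2) (by norm_num)
  have hmul : ∀ x y : ℂ, x + y = M.trace → x * y = M.det → ∃ W, W ≠ 0 ∧ M * W = x • W := by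
    intro x y h1 h2
    by_cases hM : M - y • (1 : Matrix (Fin 2) (Fin 2) ℂ) = 0
    · refine ⟨1, one_ne_zero, ?_⟩
      have hM' := sub_eq_zero.1 hM
      have : x = y := by
        rw [hM'] at h1
        simp at h1
        linear_combination h1
      rw [mul_one, this, ← hM']
    · refine ⟨_, hM, ?_⟩
      rw [Matrix.trace_fin_two] at h1
      rw [Matrix.det_fin_two] at h2
      ext i j
      fin_cases i <;> fin_cases j <;>
        simp [Matrix.mul_apply, Fin.sum_univ_two, Matrix.one_apply]
      · linear_combination (-M 0 0) * h1 + h2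
      · linear_combination (-M 0 1) * h1
      · linear_combination (-M 1 0) * h1
      · linear_combination (-M 1 1) * h1 + h2
  have e1 : (M.trace + s) / 2 + (M.trace - s) / 2 = M.trace := by ring
  have e2 : (M.trace + s) / 2 * ((M.trace - s) / 2) = M.det := by
    linear_combination (-1 / 4) * hs
  exact ⟨_, _, e1, e2, hmul _ _ e1 e2, hmul _ _ (by rw [add_comm, e1]) (by rw [mul_comm, e2])⟩

end MatrixNorm

/-- The `n`-step iterate of the multiplicative cocycle `(σ, B)` on `ℂ`. -/
def mulIter (B : ℂ → Matrix (Fin 2) (Fin 2) ℂ) (σ : ℂ) : ℕ → ℂ → Matrix (Fin 2) (Fin 2) ℂ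
  | 0, _ => 1
  | n + 1, w => mulIter B σ n (σ * w) * B w

section MulIter

variable (B : ℂ → Matrix (Fin 2) (Fin 2) ℂ) (σ : ℂ)

theorem mulIter_add (n m : ℕ) (w : ℂ) :
    mulIter B σ (n + m) w = mulIter B σ n (σ ^ m * w) * mulIter B σ m w := by
  induction m generalizing w with
  | zero => simp [mulIter]
  | succ m ih =>
    rw [← add_assoc]
    simp only [mulIter]
    rw [ih, mul_assoc, pow_succ, mul_assoc]

theorem mulIter_one (w : ℂ) : mulIter B σ 1 w = B w := by simp [mulIter]

theorem mulIter_succ_left (n : ℕ) (w : ℂ) :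
    mulIter B σ (n + 1) w = B (σ ^ n * w) * mulIter B σ n w := by
  rw [add_comm, mulIter_add, mulIter_one]

theorem det_mulIter (n : ℕ) (w : ℂ) :
    (mulIter B σ n w).det = ∏ k ∈ Finset.range n, (B (σ ^ k * w)).det := by
  induction n with
  | zero => simp [mulIter]
  | succ n ih => rw [mulIter_succ_left, Matrix.det_mul, ih, Finset.prod_range_succ, mul_comm]

theorem norm_mulIter_add_le (n m : ℕ) (w : ℂ) :
    ‖mulIter B σ (n + m) w‖ ≤ ‖mulIter B σ n (σ ^ m * w)‖ * ‖mulIter B σ m w‖ := by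
  rw [mulIter_add]
  exact Matrix.frobenius_norm_mul _ _

end MulIter

section CircleLog

open Polynomial

/-- The average of `log ‖F‖` over the circle of radius `r` around the origin. -/
def avgLog (F : ℂ[X]) (r : ℝ) : ℝ := Real.circleAverage (fun w => Real.log ‖F.eval w‖) 0 r

theorem circleIntegrable_log_norm_eval (F : ℂ[X]) (c : ℂ) (r : ℝ) :
    CircleIntegrable (fun w => Real.log ‖F.eval w‖) c r :=
  (analyticOnNhd_id.aeval_polynomial F).meromorphicOn.circleIntegrable_log_norm

theorem log_max_eq_log_add_posLog {r a : ℝ} (hr : 0 < r) (ha : 0 ≤ a) :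
    Real.log (max r a) = Real.log r + Real.posLog (r⁻¹ * a) := by
  rw [Real.posLog_eq_log_max_one (by positivity), ← Real.log_mul hr.ne' (by positivity)]
  congr 1
  rw [mul_max_of_nonneg _ _ hr.le, mul_one, mul_inv_cancel_left₀ hr.ne']

theorem avgLog_eq {F : ℂ[X]} (hF : F ≠ 0) {r : ℝ} (hr : 0 < r) :
    avgLog F r = Real.log ‖F.leadingCoeff‖
      + (F.roots.map fun a => Real.log (max r ‖a‖)).sum := by
  have hcomp : avgLog F r = (F.comp (C (r : ℂ) * X)).logMahlerMeasure := by
    rw [avgLog, Real.circleAverage_eq_circleAverage_zero_one, logMahlerMeasure_def]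
    simp
  have hlin : ∀ a : ℂ, ((X - C a).comp (C (r : ℂ) * X)).logMahlerMeasure
      = Real.log (max r ‖a‖) := by
    intro a
    rw [logMahlerMeasure_def]
    have := circleAverage_log_norm_sub_const_eq_log_radius_add_posLog (a := a) (c := 0) hr.ne'
    rw [Real.circleAverage_eq_circleAverage_zero_one] at this
    simp only [add_zero, zero_sub, norm_neg] at this
    rw [log_max_eq_log_add_posLog hr (norm_nonneg _), ← this]
    simp
  rw [hcomp]
  conv_lhs => rw [(IsAlgClosed.splits F).eq_prod_roots]
  have hr' : (r : ℂ) ≠ 0 := by exact_mod_cast hr.ne'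
  have hne : ∀ G : ℂ[X], G ≠ 0 → G.comp (C (r : ℂ) * X) ≠ 0 := by
    intro G hG h
    apply hG
    rw [comp_eq_zero_iff] at h
    rcases h with h | ⟨-, h⟩
    · exact h
    · have := congrArg (fun p => p.coeff 1) h
      simp [hr', coeff_C] at this
  have hprod : ∀ s : Multiset ℂ,
      (((s.map fun a => X - C a).prod).comp (C (r : ℂ) * X)).logMahlerMeasure
        = (s.map fun a => Real.log (max r ‖a‖)).sum := by
    intro s
    induction s using Multiset.induction_on with
    | empty => simp
    | cons a s ih =>
      rw [Multiset.map_cons, Multiset.prod_cons, mul_comp,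
        logMahlerMeasure_mul_eq_add_logMahlerMeasure, ih, hlin]
      · simp
      · refine mul_ne_zero (hne _ (X_sub_C_ne_zero a)) (hne _ ?_)
        exact (monic_multiset_prod_of_monic _ _ fun a _ => monic_X_sub_C a).ne_zero
  rw [mul_comp, C_comp, logMahlerMeasure_C_mul (by simpa using hF), hprod]
  apply hne
  exact (monic_multiset_prod_of_monic _ _ fun a _ => monic_X_sub_C a).ne_zero

theorem norm_eval_eq_prod_roots (F : ℂ[X]) (w : ℂ) :
    ‖F.eval w‖ = ‖F.leadingCoeff‖ * (F.roots.map fun a => ‖w - a‖).prod := by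
  rw [(IsAlgClosed.splits F).eval_eq_prod_roots, norm_mul]
  congr 1
  simpa using Multiset.prod_hom (F.roots.map fun x => w - x) (normHom : ℂ →*₀ ℝ) |>.symm

theorem log_norm_eval_eq {F : ℂ[X]} {w : ℂ} (hw : F.eval w ≠ 0) :
    Real.log ‖F.eval w‖
      = Real.log ‖F.leadingCoeff‖ + (F.roots.map fun a => Real.log ‖w - a‖).sum := by
  have hF : F ≠ 0 := by rintro rfl; simp at hw
  have hne : ∀ a ∈ F.roots, ‖w - a‖ ≠ 0 := by
    intro a ha h
    rw [norm_eq_zero, sub_eq_zero] at h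
    exact hw (h ▸ (mem_roots hF).1 ha)
  have hlog : ∀ s : Multiset ℂ, (∀ a ∈ s, ‖w - a‖ ≠ 0) →
      (s.map fun a => ‖w - a‖).prod ≠ 0 ∧
      Real.log (s.map fun a => ‖w - a‖).prod = (s.map fun a => Real.log ‖w - a‖).sum := by
    intro s
    induction s using Multiset.induction_on with
    | empty => simp
    | cons a s ih =>
      intro h
      have h1 := h a (Multiset.mem_cons_self a s)
      obtain ⟨h2, h3⟩ := ih fun b hb => h b (Multiset.mem_cons_of_mem hb)
      simp only [Multiset.map_cons, Multiset.prod_cons, Multiset.sum_cons]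
      exact ⟨mul_ne_zero h1 h2, by rw [Real.log_mul h1 h2, h3]⟩
  rw [norm_eval_eq_prod_roots, Real.log_mul (by simpa using hF) (hlog _ hne).1, (hlog _ hne).2]

theorem log_norm_coeff_zero_le_avgLog {F : ℂ[X]} (hF : F.coeff 0 ≠ 0) {r : ℝ} (hr : 0 < r) :
    Real.log ‖F.coeff 0‖ ≤ avgLog F r := by
  have hF' : F ≠ 0 := by rintro rfl; simp at hF
  rw [coeff_zero_eq_eval_zero] at hF ⊢
  rw [avgLog_eq hF' hr, log_norm_eval_eq hF]
  gcongr
  apply Multiset.sum_map_le_sum_map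
  intro a ha
  have ha0 : a ≠ 0 := by
    rintro rfl
    exact hF ((mem_roots hF').1 ha)
  simp only [zero_sub, norm_neg]
  exact Real.log_le_log (norm_pos_iff.2 ha0) (le_max_right _ _)

theorem two_mul_avgLog_one_le {F : ℂ[X]} (hF : F ≠ 0) {r : ℝ} (hr : 0 < r) :
    2 * avgLog F 1 ≤ avgLog F r + avgLog F r⁻¹ := by
  have hr' : 0 < r⁻¹ := inv_pos.2 hr
  rw [avgLog_eq hF one_pos, avgLog_eq hF hr, avgLog_eq hF hr']
  have : (F.roots.map fun a => 2 * Real.log (max 1 ‖a‖)).sum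
      ≤ (F.roots.map fun a => Real.log (max r ‖a‖) + Real.log (max r⁻¹ ‖a‖)).sum := by
    apply Multiset.sum_map_le_sum_map
    intro a _
    have h : ∀ x : ℝ, 0 < x → 0 < max x ‖a‖ := fun x hx => lt_of_lt_of_le hx (le_max_left _ _)
    rw [← Real.log_mul (h r hr).ne' (h _ hr').ne', ← Nat.cast_two, ← Real.log_pow]
    apply Real.log_le_log (pow_pos (h 1 one_pos) 2)
    have hrr : r * r⁻¹ = 1 := mul_inv_cancel₀ hr.ne'
    rcases le_total 1 ‖a‖ with h1 | h1
    · rw [max_eq_right h1]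
      nlinarith [le_max_right r ‖a‖, le_max_right r⁻¹ ‖a‖, norm_nonneg a]
    · rw [max_eq_left h1]
      calc (1 : ℝ) ^ 2 = r * r⁻¹ := by rw [hrr]; norm_num
        _ ≤ _ := mul_le_mul (le_max_left _ _) (le_max_left _ _) hr'.le (h r hr).le
  rw [Multiset.sum_map_mul_left, Multiset.sum_map_add] at this
  linarith

theorem avgLog_le_avgLog_one_add {F : ℂ[X]} (hF : F ≠ 0) {r : ℝ} (hr : 0 < r) :
    avgLog F r ≤ avgLog F 1 + F.natDegree * Real.posLog r := by
  rw [avgLog_eq hF one_pos, avgLog_eq hF hr, add_assoc]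
  gcongr
  have : (F.roots.map fun a => Real.log (max r ‖a‖)).sum
      ≤ (F.roots.map fun a => Real.log (max 1 ‖a‖) + Real.posLog r).sum := by
    apply Multiset.sum_map_le_sum_map
    intro a _
    have hm : 0 < max 1 r := lt_of_lt_of_le one_pos (le_max_left _ _)
    have hm' : 0 < max 1 ‖a‖ := lt_of_lt_of_le one_pos (le_max_left _ _)
    rw [Real.posLog_eq_log_max_one hr.le, ← Real.log_mul hm'.ne' hm.ne']
    apply Real.log_le_log (lt_of_lt_of_le hr (le_max_left _ _))
    apply max_le
    · nlinarith [le_max_right 1 r, le_max_left 1 ‖a‖]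
    · nlinarith [le_max_left 1 r, le_max_right 1 ‖a‖]
  rw [Multiset.sum_map_add] at this
  simp only [Multiset.map_const', Multiset.sum_replicate, nsmul_eq_mul] at this
  rwa [← (IsAlgClosed.splits F).natDegree_eq_card_roots] at this

theorem prod_range_sub_pow_mul {ω : ℂ} {Q : ℕ} (hQ : 0 < Q) (hω : IsPrimitiveRoot ω Q)
    (x u : ℂ) : ∏ k ∈ Finset.range Q, (x - ω ^ k * u) = x ^ Q - u ^ Q := by
  have h := hω.nthRoots_eq (rfl : u ^ Q = u ^ Q)
  have hm : (X ^ Q - C (u ^ Q) : ℂ[X]).Monic := monic_X_pow_sub_C _ hQ.ne'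
  have := (IsAlgClosed.splits (X ^ Q - C (u ^ Q) : ℂ[X])).eval_eq_prod_roots_of_monic hm x
  rw [nthRoots] at h
  rw [h] at this
  simp only [eval_sub, eval_pow, eval_X, eval_C, Multiset.map_map, Function.comp_def] at this
  rw [this]
  rfl

theorem prod_norm_eval_rotation {ω : ℂ} {Q : ℕ} (hQ : 0 < Q) (hω : IsPrimitiveRoot ω Q)
    (F : ℂ[X]) (u : ℂ) : ∏ k ∈ Finset.range Q, ‖F.eval (ω ^ k * u)‖
      = ‖F.leadingCoeff‖ ^ Q * (F.roots.map fun a => ‖u ^ Q - a ^ Q‖).prod := by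
  simp only [norm_eval_eq_prod_roots, Finset.prod_mul_distrib, Finset.prod_const,
    Finset.card_range]
  congr 1
  rw [← Multiset.prod_map_prod]
  congr 1
  refine Multiset.map_congr rfl fun a _ => ?_
  rw [norm_sub_rev, ← prod_range_sub_pow_mul hQ hω, norm_prod]
  exact Finset.prod_congr rfl fun k _ => norm_sub_rev _ _

theorem exp_mul_avgLog {F : ℂ[X]} (hF : F ≠ 0) {r : ℝ} (hr : 0 < r) (Q : ℕ) :
    Real.exp (Q * avgLog F r)
      = ‖F.leadingCoeff‖ ^ Q * (F.roots.map fun a => max r ‖a‖ ^ Q).prod := by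
  have hexp : ∀ s : Multiset ℂ, Real.exp (s.map fun a => Real.log (max r ‖a‖)).sum
      = (s.map fun a => max r ‖a‖).prod := by
    intro s
    induction s using Multiset.induction_on with
    | empty => simp
    | cons a s ih =>
      simp only [Multiset.map_cons, Multiset.prod_cons, Multiset.sum_cons]
      rw [Real.exp_add, ih, Real.exp_log (lt_of_lt_of_le hr (le_max_left _ _))]
  rw [Real.exp_nat_mul, avgLog_eq hF hr, Real.exp_add, hexp, mul_pow,
    Real.exp_log (by simpa using hF), Multiset.prod_map_pow]

theorem prod_norm_eval_rotation_le {ω : ℂ} {Q : ℕ} (hQ : 0 < Q) (hω : IsPrimitiveRoot ω Q)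
    {F : ℂ[X]} (hF : F ≠ 0) {r : ℝ} (hr : 0 < r) {u : ℂ} (hu : ‖u‖ = r) :
    ∏ k ∈ Finset.range Q, ‖F.eval (ω ^ k * u)‖
      ≤ 2 ^ F.natDegree * Real.exp (Q * avgLog F r) := by
  rw [prod_norm_eval_rotation hQ hω, exp_mul_avgLog hF hr,
    (IsAlgClosed.splits F).natDegree_eq_card_roots, mul_left_comm]
  gcongr
  rw [← Multiset.prod_replicate _ (2 : ℝ), ← Multiset.map_const' F.roots, ← Multiset.prod_map_mul]
  apply Multiset.prod_map_le_prod_map₀ _ _ (fun a _ => norm_nonneg _)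
  intro a _
  calc ‖u ^ Q - a ^ Q‖ ≤ ‖u ^ Q‖ + ‖a ^ Q‖ := norm_sub_le _ _
    _ = r ^ Q + ‖a‖ ^ Q := by rw [norm_pow, norm_pow, hu]
    _ ≤ max r ‖a‖ ^ Q + max r ‖a‖ ^ Q := by gcongr <;> simp
    _ = _ := by ring

theorem eventually_norm_pow_sub_pow_ge {r : ℝ} (hr : 0 < r) {a : ℂ} (ha : ‖a‖ ≠ r) :
    ∀ᶠ Q : ℕ in atTop, ∀ u : ℂ, ‖u‖ = r → 2⁻¹ * max r ‖a‖ ^ Q ≤ ‖u ^ Q - a ^ Q‖ := by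
  have hlim : ∀ x : ℝ, 0 ≤ x → x < 1 → ∀ᶠ Q : ℕ in atTop, x ^ Q < 1 / 2 := fun x hx hx1 =>
    (tendsto_pow_atTop_nhds_zero_of_lt_one hx hx1).eventually_lt_const (by norm_num)
  have ratio : ∀ x y : ℝ, 0 ≤ x → x < y → ∀ᶠ Q : ℕ in atTop, x ^ Q ≤ 2⁻¹ * y ^ Q := by
    intro x y hx hxy
    have hy : 0 < y := lt_of_le_of_lt hx hxy
    filter_upwards [hlim (x / y) (by positivity) ((div_lt_one hy).2 hxy)] with Q hQ
    rw [div_pow, div_lt_iff₀ (by positivity)] at hQ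
    linarith
  rcases lt_or_gt_of_ne ha with h | h
  · filter_upwards [ratio _ _ (norm_nonneg a) h] with Q hQ u hu
    rw [max_eq_left h.le]
    have := norm_sub_norm_le (u ^ Q) (a ^ Q)
    rw [norm_pow, norm_pow, hu] at this
    linarith
  · filter_upwards [ratio _ _ hr.le h] with Q hQ u hu
    rw [max_eq_right h.le]
    have := norm_sub_norm_le (a ^ Q) (u ^ Q)
    rw [norm_pow, norm_pow, hu, norm_sub_rev] at this
    linarith

theorem eventually_prod_norm_eval_rotation_ge {F : ℂ[X]} (hF : F ≠ 0) {r : ℝ} (hr : 0 < r)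
    (hroots : ∀ a ∈ F.roots, ‖a‖ ≠ r) :
    ∀ᶠ Q : ℕ in atTop, ∀ ω : ℂ, IsPrimitiveRoot ω Q → ∀ u : ℂ, ‖u‖ = r →
      (2⁻¹ : ℝ) ^ F.natDegree * Real.exp (Q * avgLog F r)
        ≤ ∏ k ∈ Finset.range Q, ‖F.eval (ω ^ k * u)‖ := by
  have hall : ∀ᶠ Q : ℕ in atTop, ∀ a ∈ F.roots.toFinset, ∀ u : ℂ, ‖u‖ = r →
      2⁻¹ * max r ‖a‖ ^ Q ≤ ‖u ^ Q - a ^ Q‖ := by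
    rw [Filter.eventually_all_finset]
    intro a ha
    exact eventually_norm_pow_sub_pow_ge hr (hroots a (Multiset.mem_toFinset.1 ha))
  filter_upwards [hall, eventually_gt_atTop 0] with Q h hQ ω hω u hu
  rw [prod_norm_eval_rotation hQ hω, exp_mul_avgLog hF hr,
    (IsAlgClosed.splits F).natDegree_eq_card_roots, mul_left_comm]
  gcongr
  rw [← Multiset.prod_replicate _ (2⁻¹ : ℝ), ← Multiset.map_const' F.roots, ← Multiset.prod_map_mul]
  apply Multiset.prod_map_le_prod_map₀
  · intro a _
    have := lt_of_lt_of_le hr (le_max_left r ‖a‖)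
    positivity
  · intro a ha
    exact h a (Multiset.mem_toFinset.2 ha) u hu

end CircleLog

section CircleParam

theorem circleAverage_eq_setIntegral (f : ℂ → ℝ) (r : ℝ) :
    Real.circleAverage f 0 r = ∫ x in Set.Ioc (0 : ℝ) 1, f (circleMap 0 r (2 * π * x)) := by
  rw [← intervalIntegral.integral_of_le zero_le_one,
    intervalIntegral.integral_comp_mul_left (fun θ => f (circleMap 0 r θ)) (by positivity),
    Real.circleAverage_def]
  simp

theorem CircleIntegrable.integrableOn_Ioc {f : ℂ → ℝ} {r : ℝ} (hf : CircleIntegrable f 0 r) :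
    IntegrableOn (fun x : ℝ => f (circleMap 0 r (2 * π * x))) (Set.Ioc 0 1) := by
  rw [circleIntegrable_def] at hf
  have := hf.comp_mul_left (c := 2 * π)
  rwa [zero_div, div_self (by positivity), intervalIntegrable_iff_integrableOn_Ioc_of_le
    zero_le_one] at this

theorem ae_circleMap_notMem {S : Set ℂ} (hS : S.Countable) {r : ℝ} (hr : r ≠ 0) (s : Set ℝ) :
    ∀ᵐ x ∂volume.restrict s, circleMap 0 r (2 * π * x) ∉ S := by
  apply ae_restrict_of_ae
  have h1 := hS.preimage_circleMap 0 hr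
  have h2 : ((fun x : ℝ => 2 * π * x) ⁻¹' (circleMap 0 r ⁻¹' S)).Countable :=
    h1.preimage (mul_right_injective₀ (by positivity))
  exact (h2.ae_notMem volume)

/-- Monotonicity of circle averages, ignoring a countable set. -/
theorem circleAverage_le_of_countable {f g : ℂ → ℝ} {r : ℝ} (hr : r ≠ 0)
    (hf : CircleIntegrable f 0 r) (hg : CircleIntegrable g 0 r) {S : Set ℂ} (hS : S.Countable)
    (h : ∀ w ∉ S, ‖w‖ = |r| → f w ≤ g w) :
    Real.circleAverage f 0 r ≤ Real.circleAverage g 0 r := by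
  rw [circleAverage_eq_setIntegral, circleAverage_eq_setIntegral]
  apply integral_mono_ae hf.integrableOn_Ioc hg.integrableOn_Ioc
  filter_upwards [ae_circleMap_notMem hS hr (Set.Ioc 0 1)] with x hx
  exact h _ hx (by simp)

theorem integral_le_of_lintegral_ofReal_le {α : Type*} [MeasurableSpace α] {μ : Measure α}
    {f : α → ℝ} (hf : Integrable f μ) {a : ℝ} (ha : 0 ≤ a)
    (h : ∫⁻ x, ENNReal.ofReal (f x) ∂μ ≤ ENNReal.ofReal a) : ∫ x, f x ∂μ ≤ a := by
  rw [integral_eq_lintegral_pos_part_sub_lintegral_neg_part hf]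
  have := ENNReal.toReal_mono ENNReal.ofReal_ne_top h
  rw [ENNReal.toReal_ofReal ha] at this
  linarith [ENNReal.toReal_nonneg (a := ∫⁻ x, ENNReal.ofReal (-f x) ∂μ)]

end CircleParam

section PolyMatrix

open Polynomial

/-- Entrywise evaluation of a matrix of polynomials. -/
def matEval (P : Matrix (Fin 2) (Fin 2) ℂ[X]) (w : ℂ) : Matrix (Fin 2) (Fin 2) ℂ :=
  P.map (eval w)

theorem matEval_apply (P : Matrix (Fin 2) (Fin 2) ℂ[X]) (w : ℂ) (i j : Fin 2) :
    matEval P w i j = (P i j).eval w := rfl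

/-- The average of `log ‖P‖` over the circle of radius `r` around the origin. -/
def avgLogMat (P : Matrix (Fin 2) (Fin 2) ℂ[X]) (r : ℝ) : ℝ :=
  Real.circleAverage (fun w => Real.log ‖matEval P w‖) 0 r

variable (P : Matrix (Fin 2) (Fin 2) ℂ[X])

theorem circleIntegrable_log_norm_matEval (r : ℝ) :
    CircleIntegrable (fun w => Real.log ‖matEval P w‖) 0 r := by
  set f : ℂ → EuclideanSpace ℂ (Fin 2 × Fin 2) :=
    fun w => WithLp.toLp 2 fun ij => (P ij.1 ij.2).eval w with hf
  have hd : Differentiable ℂ f := by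
    rw [differentiable_euclidean]
    intro ij
    simp only [hf]
    exact (P ij.1 ij.2).differentiable
  have hn : ∀ w, ‖matEval P w‖ = ‖f w‖ := by
    intro w
    rw [frobenius_norm_eq_sqrt, EuclideanSpace.norm_eq]
    simp [hf, matEval_apply, Fintype.sum_prod_type, Fin.sum_univ_two, add_assoc]
  simp only [hn]
  exact (AnalyticOnNhd.meromorphicOn fun w _ => hd.analyticAt w).circleIntegrable_log_norm

theorem continuous_norm_matEval : Continuous fun w => ‖matEval P w‖ := by
  simp only [frobenius_norm_eq_sqrt, matEval_apply]
  fun_prop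

theorem countable_matEval_eq_zero {P : Matrix (Fin 2) (Fin 2) ℂ[X]} {i j : Fin 2}
    (h : P i j ≠ 0) : {w | matEval P w = 0}.Countable := by
  refine Set.Countable.mono ?_ (P i j).roots.toFinset.countable_toSet
  intro w hw
  simp only [Finset.mem_coe, Multiset.mem_toFinset, mem_roots h]
  exact congrFun (congrFun hw i) j

theorem avgLog_le_avgLogMat {i j : Fin 2} (h : P i j ≠ 0) {r : ℝ} (hr : r ≠ 0) :
    avgLog (P i j) r ≤ avgLogMat P r := by
  refine circleAverage_le_of_countable hr (circleIntegrable_log_norm_eval _ _ _)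
    (circleIntegrable_log_norm_matEval P r) (P i j).roots.toFinset.countable_toSet ?_
  intro w hw _
  simp only [Finset.mem_coe, Multiset.mem_toFinset, mem_roots h] at hw
  exact Real.log_le_log (norm_pos_iff.2 hw) (frobenius_norm_apply_le (matEval P w) i j)

/-- The linear combination of the entries of `P` with coefficients `1, t, t², t³`. -/
def combo (t : ℂ) : ℂ[X] :=
  P 0 0 + C t * P 0 1 + C (t ^ 2) * P 1 0 + C (t ^ 3) * P 1 1

/-- The same combination for a constant matrix, as a polynomial in the parameter. -/
def comboPoly (M : Matrix (Fin 2) (Fin 2) ℂ) : ℂ[X] :=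
  C (M 0 0) + C (M 0 1) * X + C (M 1 0) * X ^ 2 + C (M 1 1) * X ^ 3

theorem eval_combo (t w : ℂ) : (combo P t).eval w = (comboPoly (matEval P w)).eval t := by
  simp [combo, comboPoly, matEval_apply]
  ring

theorem norm_eval_comboPoly_le (M : Matrix (Fin 2) (Fin 2) ℂ) {t : ℂ} (ht : ‖t‖ = 1) :
    ‖(comboPoly M).eval t‖ ≤ 2 * ‖M‖ := by
  have h : ‖(comboPoly M).eval t‖ ≤ ‖M 0 0‖ + ‖M 0 1‖ + ‖M 1 0‖ + ‖M 1 1‖ := by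
    simp only [comboPoly, eval_add, eval_mul, eval_C, eval_X, eval_pow]
    refine (norm_add_le _ _).trans (add_le_add ((norm_add_le _ _).trans (add_le_add
      ((norm_add_le _ _).trans ?_) ?_)) ?_) <;> simp [ht]
  refine h.trans (le_of_sq_le_sq ?_ (by positivity))
  rw [mul_pow, frobenius_norm_sq]
  nlinarith [sq_nonneg (‖M 0 0‖ - ‖M 0 1‖), sq_nonneg (‖M 0 0‖ - ‖M 1 0‖),
    sq_nonneg (‖M 0 0‖ - ‖M 1 1‖), sq_nonneg (‖M 0 1‖ - ‖M 1 0‖),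
    sq_nonneg (‖M 0 1‖ - ‖M 1 1‖), sq_nonneg (‖M 1 0‖ - ‖M 1 1‖)]

theorem norm_le_mahlerMeasure_comboPoly (M : Matrix (Fin 2) (Fin 2) ℂ) :
    ‖M‖ ≤ 6 * (comboPoly M).mahlerMeasure := by
  have hdeg : (comboPoly M).natDegree ≤ 3 := by
    unfold comboPoly
    compute_degree
  have hc : ∀ n, ‖(comboPoly M).coeff n‖ ≤ 3 * (comboPoly M).mahlerMeasure := by
    intro n
    refine (norm_coeff_le_choose_mul_mahlerMeasure n _).trans ?_
    gcongr
    · exact mahlerMeasure_nonneg _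
    · have : ∀ d ≤ 3, d.choose n ≤ 3 := by
        intro d hd
        rcases le_or_gt n 3 with hn | hn
        · interval_cases d <;> interval_cases n <;> simp [Nat.choose]
        · rw [Nat.choose_eq_zero_of_lt (by omega)]; omega
      exact_mod_cast this _ hdeg
  have := frobenius_norm_le_of_apply_le M (a := 3 * (comboPoly M).mahlerMeasure) (by
    intro i j
    fin_cases i <;> fin_cases j
    · simpa [comboPoly, coeff_X, coeff_C] using hc 0
    · simpa [comboPoly, coeff_X, coeff_C, coeff_X_pow] using hc 1
    · simpa [comboPoly, coeff_X, coeff_C, coeff_X_pow] using hc 2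
    · simpa [comboPoly, coeff_X, coeff_C, coeff_X_pow] using hc 3)
  linarith

theorem comboPoly_ne_zero {M : Matrix (Fin 2) (Fin 2) ℂ} (hM : M ≠ 0) : comboPoly M ≠ 0 := by
  intro h
  have := norm_le_mahlerMeasure_comboPoly M
  rw [h, mahlerMeasure_zero, mul_zero, norm_le_zero_iff] at this
  exact hM this

theorem lintegral_log_comboPoly_le {M : Matrix (Fin 2) (Fin 2) ℂ} (hM : M ≠ 0) :
    ∫⁻ y in Set.Ioc (0 : ℝ) 1, ENNReal.ofReal (Real.log (2 * ‖M‖)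
      - Real.log ‖(comboPoly M).eval (circleMap 0 1 (2 * π * y))‖) ≤ ENNReal.ofReal (Real.log 12) := by
  have hp := comboPoly_ne_zero hM
  have hM' : 0 < ‖M‖ := norm_pos_iff.2 hM
  have hint := (circleIntegrable_log_norm_eval (comboPoly M) 0 1).integrableOn_Ioc
  rw [← ofReal_integral_eq_lintegral_ofReal]
  · apply ENNReal.ofReal_le_ofReal
    rw [integral_sub (integrable_const _) hint,
      ← circleAverage_eq_setIntegral (fun w => Real.log ‖(comboPoly M).eval w‖),
      ← logMahlerMeasure_def, logMahlerMeasure_eq_log_MahlerMeasure]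
    have hm := mahlerMeasure_pos_of_ne_zero hp
    have h6 : Real.log (2 * ‖M‖) ≤ Real.log (12 * (comboPoly M).mahlerMeasure) :=
      Real.log_le_log (by positivity) (by linarith [norm_le_mahlerMeasure_comboPoly M])
    rw [Real.log_mul (by norm_num) hm.ne'] at h6
    simp
    linarith
  · exact (integrable_const _).sub hint
  · filter_upwards [ae_circleMap_notMem (comboPoly M).roots.toFinset.countable_toSet one_ne_zero
      (Set.Ioc 0 1)] with y hy
    simp only [Finset.mem_coe, Multiset.mem_toFinset, mem_roots hp] at hy
    have := Real.log_le_log (norm_pos_iff.2 hy)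
      (norm_eval_comboPoly_le M (t := circleMap 0 1 (2 * π * y)) (by simp))
    simpa using this

/-- Some unimodular combination of the entries captures `avgLogMat` on finitely many circles
simultaneously. -/
theorem exists_combo_avgLog_ge {P : Matrix (Fin 2) (Fin 2) ℂ[X]} {i j : Fin 2} (hP : P i j ≠ 0)
    (S : Finset ℝ) (hS : ∀ r ∈ S, r ≠ 0) :
    ∃ t : ℂ, ‖t‖ = 1 ∧ combo P t ≠ 0 ∧
      ∀ r ∈ S, avgLogMat P r - S.card * Real.log 12 ≤ avgLog (combo P t) r := by
  have hprob : IsProbabilityMeasure (volume.restrict (Set.Ioc (0 : ℝ) 1)) := ⟨by simp⟩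
  set K : ℝ → ℝ → ℝ → ℝ := fun r y x =>
    Real.log (2 * ‖matEval P (circleMap 0 r (2 * π * x))‖)
      - Real.log ‖(combo P (circleMap 0 1 (2 * π * y))).eval (circleMap 0 r (2 * π * x))‖ with hK
  have hmeas : ∀ r, Measurable (Function.uncurry fun y x => ENNReal.ofReal (K r y x)) := by
    intro r
    have h1 : Measurable fun p : ℝ × ℝ =>
        Real.log (2 * ‖matEval P (circleMap 0 r (2 * π * p.2))‖) := by
      apply Real.measurable_log.comp
      apply Continuous.measurable
      have := (continuous_norm_matEval P).comp
        (g := fun w => ‖matEval P w‖) (f := fun p : ℝ × ℝ => circleMap 0 r (2 * π * p.2))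
        (by fun_prop)
      exact continuous_const.mul this
    have h2 : Measurable fun p : ℝ × ℝ => Real.log
        ‖(combo P (circleMap 0 1 (2 * π * p.1))).eval (circleMap 0 r (2 * π * p.2))‖ := by
      apply Real.measurable_log.comp
      apply Continuous.measurable
      simp only [combo, eval_add, eval_mul, eval_C]
      fun_prop
    exact ENNReal.measurable_ofReal.comp (h1.sub h2)
  have hle : ∀ r ∈ S, ∫⁻ y in Set.Ioc (0 : ℝ) 1, ∫⁻ x in Set.Ioc (0 : ℝ) 1,
      ENNReal.ofReal (K r y x) ≤ ENNReal.ofReal (Real.log 12) := by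
    intro r hr
    rw [lintegral_lintegral_swap (hmeas r).aemeasurable]
    calc _ ≤ ∫⁻ _ in Set.Ioc (0 : ℝ) 1, ENNReal.ofReal (Real.log 12) := by
          apply lintegral_mono_ae
          filter_upwards [ae_circleMap_notMem (countable_matEval_eq_zero hP) (hS r hr)
            (Set.Ioc 0 1)] with x hx
          simp only [hK, eval_combo]
          exact lintegral_log_comboPoly_le hx
      _ = _ := by simp
  have hsum : ∫⁻ y in Set.Ioc (0 : ℝ) 1, ∑ r ∈ S, ∫⁻ x in Set.Ioc (0 : ℝ) 1,
      ENNReal.ofReal (K r y x) ≤ ENNReal.ofReal (S.card * Real.log 12) := by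
    rw [lintegral_finsetSum _ fun r _ => (hmeas r).lintegral_prod_right]
    refine (Finset.sum_le_sum hle).trans ?_
    rw [Finset.sum_const, nsmul_eq_mul, ENNReal.ofReal_mul (by positivity), ENNReal.ofReal_natCast]
  obtain ⟨w0, hw0⟩ : ∃ w0, matEval P w0 ≠ 0 := by
    by_contra! h
    exact hP (Polynomial.funext fun w => by simpa [matEval_apply] using congrFun (congrFun (h w) i) j)
  have hnull := ae_circleMap_notMem (comboPoly (matEval P w0)).roots.toFinset.countable_toSet
    one_ne_zero (Set.Ioc 0 1)
  have hm : Measurable fun y => ∑ r ∈ S, ∫⁻ x in Set.Ioc (0 : ℝ) 1, ENNReal.ofReal (K r y x) :=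
    Finset.measurable_fun_sum S fun r _ => (hmeas r).lintegral_prod_right
  obtain ⟨y, hy, hyle⟩ := exists_notMem_null_le_lintegral hm.aemeasurable (ae_iff.1 hnull)
  simp only [Set.mem_ofPred_eq, not_not, Finset.mem_coe, Multiset.mem_toFinset,
    mem_roots (comboPoly_ne_zero hw0)] at hy
  refine ⟨circleMap 0 1 (2 * π * y), by simp, ?_, ?_⟩
  · intro h
    apply hy
    rw [IsRoot, ← eval_combo, h, eval_zero]
  · intro r hr
    have h1 : ∫⁻ x in Set.Ioc (0 : ℝ) 1, ENNReal.ofReal (K r y x)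
        ≤ ENNReal.ofReal (S.card * Real.log 12) :=
      (Finset.single_le_sum (f := fun r => ∫⁻ x in Set.Ioc (0 : ℝ) 1, ENNReal.ofReal (K r y x))
        (fun _ _ => zero_le) hr).trans (hyle.trans hsum)
    have i1 := (circleIntegrable_log_norm_matEval P r).integrableOn_Ioc
    have i2 := (circleIntegrable_log_norm_eval (combo P (circleMap 0 1 (2 * π * y))) 0 r
      ).integrableOn_Ioc
    have hKeq : ∀ᵐ x ∂volume.restrict (Set.Ioc (0 : ℝ) 1), Real.log 2
        + Real.log ‖matEval P (circleMap 0 r (2 * π * x))‖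
        - Real.log ‖(combo P (circleMap 0 1 (2 * π * y))).eval (circleMap 0 r (2 * π * x))‖
        = K r y x := by
      filter_upwards [ae_circleMap_notMem (countable_matEval_eq_zero hP) (hS r hr)
            (Set.Ioc 0 1)] with x hx
      simp only [hK]
      rw [Real.log_mul two_ne_zero (norm_ne_zero_iff.2 hx)]
    have i3 : Integrable (fun x => Real.log 2
        + Real.log ‖matEval P (circleMap 0 r (2 * π * x))‖) (volume.restrict (Set.Ioc (0 : ℝ) 1)) :=
      (integrable_const (Real.log 2)).add i1
    have hint := i3.sub i2
    have h2 := integral_le_of_lintegral_ofReal_le (hint.congr hKeq) (by positivity) h1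
    rw [← integral_congr_ae hKeq, integral_sub i3 i2,
      integral_add (integrable_const (Real.log 2)) i1,
      ← circleAverage_eq_setIntegral (fun w => Real.log ‖matEval P w‖),
      ← circleAverage_eq_setIntegral
        (fun w => Real.log ‖(combo P (circleMap 0 1 (2 * π * y))).eval w‖)] at h2
    change _ + avgLogMat P r - avgLog _ r ≤ _ at h2
    have : 0 ≤ ∫ _ in Set.Ioc (0 : ℝ) 1, Real.log 2 := by
      have := Real.log_nonneg (one_le_two (α := ℝ)); positivity
    linarith

theorem avgLog_combo_le {t : ℂ} (ht : ‖t‖ = 1) (h : combo P t ≠ 0) {r : ℝ} (hr : r ≠ 0) :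
    avgLog (combo P t) r ≤ Real.log 2 + avgLogMat P r := by
  rw [avgLogMat, ← Real.circleAverage_const (Real.log 2) 0 r,
    ← Real.circleAverage_fun_add (circleIntegrable_const _ _ _)
      (circleIntegrable_log_norm_matEval P r)]
  refine circleAverage_le_of_countable hr (circleIntegrable_log_norm_eval _ _ _)
    ((circleIntegrable_const _ _ _).add (circleIntegrable_log_norm_matEval P r))
    (combo P t).roots.toFinset.countable_toSet ?_
  intro w hw _
  simp only [Finset.mem_coe, Multiset.mem_toFinset, mem_roots h] at hw
  have h1 : ‖(combo P t).eval w‖ ≤ 2 * ‖matEval P w‖ := by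
    rw [eval_combo]; exact norm_eval_comboPoly_le _ ht
  have h2 : 0 < ‖(combo P t).eval w‖ := norm_pos_iff.2 hw
  rw [← Real.log_mul two_ne_zero (by nlinarith)]
  exact Real.log_le_log h2 h1

end PolyMatrix

section UniformUpper

theorem sum_range_pow_eq_of_isPrimitiveRoot {ω ζ : ℂ} {q : ℕ} (hω : IsPrimitiveRoot ω q)
    (hζ : IsPrimitiveRoot ζ q) (f : ℂ → ℝ) :
    ∑ k ∈ Finset.range q, f (ω ^ k) = ∑ k ∈ Finset.range q, f (ζ ^ k) := by
  have h1 := hω.nthRoots_eq (one_pow q)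
  have h2 := hζ.nthRoots_eq (one_pow q)
  have := congrArg (fun s => (s.map f).sum) (h1.symm.trans h2)
  simp only [Multiset.map_map, Function.comp_def, mul_one] at this
  exact this

theorem circleMap_two_pi_mul_add (r x y : ℝ) :
    circleMap 0 r (2 * π * (x + y)) = circleMap 0 r (2 * π * x) * circleMap 0 1 (2 * π * y) := by
  simp only [circleMap_zero]
  push_cast
  rw [mul_add, add_mul, Complex.exp_add]
  ring

theorem circleMap_one_nat_mul (k : ℕ) (y : ℝ) :
    circleMap 0 1 (2 * π * (k * y)) = circleMap 0 1 (2 * π * y) ^ k := by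
  simp only [circleMap_zero, ofReal_one, one_mul]
  rw [← Complex.exp_nat_mul]
  push_cast
  ring_nf

theorem isPrimitiveRoot_circleMap (x : ℚ) :
    IsPrimitiveRoot (circleMap 0 1 (2 * π * (x : ℝ))) x.den := by
  convert Complex.isPrimitiveRoot_exp_rat x using 1
  simp only [circleMap_zero, ofReal_one, one_mul]
  push_cast
  ring_nf

/-- Rational approximations with large denominators. -/
theorem exists_rat_approx {α : ℝ} (hα : Irrational α) (M : ℕ) :
    ∃ x : ℚ, M < x.den ∧ |α - x| < 1 / (x.den : ℝ) ^ 2 := by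
  have hinf := Real.infinite_rat_abs_sub_lt_one_div_den_sq_of_irrational hα
  by_contra! h
  apply hinf
  have hfin : {x : ℚ | x.den ≤ M ∧ |(x : ℝ)| ≤ |α| + 1}.Finite := by
    obtain ⟨B, hB⟩ := exists_nat_gt ((|α| + 1) * M)
    refine Set.Finite.subset ((Finset.Icc (-(B : ℤ)) B ×ˢ Finset.range (M + 1)).image
      fun p : ℤ × ℕ => (p.1 / p.2 : ℚ)).finite_toSet ?_
    rintro x ⟨hx1, hx2⟩
    simp only [Finset.coe_image, Set.mem_image, Finset.mem_coe, Finset.mem_product,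
      Finset.mem_Icc, Finset.mem_range]
    refine ⟨(x.num, x.den), ⟨?_, by omega⟩, Rat.num_div_den x⟩
    have hnum : |(x.num : ℝ)| ≤ B := by
      have hd : (0 : ℝ) < x.den := by exact_mod_cast x.den_pos
      have : (x.num : ℝ) = x * x.den := by
        have := Rat.num_div_den x
        have h3 : ((x.num / x.den : ℚ) : ℝ) = x := by rw [this]
        push_cast at h3
        rw [← h3]; field_simp
      rw [this, abs_mul, abs_of_pos hd]
      have : (x.den : ℝ) ≤ M := by exact_mod_cast hx1
      calc |(x : ℝ)| * x.den ≤ (|α| + 1) * M := by gcongr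
        _ ≤ B := hB.le
    have := abs_le.1 hnum
    exact ⟨by exact_mod_cast this.1, by exact_mod_cast this.2⟩
  refine hfin.subset ?_
  intro x hx
  simp only [Set.mem_ofPred_eq] at hx
  have hden : (1 : ℝ) ≤ (x.den : ℝ) := by exact_mod_cast x.den_pos
  refine ⟨?_, ?_⟩
  · by_contra! hlt
    exact absurd hx (not_lt.2 (h x hlt))
  · have h1 : 1 / (x.den : ℝ) ^ 2 ≤ 1 := by
      rw [div_le_one (by positivity)]; nlinarith
    have := abs_sub_abs_le_abs_sub (x : ℝ) α
    rw [abs_sub_comm] at this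
    linarith

/-- Uniform upper ergodic sums over an irrational rotation, along one block. -/
theorem exists_block_sum_le {α : ℝ} (hα : Irrational α) {r : ℝ} {g : ℂ → ℝ}
    (hg : Continuous fun x : ℝ => g (circleMap 0 r x)) {ε : ℝ} (hε : 0 < ε) :
    ∃ q : ℕ, 0 < q ∧ ∀ x : ℝ, ∑ k ∈ Finset.range q, g (circleMap 0 r (2 * π * (x + k * α)))
      ≤ q * (Real.circleAverage g 0 r + ε) := by
  set G : ℝ → ℝ := fun x => g (circleMap 0 r (2 * π * x)) with hG
  have hGc : Continuous G := hg.comp (by fun_prop : Continuous fun x : ℝ => 2 * π * x)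
  have hper : Function.Periodic G 1 := by
    intro x
    simp only [hG, mul_add, mul_one]
    rw [periodic_circleMap]
  obtain ⟨d, hd, hunif⟩ : ∃ d > 0, ∀ x y : ℝ, |x - y| < d → |G x - G y| < ε := by
    have hcompact : UniformContinuous fun z : AddCircle (1 : ℝ) => hper.lift z := by
      apply CompactSpace.uniformContinuous_of_continuous
      exact continuous_coinduced_dom.2 hGc
    have huc : UniformContinuous G := by
      have : G = (fun z : AddCircle (1 : ℝ) => hper.lift z) ∘ fun x : ℝ => (x : AddCircle (1 : ℝ)) := by
        funext x; simp
      rw [this]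
      refine hcompact.comp ?_
      exact uniformContinuous_of_continuousAt_zero (QuotientAddGroup.mk' _)
        (continuous_quotient_mk'.continuousAt)
    rw [Metric.uniformContinuous_iff] at huc
    obtain ⟨d, hd, h⟩ := huc ε hε
    exact ⟨d, hd, fun x y hxy => h hxy⟩
  obtain ⟨M, hM⟩ := exists_nat_gt (2 / d)
  obtain ⟨p, hpM, hp⟩ := exists_rat_approx hα M
  set q := p.den with hq
  have hq0 : 0 < q := p.den_pos
  have hq0' : (0 : ℝ) < q := by exact_mod_cast hq0
  refine ⟨q, hq0, fun x => ?_⟩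
  have hclose : ∀ y ∈ Set.Icc x (x + 1 / q), ∑ k ∈ Finset.range q, G (x + k * α) - q * ε
      ≤ ∑ k ∈ Finset.range q, G (y + k * (1 / q : ℝ)) := by
    intro y hy
    have hperm : ∑ k ∈ Finset.range q, G (y + k * (1 / q : ℝ))
        = ∑ k ∈ Finset.range q, G (y + k * (p : ℝ)) := by
      simp only [hG, circleMap_two_pi_mul_add, circleMap_one_nat_mul]
      refine sum_range_pow_eq_of_isPrimitiveRoot ?_ (isPrimitiveRoot_circleMap p)
        (fun z => g (circleMap 0 r (2 * π * y) * z))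
      convert Complex.isPrimitiveRoot_exp q hq0.ne' using 1
      simp only [circleMap_zero, ofReal_one, one_mul]
      push_cast
      congr 1
      ring
    rw [hperm, sub_le_iff_le_add]
    calc ∑ k ∈ Finset.range q, G (x + k * α)
        ≤ ∑ k ∈ Finset.range q, (G (y + k * (p : ℝ)) + ε) := by
          apply Finset.sum_le_sum
          intro k hk
          have hk' : (k : ℝ) ≤ q := by exact_mod_cast (Finset.mem_range.1 hk).le
          have hlt : |(x + k * α) - (y + k * (p : ℝ))| < d := by
            have e : (x + k * α) - (y + k * (p : ℝ)) = (x - y) + k * (α - p) := by ring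
            have h1 : |x - y| ≤ 1 / q := by rw [abs_le]; constructor <;> linarith [hy.1, hy.2]
            have h2 : |k * (α - p)| ≤ 1 / q := by
              rw [abs_mul, Nat.abs_cast]
              calc (k : ℝ) * |α - p| ≤ q * (1 / (q : ℝ) ^ 2) := by gcongr
                _ = 1 / q := by field_simp
            have h3 : 2 / (q : ℝ) < d := by
              rw [div_lt_iff₀ hd] at hM
              rw [div_lt_iff₀ hq0']
              have : (M : ℝ) ≤ q := by exact_mod_cast hpM.le
              nlinarith
            rw [e]
            calc _ ≤ |x - y| + |k * (α - p)| := abs_add_le _ _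
              _ ≤ 1 / q + 1 / q := add_le_add h1 h2
              _ = 2 / q := by ring
              _ < d := h3
          linarith [(abs_lt.1 (hunif _ _ hlt)).2]
      _ = _ := by rw [Finset.sum_add_distrib]; simp
  have hint : ∀ a b : ℝ, IntervalIntegrable G volume a b := fun a b => hGc.intervalIntegrable a b
  have hck : ∀ k : ℕ, Continuous fun y : ℝ => G (y + k * (1 / q : ℝ)) := fun k =>
    hGc.comp (by fun_prop)
  have hsplit : ∫ y in x..(x + 1 / q), ∑ k ∈ Finset.range q, G (y + k * (1 / q : ℝ))
      = Real.circleAverage g 0 r := by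
    rw [intervalIntegral.integral_finsetSum fun k _ => (hck k).intervalIntegrable _ _]
    simp only [intervalIntegral.integral_comp_add_right]
    have := intervalIntegral.sum_integral_adjacent_intervals (f := G) (μ := volume)
      (a := fun k : ℕ => x + k * (1 / q : ℝ)) (n := q) (fun k _ => hint _ _)
    have e : ∀ k : ℕ, x + ((k + 1 : ℕ) : ℝ) * (1 / q) = x + 1 / q + k * (1 / q) := by
      intro k; push_cast; ring
    simp only [e] at this
    rw [this]
    have e2 : x + (q : ℝ) * (1 / q) = x + 1 := by field_simp
    simp only [Nat.cast_zero, zero_mul, add_zero]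
    rw [e2, hper.intervalIntegral_add_eq x 0, circleAverage_eq_setIntegral, zero_add,
      intervalIntegral.integral_of_le zero_le_one]
  have hmono := intervalIntegral.integral_mono_on (μ := volume) (a := x) (b := x + 1 / q)
    (by have : 0 < 1 / (q : ℝ) := by positivity
        linarith)
    (f := fun _ => ∑ k ∈ Finset.range q, G (x + k * α) - q * ε)
    (g := fun y => ∑ k ∈ Finset.range q, G (y + k * (1 / q : ℝ)))
    (intervalIntegrable_const)
    ((continuous_finsetSum _ fun k _ => hck k).intervalIntegrable _ _) hclose
  rw [hsplit, intervalIntegral.integral_const] at hmono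
  simp only [add_sub_cancel_left, smul_eq_mul] at hmono
  rw [one_div, inv_mul_le_iff₀ hq0'] at hmono
  linarith

/-- Uniform upper bounds for submultiplicative sequences over an irrational rotation. -/
theorem eventually_le_exp_of_submultiplicative {β : ℝ} (hβ : Irrational β) {r : ℝ} (hr : 0 < r)
    (φ : ℕ → ℂ → ℝ) (hpos : ∀ n w, ‖w‖ = r → 0 < φ n w) (hcont : ∀ n, Continuous (φ n))
    (hsub : ∀ n m w, ‖w‖ = r →
      φ (n + m) w ≤ φ n (circleMap 0 1 (2 * π * β) ^ m * w) * φ m w)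
    {m : ℕ} (hm : 0 < m) {l : ℝ}
    (h : Real.circleAverage (fun w => Real.log (φ m w)) 0 r < m * l) :
    ∀ᶠ n : ℕ in atTop, ∀ w, ‖w‖ = r → φ n w ≤ Real.exp (n * l) := by
  set σ := circleMap 0 1 (2 * π * β) with hσ
  have hσ1 : ‖σ‖ = 1 := by simp [hσ]
  have hσn : ∀ (k : ℕ) (w : ℂ), ‖w‖ = r → ‖σ ^ k * w‖ = r := by
    intro k w hw; rw [norm_mul, norm_pow, hσ1, one_pow, one_mul, hw]
  have hm' : (0 : ℝ) < m := by exact_mod_cast hm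
  set a := Real.circleAverage (fun w => Real.log (φ m w)) 0 r with ha
  set ε := (m * l - a) / 2 with hε
  have hε0 : 0 < ε := by rw [hε]; linarith
  set l' := l - ε / m with hl'
  have hml' : a + ε = m * l' := by
    have : m * l' = m * l - ε := by rw [hl']; field_simp
    rw [this, hε]; ring
  have hαirr : Irrational ((m : ℝ) * β) := hβ.natCast_mul hm.ne'
  have hgc : Continuous fun x : ℝ => Real.log (φ m (circleMap 0 r x)) := by
    apply ((hcont m).comp (by fun_prop)).log
    intro x
    exact (hpos m _ (by simp [abs_of_pos hr])).ne'
  obtain ⟨q, hq, hblock⟩ := exists_block_sum_le hαirr (g := fun w => Real.log (φ m w)) hgc hε0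
  have hparam : ∀ w : ℂ, ‖w‖ = r → ∃ x : ℝ, w = circleMap 0 r (2 * π * x) := by
    intro w hw
    refine ⟨Complex.arg w / (2 * π), ?_⟩
    rw [mul_div_cancel₀ _ (by positivity), circleMap_zero, ← hw, Complex.norm_mul_exp_arg_mul_I]
  have hprod : ∀ (j : ℕ) (w : ℂ), ‖w‖ = r → 0 < j →
      φ (j * m) w ≤ ∏ k ∈ Finset.range j, φ m (σ ^ (k * m) * w) := by
    intro j
    induction j with
    | zero => intro w _ h0; exact absurd h0 (lt_irrefl _)
    | succ j ih =>
      intro w hw _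
      rcases Nat.eq_zero_or_pos j with rfl | hj
      · simp
      rw [Finset.prod_range_succ, Nat.succ_mul, add_comm]
      refine (hsub _ _ _ hw).trans ?_
      rw [mul_comm]
      exact mul_le_mul_of_nonneg_right (ih w hw hj) (hpos _ _ (hσn _ _ hw)).le
  have hT : ∀ w, ‖w‖ = r → φ (q * m) w ≤ Real.exp ((q * m : ℕ) * l') := by
    intro w hw
    obtain ⟨x, hx⟩ := hparam w hw
    refine (hprod q w hw hq).trans ?_
    rw [← Real.log_le_iff_le_exp (Finset.prod_pos fun k _ => hpos _ _ (hσn _ _ hw)),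
      Real.log_prod fun k _ => (hpos _ _ (hσn _ _ hw)).ne']
    have := hblock x
    rw [hml'] at this
    refine le_trans (le_of_eq ?_) (this.trans (le_of_eq ?_))
    · refine Finset.sum_congr rfl fun k _ => ?_
      congr 2
      rw [circleMap_two_pi_mul_add, circleMap_one_nat_mul, circleMap_one_nat_mul, ← hx, ← hσ,
        ← pow_mul, mul_comm m k, mul_comm w]
    · push_cast; ring
  set T := q * m with hTdef
  have hT0 : 0 < T := Nat.mul_pos hq hm
  obtain ⟨K, hK0, hK⟩ : ∃ K : ℝ, 0 < K ∧ ∀ b ∈ Finset.range T, ∀ w, ‖w‖ = r → φ b w ≤ K := by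
    have hb : ∀ b, ∃ K : ℝ, ∀ w, ‖w‖ = r → φ b w ≤ K := by
      intro b
      obtain ⟨K, hK⟩ := (isCompact_sphere (0 : ℂ) r).bddAbove_image (hcont b).continuousOn
      exact ⟨K, fun w hw => hK ⟨w, by simpa using hw, rfl⟩⟩
    choose K hK using hb
    refine ⟨1 + ∑ b ∈ Finset.range T, |K b|, by positivity, fun b hb w hw => ?_⟩
    have := Finset.single_le_sum (f := fun b => |K b|) (fun _ _ => abs_nonneg _) hb
    linarith [hK b w hw, le_abs_self (K b)]
  have hall : ∀ (c b : ℕ), b < T → ∀ w, ‖w‖ = r →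
      φ (b + c * T) w ≤ K * Real.exp ((c * T : ℕ) * l') := by
    intro c b hb
    induction c with
    | zero => intro w hw; simpa using hK b (Finset.mem_range.2 hb) w hw
    | succ c ih =>
      intro w hw
      rw [Nat.succ_mul, ← add_assoc]
      refine (hsub _ _ _ hw).trans ((mul_le_mul (ih _ (hσn _ _ hw)) (hT w hw)
        (hpos _ _ hw).le (by positivity)).trans (le_of_eq ?_))
      rw [mul_assoc, ← Real.exp_add]
      push_cast
      ring_nf
  have hlim : ∀ᶠ n : ℕ in atTop, Real.log K + T * |l'| ≤ n * (ε / m) := by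
    have : Tendsto (fun n : ℕ => (n : ℝ) * (ε / m)) atTop atTop :=
      tendsto_natCast_atTop_atTop.atTop_mul_const (by positivity)
    exact this.eventually_ge_atTop _
  filter_upwards [hlim] with n hn w hw
  have hb := Nat.mod_lt n hT0
  have hdecomp : n % T + n / T * T = n := by rw [mul_comm, Nat.mod_add_div]
  have := hall (n / T) (n % T) hb w hw
  rw [hdecomp] at this
  refine this.trans ?_
  rw [← Real.log_le_iff_le_exp (by positivity), Real.log_mul hK0.ne' (Real.exp_ne_zero _),
    Real.log_exp]
  have hn' : (n : ℝ) = (n % T : ℕ) + (n / T * T : ℕ) := by exact_mod_cast hdecomp.symm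
  have hbT : ((n % T : ℕ) : ℝ) ≤ T := by exact_mod_cast hb.le
  have h1 : -((n % T : ℕ) : ℝ) * l' ≤ T * |l'| := by
    have h2 : -l' ≤ |l'| := neg_le_abs l'
    have h3 : (0 : ℝ) ≤ (n % T : ℕ) := by positivity
    nlinarith [abs_nonneg l']
  have e : (n : ℝ) * l = n * l' + n * (ε / m) := by rw [hl']; ring
  rw [e]
  have e2 : ((n / T * T : ℕ) : ℝ) * l' = n * l' - (n % T : ℕ) * l' := by
    rw [hn']; ring
  rw [e2]
  linarith

end UniformUpper

section PolynomialCocycle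

open Polynomial

/-- Iterates of a polynomial cocycle, as matrices of polynomials. -/
def polyIter (B : Matrix (Fin 2) (Fin 2) ℂ[X]) (σ : ℂ) : ℕ → Matrix (Fin 2) (Fin 2) ℂ[X]
  | 0 => 1
  | n + 1 => (polyIter B σ n).map (fun p => p.comp (C σ * X)) * B

/-- The matrix of coefficients of a given degree. -/
def coeffMat (P : Matrix (Fin 2) (Fin 2) ℂ[X]) (k : ℕ) : Matrix (Fin 2) (Fin 2) ℂ :=
  P.map fun p => p.coeff k

theorem matEval_mul (P R : Matrix (Fin 2) (Fin 2) ℂ[X]) (w : ℂ) :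
    matEval (P * R) w = matEval P w * matEval R w := by
  ext i j
  simp [matEval_apply, Matrix.mul_apply]

theorem matEval_one (w : ℂ) : matEval 1 w = 1 := by
  ext i j
  by_cases h : i = j <;> simp [matEval_apply, h, Matrix.one_apply]

theorem matEval_polyIter (B : Matrix (Fin 2) (Fin 2) ℂ[X]) (σ : ℂ) (n : ℕ) (w : ℂ) :
    matEval (polyIter B σ n) w = mulIter (matEval B) σ n w := by
  induction n generalizing w with
  | zero => exact matEval_one w
  | succ n ih =>
    rw [polyIter, matEval_mul, mulIter, ← ih]
    congr 1
    ext i j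
    simp [matEval_apply, eval_comp]

theorem natDegree_polyIter_le {B : Matrix (Fin 2) (Fin 2) ℂ[X]} (hB : ∀ i j, (B i j).natDegree ≤ 2)
    (σ : ℂ) (n : ℕ) (i j : Fin 2) : (polyIter B σ n i j).natDegree ≤ 2 * n := by
  induction n generalizing i j with
  | zero =>
    by_cases h : i = j <;> simp [polyIter, h, Matrix.one_apply]
  | succ n ih =>
    rw [polyIter, Matrix.mul_apply]
    refine natDegree_sum_le_of_forall_le _ _ fun k _ => ?_
    refine natDegree_mul_le.trans ?_
    have h1 : ((polyIter B σ n i k).comp (C σ * X)).natDegree ≤ 2 * n := by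
      refine natDegree_comp_le.trans ?_
      calc _ ≤ 2 * n * 1 := Nat.mul_le_mul (ih i k) ((natDegree_C_mul_le σ X).trans natDegree_X_le)
        _ = 2 * n := mul_one _
    have := hB k j
    simp only [Matrix.map_apply]
    omega

theorem coeffMat_polyIter_zero (B : Matrix (Fin 2) (Fin 2) ℂ[X]) (σ : ℂ) (n : ℕ) :
    coeffMat (polyIter B σ n) 0 = coeffMat B 0 ^ n := by
  induction n with
  | zero =>
    ext i j
    by_cases h : i = j <;> simp [polyIter, coeffMat, h]
  | succ n ih =>
    rw [pow_succ, ← ih]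
    ext i j
    simp [polyIter, coeffMat, Matrix.mul_apply, comp_C_mul_X_coeff, mul_coeff_zero]

theorem coeffMat_polyIter_top {B : Matrix (Fin 2) (Fin 2) ℂ[X]}
    (hB : ∀ i j, (B i j).natDegree ≤ 2) {σ : ℂ} (hσ : ‖σ‖ = 1) (n : ℕ) :
    ∃ u : ℂ, ‖u‖ = 1 ∧ coeffMat (polyIter B σ n) (2 * n) = u • coeffMat B 2 ^ n := by
  induction n with
  | zero =>
    refine ⟨1, by simp, ?_⟩
    ext i j
    by_cases h : i = j <;> simp [polyIter, coeffMat, h]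
  | succ n ih =>
    obtain ⟨u, hu, h⟩ := ih
    refine ⟨σ ^ (2 * n) * u, by simp [hu, hσ], ?_⟩
    rw [pow_succ, mul_smul, ← smul_mul_assoc u, ← h]
    ext i j
    simp only [polyIter, coeffMat, Matrix.mul_apply, Matrix.map_apply, Matrix.smul_apply,
      smul_eq_mul, finsetSum_coeff, Finset.mul_sum]
    refine Finset.sum_congr rfl fun k _ => ?_
    rw [mul_add, mul_one, coeff_mul_add_eq_of_natDegree_le _ (hB k j), comp_C_mul_X_coeff]
    · ring
    · refine natDegree_comp_le.trans ?_
      calc _ ≤ 2 * n * 1 := Nat.mul_le_mul (natDegree_polyIter_le hB σ n i k)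
            ((natDegree_C_mul_le σ X).trans natDegree_X_le)
        _ = 2 * n := mul_one _

theorem circleAverage_rotate (f : ℂ → ℝ) {σ : ℂ} (hσ : ‖σ‖ = 1) (r : ℝ) :
    Real.circleAverage (fun w => f (σ * w)) 0 r = Real.circleAverage f 0 r := by
  rw [Real.circleAverage_eq_integral_add (f := f) σ.arg, Real.circleAverage_def]
  congr 2
  ext x
  congr 1
  have h : σ = Complex.exp (σ.arg * Complex.I) := by
    conv_lhs => rw [← Complex.norm_mul_exp_arg_mul_I σ, hσ]
    simp
  conv_lhs => rw [h]
  simp only [circleMap_zero]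
  push_cast
  rw [add_mul, Complex.exp_add]
  ring

theorem avgLogMat_polyIter_add_le {B : Matrix (Fin 2) (Fin 2) ℂ[X]} {σ : ℂ} (hσ : ‖σ‖ = 1)
    (hne : ∀ n, polyIter B σ n 0 0 ≠ 0) {r : ℝ} (hr : r ≠ 0) (n m : ℕ) :
    avgLogMat (polyIter B σ (n + m)) r
      ≤ avgLogMat (polyIter B σ n) r + avgLogMat (polyIter B σ m) r := by
  have hσm : ‖σ ^ m‖ = 1 := by simp [hσ]
  have hrot : CircleIntegrable (fun w => Real.log ‖matEval (polyIter B σ n) (σ ^ m * w)‖) 0 r := by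
    have h := circleIntegrable_log_norm_matEval
      ((polyIter B σ n).map (fun p => p.comp (C (σ ^ m) * X))) r
    convert h using 4 with w
    ext i j
    simp [matEval_apply, eval_comp]
  have h1 : avgLogMat (polyIter B σ n) r
      = Real.circleAverage (fun w => Real.log ‖matEval (polyIter B σ n) (σ ^ m * w)‖) 0 r :=
    (circleAverage_rotate (fun w => Real.log ‖matEval (polyIter B σ n) w‖) hσm r).symm
  rw [h1, avgLogMat, avgLogMat, ← Real.circleAverage_fun_add hrot
    (circleIntegrable_log_norm_matEval _ _)]
  refine circleAverage_le_of_countable hr (circleIntegrable_log_norm_matEval _ _)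
    (hrot.add (circleIntegrable_log_norm_matEval _ _))
    (countable_matEval_eq_zero (hne (n + m))) fun w hw _ => ?_
  have hw' : matEval (polyIter B σ (n + m)) w ≠ 0 := hw
  simp only [matEval_polyIter] at hw' ⊢
  have hle := norm_mulIter_add_le (matEval B) σ n m w
  have hpos : 0 < ‖mulIter (matEval B) σ (n + m) w‖ := norm_pos_iff.2 hw'
  have hne1 : ‖mulIter (matEval B) σ n (σ ^ m * w)‖ ≠ 0 := by
    intro h; rw [h, zero_mul] at hle; linarith
  have hne2 : ‖mulIter (matEval B) σ m w‖ ≠ 0 := by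
    intro h; rw [h, mul_zero] at hle; linarith
  rw [← Real.log_mul hne1 hne2]
  exact Real.log_le_log hpos hle

/-- The Lyapunov exponent of a polynomial cocycle on the circle of radius `r`. -/
def radialLyap (B : Matrix (Fin 2) (Fin 2) ℂ[X]) (σ : ℂ) (r : ℝ) : ℝ :=
  sInf ((fun n : ℕ => avgLogMat (polyIter B σ n) r / n) '' Set.Ici 1)

theorem bddBelow_avgLogMat_polyIter_div {B : Matrix (Fin 2) (Fin 2) ℂ[X]} {σ : ℂ} {r b : ℝ}
    (hb : ∀ n : ℕ, n * b ≤ avgLogMat (polyIter B σ n) r) :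
    BddBelow (Set.range fun n : ℕ => avgLogMat (polyIter B σ n) r / n) := by
  refine ⟨min b 0, ?_⟩
  rintro _ ⟨n, rfl⟩
  rcases Nat.eq_zero_or_pos n with rfl | hn
  · simp
  · refine (min_le_left _ _).trans ?_
    have : (0 : ℝ) < n := by exact_mod_cast hn
    rw [le_div_iff₀ this]
    linarith [hb n]

theorem mul_radialLyap_le {B : Matrix (Fin 2) (Fin 2) ℂ[X]} {σ : ℂ} {r b : ℝ}
    (hb : ∀ n : ℕ, n * b ≤ avgLogMat (polyIter B σ n) r) {n : ℕ} (hn : 1 ≤ n) :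
    n * radialLyap B σ r ≤ avgLogMat (polyIter B σ n) r := by
  have hn' : (0 : ℝ) < n := by exact_mod_cast hn
  have : radialLyap B σ r ≤ avgLogMat (polyIter B σ n) r / n :=
    csInf_le ((bddBelow_avgLogMat_polyIter_div hb).mono (Set.image_subset_range _ _))
      ⟨n, hn, rfl⟩
  rw [le_div_iff₀ hn'] at this
  linarith

theorem tendsto_radialLyap {B : Matrix (Fin 2) (Fin 2) ℂ[X]} {σ : ℂ} (hσ : ‖σ‖ = 1)
    (hne : ∀ n, polyIter B σ n 0 0 ≠ 0) {r b : ℝ} (hr : r ≠ 0)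
    (hb : ∀ n : ℕ, n * b ≤ avgLogMat (polyIter B σ n) r) :
    Tendsto (fun n : ℕ => avgLogMat (polyIter B σ n) r / n) atTop
      (nhds (radialLyap B σ r)) := by
  have hsub : Subadditive fun n : ℕ => avgLogMat (polyIter B σ n) r := fun n m =>
    avgLogMat_polyIter_add_le hσ hne hr n m
  have := hsub.tendsto_lim (bddBelow_avgLogMat_polyIter_div hb)
  rwa [Subadditive.lim] at this

theorem exists_avgLogMat_lt (B : Matrix (Fin 2) (Fin 2) ℂ[X]) (σ : ℂ) (r : ℝ) {ε : ℝ} (hε : 0 < ε) :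
    ∃ m : ℕ, 0 < m ∧ avgLogMat (polyIter B σ m) r < m * (radialLyap B σ r + ε) := by
  obtain ⟨_, ⟨m, hm, rfl⟩, h⟩ := exists_lt_of_csInf_lt
    (s := (fun n : ℕ => avgLogMat (polyIter B σ n) r / n) '' Set.Ici 1)
    ⟨_, ⟨1, Set.mem_Ici.2 le_rfl, rfl⟩⟩ (b := radialLyap B σ r + ε)
    (by rw [radialLyap]; linarith)
  have hm' : (0 : ℝ) < m := by exact_mod_cast (Set.mem_Ici.1 hm)
  refine ⟨m, Set.mem_Ici.1 hm, ?_⟩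
  simp only at h
  rw [div_lt_iff₀ hm'] at h
  linarith

/-- Convexity of the radial Lyapunov exponent. -/
theorem two_mul_radialLyap_one_le {B : Matrix (Fin 2) (Fin 2) ℂ[X]} {σ : ℂ} (hσ : ‖σ‖ = 1)
    (hne : ∀ n, polyIter B σ n 0 0 ≠ 0) {b : ℝ}
    (hb : ∀ s : ℝ, 0 < s → ∀ n : ℕ, n * b ≤ avgLogMat (polyIter B σ n) s) {r : ℝ} (hr : 0 < r) :
    2 * radialLyap B σ 1 ≤ radialLyap B σ r + radialLyap B σ r⁻¹ := by
  have hr' : 0 < r⁻¹ := inv_pos.2 hr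
  have key : ∀ n : ℕ, 1 ≤ n → 2 * radialLyap B σ 1 - (2 * Real.log 12 + 2 * Real.log 2) / n
      ≤ avgLogMat (polyIter B σ n) r / n + avgLogMat (polyIter B σ n) r⁻¹ / n := by
    intro n hn
    have hn' : (0 : ℝ) < n := by exact_mod_cast hn
    obtain ⟨t, ht, hne', hX⟩ := exists_combo_avgLog_ge (hne n) {(1 : ℝ)} (by simp)
    have h1 := hX 1 (by simp)
    simp only [Finset.card_singleton, Nat.cast_one, one_mul] at h1
    have h2 := two_mul_avgLog_one_le hne' hr
    have h3 := avgLog_combo_le (polyIter B σ n) ht hne' hr.ne'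
    have h4 := avgLog_combo_le (polyIter B σ n) ht hne' hr'.ne'
    have h5 := mul_radialLyap_le (hb 1 one_pos) hn
    rw [← add_div, le_div_iff₀ hn', sub_mul, div_mul_cancel₀ _ hn'.ne']
    linarith
  have hlim1 : Tendsto (fun n : ℕ => 2 * radialLyap B σ 1 -
      (2 * Real.log 12 + 2 * Real.log 2) / n) atTop (nhds (2 * radialLyap B σ 1 - 0)) :=
    tendsto_const_nhds.sub (tendsto_const_div_atTop_nhds_zero_nat _)
  rw [sub_zero] at hlim1
  exact le_of_tendsto_of_tendsto hlim1
    ((tendsto_radialLyap hσ hne hr.ne' (hb r hr)).add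
      (tendsto_radialLyap hσ hne hr'.ne' (hb _ hr')))
    (eventually_atTop.2 ⟨1, key⟩)

end PolynomialCocycle

section HarperPolynomials

open Polynomial ComplexConjugate

/-- The larger root of `x² - x + λ₁λ₃`. -/
def harperMu (l1 l3 : ℝ) : ℝ := (1 + Real.sqrt (1 - 4 * l1 * l3)) / 2

theorem half_le_harperMu (l1 l3 : ℝ) : 1 / 2 ≤ harperMu l1 l3 := by
  rw [harperMu]
  linarith [Real.sqrt_nonneg (1 - 4 * l1 * l3)]

theorem harperMu_pos (l1 l3 : ℝ) : 0 < harperMu l1 l3 := by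
  linarith [half_le_harperMu l1 l3]

theorem harperMu_mul {l1 l3 : ℝ} (h : 4 * l1 * l3 ≤ 1) :
    harperMu l1 l3 * (1 - harperMu l1 l3) = l1 * l3 := by
  have := Real.sq_sqrt (show 0 ≤ 1 - 4 * l1 * l3 by linarith)
  rw [harperMu]
  nlinarith

theorem harperMu_le_one {l1 l3 : ℝ} (h1 : 0 ≤ l1) (h3 : 0 ≤ l3) : harperMu l1 l3 ≤ 1 := by
  have : Real.sqrt (1 - 4 * l1 * l3) ≤ 1 := by
    rw [Real.sqrt_le_left zero_le_one, one_pow]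
    nlinarith [mul_nonneg h1 h3]
  rw [harperMu]
  linarith

theorem le_harperMu {l1 l3 s : ℝ} (h : s ^ 2 - s + l1 * l3 ≤ 0) : s ≤ harperMu l1 l3 := by
  have : 2 * s - 1 ≤ Real.sqrt (1 - 4 * l1 * l3) := Real.le_sqrt_of_sq_le (by nlinarith)
  rw [harperMu]
  linarith

theorem harperMu_comm (l1 l3 : ℝ) : harperMu l1 l3 = harperMu l3 l1 := by
  rw [harperMu, harperMu]
  ring_nf

theorem trace_pow_eq {M : Matrix (Fin 2) (Fin 2) ℂ} {a b : ℂ} (htr : M.trace = -(a + b))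
    (hM : M * M = -((a + b) • M) - (a * b) • 1) (n : ℕ) :
    (M ^ n).trace = (-1) ^ n * (a ^ n + b ^ n) := by
  induction n using Nat.strong_induction_on with
  | _ n ih =>
    match n, ih with
    | 0, _ => simp; norm_num
    | 1, _ => simp [htr]
    | n + 2, ih =>
      have e : M ^ (n + 2) = -((a + b) • M ^ (n + 1)) - (a * b) • M ^ n := by
        rw [pow_add, pow_two, hM, pow_succ]
        simp [mul_sub]
      rw [e, Matrix.trace_sub, Matrix.trace_neg, Matrix.trace_smul, Matrix.trace_smul,
        ih (n + 1) (by omega), ih n (by omega)]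
      simp only [smul_eq_mul]
      ring

theorem exists_pow_apply_zero_zero_eq {M : Matrix (Fin 2) (Fin 2) ℂ} {a b : ℝ} (ha : 0 ≤ a)
    (hb : 0 ≤ b) (hab : a + b = 1) (h00 : M 0 0 = -1)
    (hM : M * M = -M - ((a : ℂ) * b) • 1) (n : ℕ) :
    ∃ D : ℝ, a ^ n ≤ D ∧ (M ^ n) 0 0 = (-1) ^ n * D := by
  suffices h : ∃ D : ℝ, a ^ n ≤ D ∧ (M ^ n) 0 0 = (-1) ^ n * D ∧
      (M ^ (n + 1)) 0 0 = (-1) ^ (n + 1) * ((a * D + b ^ (n + 1) : ℝ) : ℂ) by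
    obtain ⟨D, h1, h2, -⟩ := h
    exact ⟨D, h1, h2⟩
  have habC : (a : ℂ) + b = 1 := by exact_mod_cast hab
  induction n with
  | zero =>
    refine ⟨1, by simp, by simp, ?_⟩
    simp [h00, habC]
  | succ n ih =>
    obtain ⟨D, h1, h2, h3⟩ := ih
    refine ⟨a * D + b ^ (n + 1), ?_, h3, ?_⟩
    · rw [pow_succ]
      have := pow_nonneg hb (n + 1)
      nlinarith
    · have e : M ^ (n + 2) = -M ^ (n + 1) - ((a : ℂ) * b) • M ^ n := by
        rw [pow_add, pow_two, hM, pow_succ]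
        simp [mul_sub]
      rw [show n + 1 + 1 = n + 2 from rfl, e]
      simp only [Matrix.sub_apply, Matrix.neg_apply, Matrix.smul_apply, smul_eq_mul, h2, h3]
      push_cast
      have hb' : (b : ℂ) = 1 - a := by rw [← habC]; ring
      rw [hb']
      ring

/-- The transfer matrix of extended Harper's model, cleared of denominators in
`w = exp (2πiz)`; here `ρ = exp (πiβ)`. -/
def harperPoly (l1 l2 l3 : ℝ) (ρ E : ℂ) : Matrix (Fin 2) (Fin 2) ℂ[X] :=
  !![C E * X - (X ^ 2 + 1), -(C (l3 * conj ρ) * X ^ 2 + C (l2 : ℂ) * X + C (l1 * ρ));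
     C (l3 * conj ρ) + C (l2 : ℂ) * X + C (l1 * ρ) * X ^ 2, 0]

/-- Iterates of the transfer matrix. -/
def harperIter (l1 l2 l3 : ℝ) (ρ E : ℂ) (n : ℕ) (w : ℂ) : Matrix (Fin 2) (Fin 2) ℂ :=
  mulIter (matEval (harperPoly l1 l2 l3 ρ E)) (ρ ^ 2) n w

/-- The numerator of the off-diagonal coefficient. -/
def harperG (l1 l2 l3 : ℝ) : ℂ[X] := C (l3 : ℂ) + C (l2 : ℂ) * X + C (l1 : ℂ) * X ^ 2

theorem natDegree_harperPoly_le (l1 l2 l3 : ℝ) (ρ E : ℂ) (i j : Fin 2) :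
    (harperPoly l1 l2 l3 ρ E i j).natDegree ≤ 2 := by
  fin_cases i <;> fin_cases j <;> simp [harperPoly] <;> compute_degree

theorem natDegree_harperG_le (l1 l2 l3 : ℝ) : (harperG l1 l2 l3).natDegree ≤ 2 := by
  unfold harperG
  compute_degree

theorem harperG_ne_zero {l1 l2 l3 : ℝ} (h : l1 ≠ 0 ∨ l2 ≠ 0 ∨ l3 ≠ 0) : harperG l1 l2 l3 ≠ 0 := by
  intro h0
  have e0 := congrArg (fun p => coeff p 0) h0
  have e1 := congrArg (fun p => coeff p 1) h0
  have e2 := congrArg (fun p => coeff p 2) h0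
  simp [harperG, coeff_X, coeff_C] at e0 e1 e2
  tauto

theorem coeffMat_harperPoly_zero (l1 l2 l3 : ℝ) (ρ E : ℂ) :
    coeffMat (harperPoly l1 l2 l3 ρ E) 0 = !![-1, -(l1 * ρ); l3 * conj ρ, 0] := by
  ext i j
  fin_cases i <;> fin_cases j <;> simp [harperPoly, coeffMat, mul_coeff_zero]

theorem coeffMat_harperPoly_two (l1 l2 l3 : ℝ) (ρ E : ℂ) :
    coeffMat (harperPoly l1 l2 l3 ρ E) 2 = !![-1, -(l3 * conj ρ); l1 * ρ, 0] := by
  ext i j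
  fin_cases i <;> fin_cases j <;> simp [harperPoly, coeffMat, coeff_one, mul_assoc, coeff_C_mul]

theorem sq_eq_of_trace_neg_one (x y : ℂ) :
    !![(-1 : ℂ), -x; y, 0] * !![(-1 : ℂ), -x; y, 0]
      = -!![(-1 : ℂ), -x; y, 0] - (x * y) • (1 : Matrix (Fin 2) (Fin 2) ℂ) := by
  ext i j
  fin_cases i <;> fin_cases j <;> simp [Matrix.mul_apply, Fin.sum_univ_two, mul_comm, sub_eq_add_neg]

theorem mul_conj_eq_one {ρ : ℂ} (hρ : ‖ρ‖ = 1) : ρ * conj ρ = 1 := by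
  rw [Complex.mul_conj, Complex.normSq_eq_norm_sq, hρ]
  simp

variable {l1 l2 l3 : ℝ}

theorem one_sub_harperMu_mem (h1 : 0 ≤ l1) (h3 : 0 ≤ l3) :
    0 ≤ 1 - harperMu l1 l3 ∧ 1 - harperMu l1 l3 ≤ harperMu l1 l3 :=
  ⟨by linarith [harperMu_le_one h1 h3], by linarith [half_le_harperMu l1 l3]⟩

theorem norm_trace_pow_le {x y : ℂ} (h1 : 0 ≤ l1) (h3 : 0 ≤ l3) (h : 4 * l1 * l3 ≤ 1)
    (hxy : x * y = l1 * l3) (n : ℕ) :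
    ‖(!![(-1 : ℂ), -x; y, 0] ^ n).trace‖ ≤ 2 * harperMu l1 l3 ^ n := by
  obtain ⟨ha, hb⟩ := one_sub_harperMu_mem h1 h3
  have hprod := harperMu_mul h
  rw [trace_pow_eq (a := harperMu l1 l3) (b := ((1 - harperMu l1 l3 : ℝ) : ℂ))]
  · rw [norm_mul, norm_pow, norm_neg, norm_one, one_pow, one_mul]
    have : ((harperMu l1 l3 : ℂ) ^ n + ((1 - harperMu l1 l3 : ℝ) : ℂ) ^ n)
        = ((harperMu l1 l3 ^ n + (1 - harperMu l1 l3) ^ n : ℝ) : ℂ) := by push_cast; ring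
    rw [this, Complex.norm_real, Real.norm_eq_abs, abs_of_nonneg
      (add_nonneg (pow_nonneg (harperMu_pos _ _).le _) (pow_nonneg ha _))]
    have := pow_le_pow_left₀ ha hb n
    linarith
  · simp [Matrix.trace_fin_two]
  · have e1 : (harperMu l1 l3 : ℂ) + ((1 - harperMu l1 l3 : ℝ) : ℂ) = 1 := by push_cast; ring
    have e2 : (harperMu l1 l3 : ℂ) * ((1 - harperMu l1 l3 : ℝ) : ℂ) = x * y := by
      rw [hxy]; exact_mod_cast hprod
    rw [e1, e2, one_smul]
    exact sq_eq_of_trace_neg_one x y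

/-- Lower bound for the constant coefficient of the upper left entry of the iterates. -/
theorem norm_coeff_zero_harper_ge {ρ : ℂ} (hρ : ‖ρ‖ = 1) (E : ℂ) (h1 : 0 ≤ l1) (h3 : 0 ≤ l3)
    (h : 4 * l1 * l3 ≤ 1) (n : ℕ) :
    harperMu l1 l3 ^ n ≤ ‖(polyIter (harperPoly l1 l2 l3 ρ E) (ρ ^ 2) n 0 0).coeff 0‖ := by
  have e : (polyIter (harperPoly l1 l2 l3 ρ E) (ρ ^ 2) n 0 0).coeff 0
      = (coeffMat (polyIter (harperPoly l1 l2 l3 ρ E) (ρ ^ 2) n) 0) 0 0 := rfl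
  rw [e, coeffMat_polyIter_zero, coeffMat_harperPoly_zero]
  obtain ⟨ha, hb⟩ := one_sub_harperMu_mem h1 h3
  have hprod := harperMu_mul h
  obtain ⟨D, hD, hD'⟩ := exists_pow_apply_zero_zero_eq
    (M := !![-1, -(l1 * ρ); l3 * conj ρ, 0]) (harperMu_pos l1 l3).le ha (by ring) (by simp)
    (by
      rw [sq_eq_of_trace_neg_one]
      congr 2
      rw [show (l1 * ρ) * (l3 * conj ρ) = (l1 * l3 : ℂ) * (ρ * conj ρ) by ring, mul_conj_eq_one hρ,
        mul_one]
      exact_mod_cast hprod.symm) n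
  rw [hD', norm_mul, norm_pow, norm_neg, norm_one, one_pow, one_mul, Complex.norm_real]
  exact hD.trans (le_abs_self D)

theorem polyIter_harper_ne_zero {ρ : ℂ} (hρ : ‖ρ‖ = 1) (E : ℂ) (h1 : 0 ≤ l1) (h3 : 0 ≤ l3)
    (h : 4 * l1 * l3 ≤ 1) (n : ℕ) : polyIter (harperPoly l1 l2 l3 ρ E) (ρ ^ 2) n 0 0 ≠ 0 := by
  intro h0
  have := norm_coeff_zero_harper_ge (l2 := l2) hρ E h1 h3 h n
  rw [h0, coeff_zero, norm_zero] at this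
  linarith [pow_pos (harperMu_pos l1 l3) n]

/-- Herman's subharmonicity lower bound. -/
theorem mul_log_harperMu_le {ρ : ℂ} (hρ : ‖ρ‖ = 1) (E : ℂ) (h1 : 0 ≤ l1) (h3 : 0 ≤ l3)
    (h : 4 * l1 * l3 ≤ 1) {r : ℝ} (hr : 0 < r) (n : ℕ) :
    n * Real.log (harperMu l1 l3)
      ≤ avgLogMat (polyIter (harperPoly l1 l2 l3 ρ E) (ρ ^ 2) n) r := by
  have hge := norm_coeff_zero_harper_ge (l2 := l2) hρ E h1 h3 h n
  have hpos := pow_pos (harperMu_pos l1 l3) n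
  have hne : (polyIter (harperPoly l1 l2 l3 ρ E) (ρ ^ 2) n 0 0).coeff 0 ≠ 0 := by
    rw [← norm_pos_iff]; linarith
  have h2 := log_norm_coeff_zero_le_avgLog hne hr
  have h4 := avgLog_le_avgLogMat _ (polyIter_harper_ne_zero (l2 := l2) hρ E h1 h3 h n) hr.ne'
  have h5 := Real.log_le_log hpos hge
  rw [Real.log_pow] at h5
  linarith

/-- The Jensen bound for the off-diagonal coefficient. -/
theorem avgLog_harperG_one_le (h1 : 0 ≤ l1) (h2 : 0 ≤ l2) (h3 : 0 ≤ l3)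
    (hpos : 0 < l1 ∨ 0 < l2 ∨ 0 < l3) (h13 : l1 + l3 ≤ 1) (h2' : l2 ≤ 1) :
    avgLog (harperG l1 l2 l3) 1 ≤ Real.log (harperMu l1 l3) := by
  rcases h1.eq_or_lt with h0 | h1
  · subst h0
    have hmu : harperMu 0 l3 = 1 := by simp [harperMu]
    rw [hmu, Real.log_one]
    rcases h2.eq_or_lt with h0 | h2
    · subst h0
      have h3' : 0 < l3 := by simpa using hpos
      have e : harperG 0 0 l3 = C (l3 : ℂ) := by simp [harperG]
      rw [e, avgLog_eq (by simpa using h3'.ne') one_pos]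
      simp only [leadingCoeff_C, roots_C, Multiset.map_zero, Multiset.sum_zero, add_zero,
        Complex.norm_real, Real.norm_eq_abs, abs_of_pos h3']
      exact Real.log_nonpos h3 (by linarith)
    · have h2c : (l2 : ℂ) ≠ 0 := by exact_mod_cast h2.ne'
      have e : harperG 0 l2 l3 = C (l2 : ℂ) * (X - C (-(l3 / l2 : ℂ))) := by
        rw [mul_sub, ← C_mul]
        simp only [harperG, Complex.ofReal_zero, C_0, zero_mul, add_zero]
        rw [show (l2 : ℂ) * -(l3 / l2 : ℂ) = -l3 by field_simp, C_neg]
        ring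
      rw [e, avgLog_eq (mul_ne_zero (C_ne_zero.2 h2c) (X_sub_C_ne_zero _)) one_pos,
        leadingCoeff_mul, leadingCoeff_C, leadingCoeff_X_sub_C, mul_one,
        roots_C_mul _ h2c, roots_X_sub_C]
      simp only [Multiset.map_singleton, Multiset.sum_singleton, norm_neg, norm_div,
        Complex.norm_real, Real.norm_eq_abs, abs_of_pos h2, abs_of_nonneg h3]
      have hm : 0 < max 1 (l3 / l2) := lt_of_lt_of_le one_pos (le_max_left _ _)
      rw [← Real.log_mul h2.ne' hm.ne', mul_max_of_nonneg _ _ h2.le, mul_one,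
        mul_div_cancel₀ _ h2.ne']
      refine Real.log_nonpos (h2.le.trans (le_max_left _ _)) (max_le h2' (by linarith))
  · have h1c : (l1 : ℂ) ≠ 0 := by exact_mod_cast h1.ne'
    obtain ⟨a, b, hab, hab', -, -⟩ := exists_eigenvalues
      !![-(l2 / l1 : ℂ), -(l3 / l1 : ℂ); 1, 0]
    simp only [Matrix.trace_fin_two, Matrix.det_fin_two, Matrix.of_apply, Matrix.cons_val',
      Matrix.cons_val_zero, Matrix.cons_val_one, Matrix.cons_val_fin_one, add_zero, mul_zero,
      zero_sub, mul_one, neg_neg] at hab hab'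
    have e : harperG l1 l2 l3 = C (l1 : ℂ) * ((X - C a) * (X - C b)) := by
      have e1 : (X - C a) * (X - C b) = X ^ 2 - C (a + b) * X + C (a * b) := by
        rw [C_add, C_mul]; ring
      rw [e1, hab, hab', mul_add, mul_sub, ← mul_assoc, ← C_mul, ← C_mul,
        show (l1 : ℂ) * -(l2 / l1 : ℂ) = -l2 by field_simp,
        show (l1 : ℂ) * (l3 / l1 : ℂ) = l3 by field_simp, C_neg, harperG]
      ring
    have hroot : ∀ x y : ℂ, x + y = -(l2 / l1 : ℂ) → x * y = l3 / l1 →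
        l1 * ‖x‖ ≤ harperMu l1 l3 := by
      intro x y hx hy
      have hq : (l1 * x) ^ 2 + l2 * (l1 * x) + (l1 * l3 : ℂ) = 0 := by
        have hy' : y = -(l2 / l1 : ℂ) - x := by rw [← hx]; ring
        rw [hy'] at hy
        field_simp at hy
        linear_combination (-(l1 : ℂ)) * hy
      set s : ℂ := l1 * x with hs
      have hns : l1 * ‖x‖ = ‖s‖ := by
        rw [hs, norm_mul, Complex.norm_real, Real.norm_eq_abs, abs_of_pos h1]
      rw [hns]
      have hre := congrArg Complex.re hq
      have him := congrArg Complex.im hq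
      simp [pow_two] at hre him
      have h4 : 4 * l1 * l3 ≤ 1 := by nlinarith [sq_nonneg (l1 - l3)]
      have hp := harperMu_mul h4
      by_cases hy0 : s.im = 0
      · have hsre : s = (s.re : ℂ) := by apply Complex.ext <;> simp [hy0]
        rw [hsre, Complex.norm_real, Real.norm_eq_abs]
        apply le_harperMu
        rw [hy0] at hre
        have hneg : s.re ≤ 0 := by
          by_contra! hp'
          nlinarith [mul_nonneg h1.le h3, mul_nonneg h2 hp'.le, mul_pos hp' hp']
        rw [abs_of_nonpos hneg]
        nlinarith
      · have h5 : 2 * s.re + l2 = 0 := by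
          have : s.im * (2 * s.re + l2) = 0 := by linarith
          exact (mul_eq_zero.1 this).resolve_left hy0
        have h6 : ‖s‖ ^ 2 = l1 * l3 := by
          rw [← Complex.normSq_eq_norm_sq, Complex.normSq_apply]
          nlinarith
        have h7 := half_le_harperMu l1 l3
        refine abs_le_of_sq_le_sq' ?_ (by linarith) |>.2
        rw [h6]
        nlinarith
    have ha := hroot a b hab hab'
    have hb := hroot b a (by rw [add_comm, hab]) (by rw [mul_comm, hab'])
    have hl1 : l1 ≤ harperMu l1 l3 := le_harperMu (by nlinarith)
    have hl3 : l3 ≤ harperMu l1 l3 := le_harperMu (by nlinarith)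
    have hab3 : l1 * (‖a‖ * ‖b‖) = l3 := by
      rw [← norm_mul, hab', norm_div, Complex.norm_real, Complex.norm_real, Real.norm_eq_abs,
        Real.norm_eq_abs, abs_of_pos h1, abs_of_nonneg h3]
      field_simp
    have hne : (X - C a) * (X - C b) ≠ 0 := mul_ne_zero (X_sub_C_ne_zero _) (X_sub_C_ne_zero _)
    rw [e, avgLog_eq (mul_ne_zero (C_ne_zero.2 h1c) hne) one_pos, leadingCoeff_mul, leadingCoeff_C,
      leadingCoeff_mul, leadingCoeff_X_sub_C, leadingCoeff_X_sub_C, mul_one, mul_one,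
      roots_C_mul _ h1c, roots_mul hne, roots_X_sub_C, roots_X_sub_C]
    simp only [Multiset.map_add, Multiset.map_singleton, Multiset.sum_add, Multiset.sum_singleton,
      Complex.norm_real, Real.norm_eq_abs, abs_of_pos h1]
    have hm : ∀ x : ℂ, 0 < max 1 ‖x‖ := fun x => lt_of_lt_of_le one_pos (le_max_left _ _)
    rw [← Real.log_mul (hm a).ne' (hm b).ne', ← Real.log_mul h1.ne' (mul_pos (hm a) (hm b)).ne']
    refine Real.log_le_log (mul_pos h1 (mul_pos (hm a) (hm b))) ?_
    rcases max_cases 1 ‖a‖ with ⟨h, -⟩ | ⟨h, -⟩ <;> rcases max_cases 1 ‖b‖ with ⟨h', -⟩ | ⟨h', -⟩ <;>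
      rw [h, h'] <;> linarith

theorem norm_eval_harperPoly_one_zero {ρ : ℂ} (hρ : ‖ρ‖ = 1) (E w : ℂ) :
    ‖(harperPoly l1 l2 l3 ρ E 1 0).eval w‖ = ‖(harperG l1 l2 l3).eval (ρ * w)‖ := by
  have e : (harperPoly l1 l2 l3 ρ E 1 0).eval w = conj ρ * (harperG l1 l2 l3).eval (ρ * w) := by
    simp [harperPoly, harperG]
    linear_combination (-(l2 : ℂ) * w - l1 * ρ * w ^ 2) * mul_conj_eq_one hρ
  rw [e, norm_mul, RCLike.norm_conj, hρ, one_mul]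

theorem norm_eval_harperPoly_zero_one {ρ : ℂ} (hρ : ‖ρ‖ = 1) (E w : ℂ) :
    ‖(harperPoly l1 l2 l3 ρ E 0 1).eval w‖ = ‖(harperG l3 l2 l1).eval (conj ρ * w)‖ := by
  have e : (harperPoly l1 l2 l3 ρ E 0 1).eval w
      = -(ρ * (harperG l3 l2 l1).eval (conj ρ * w)) := by
    simp [harperPoly, harperG]
    linear_combination ((l2 : ℂ) * w + l3 * conj ρ * w ^ 2) * mul_conj_eq_one hρ
  rw [e, norm_neg, norm_mul, hρ, one_mul]

theorem norm_det_harperPoly {ρ : ℂ} (hρ : ‖ρ‖ = 1) (E w : ℂ) :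
    ‖(matEval (harperPoly l1 l2 l3 ρ E) w).det‖
      = ‖(harperG l1 l2 l3).eval (ρ * w)‖ * ‖(harperG l3 l2 l1).eval (conj ρ * w)‖ := by
  rw [Matrix.det_fin_two, ← norm_eval_harperPoly_one_zero hρ E, ←
    norm_eval_harperPoly_zero_one hρ E, ← norm_mul]
  have : matEval (harperPoly l1 l2 l3 ρ E) w 1 1 = 0 := by simp [matEval_apply, harperPoly]
  rw [this, mul_zero, zero_sub, norm_neg, matEval_apply, matEval_apply, mul_comm]

end HarperPolynomials

section Paving

open Polynomial

theorem norm_circleMap_sub_le (s t : ℝ) : ‖circleMap 0 1 s - circleMap 0 1 t‖ ≤ |s - t| := by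
  have e : circleMap 0 1 s - circleMap 0 1 t
      = circleMap 0 1 t * (Complex.exp (Complex.I * ((s - t : ℝ) : ℂ)) - 1) := by
    simp only [circleMap_zero, ofReal_one, one_mul, mul_sub, mul_one, ← Complex.exp_add]
    push_cast
    ring_nf
  rw [e, norm_mul, norm_circleMap_zero, abs_one, one_mul]
  exact Real.norm_exp_I_mul_ofReal_sub_one_le

theorem norm_circleMap_sub_one_ge (y : ℝ) :
    4 * |y - round y| ≤ ‖circleMap 0 1 (2 * π * y) - 1‖ := by
  have e : circleMap 0 1 (2 * π * y)
      = Complex.exp (Complex.I * ((2 * π * (y - round y) : ℝ) : ℂ)) := by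
    simp only [circleMap_zero, ofReal_one, one_mul]
    rw [Complex.exp_eq_exp_iff_exists_int]
    exact ⟨round y, by push_cast; ring⟩
  rw [e, Complex.norm_exp_I_mul_ofReal_sub_one, norm_mul, Real.norm_eq_abs, Real.norm_eq_abs,
    abs_two]
  have h := abs_sub_round y
  have h2 : |2 * π * (y - round y) / 2| ≤ π / 2 := by
    rw [show 2 * π * (y - round y) / 2 = π * (y - round y) by ring, abs_mul,
      abs_of_pos Real.pi_pos]
    nlinarith [Real.pi_pos]
  have h3 := Real.mul_abs_le_abs_sin h2
  rw [show 2 * π * (y - round y) / 2 = π * (y - round y) by ring, abs_mul,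
      abs_of_pos Real.pi_pos, show 2 / π * (π * |y - round y|) = 2 * |y - round y| by
        field_simp] at h3
  rw [show 2 * π * (y - round y) / 2 = π * (y - round y) by ring]
  linarith

/-- Separation of nearby points of an orbit of a well-approximable rotation. -/
theorem norm_pow_sub_pow_ge {α : ℝ} {x : ℚ} (hx : |α - x| < 1 / (x.den : ℝ) ^ 2) {i j : ℕ}
    (hij : i < j) (h : 2 * (j - i) ≤ x.den) :
    2 / (x.den : ℝ) ≤ ‖circleMap 0 1 (2 * π * α) ^ j - circleMap 0 1 (2 * π * α) ^ i‖ := by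
  obtain ⟨k, rfl⟩ := Nat.exists_eq_add_of_lt hij
  set h' := k + 1 with hh
  have hk : i + k + 1 - i = h' := by omega
  rw [hk] at h
  have hq : (0 : ℝ) < x.den := by exact_mod_cast x.den_pos
  rw [show i + k + 1 = i + h' by omega, pow_add]
  have e : circleMap 0 1 (2 * π * α) ^ i * circleMap 0 1 (2 * π * α) ^ h'
      - circleMap 0 1 (2 * π * α) ^ i
      = circleMap 0 1 (2 * π * α) ^ i * (circleMap 0 1 (2 * π * (h' * α)) - 1) := by
    rw [circleMap_one_nat_mul]; ring
  rw [e, norm_mul, norm_pow, norm_circleMap_zero, abs_one, one_pow, one_mul]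
  refine le_trans ?_ (norm_circleMap_sub_one_ge _)
  set n := round ((h' : ℝ) * α) with hn
  have hxq : (x : ℝ) = x.num / x.den := by
    exact_mod_cast (Rat.num_div_den x).symm
  have hint : (h' : ℤ) * x.num - n * x.den ≠ 0 := by
    intro h0
    have hdvd : (x.den : ℤ) ∣ h' * x.num := ⟨n, by linarith⟩
    have hcop : IsCoprime (x.den : ℤ) x.num := by
      rw [Int.isCoprime_iff_gcd_eq_one]
      have := x.reduced
      rwa [Nat.Coprime, Nat.gcd_comm] at this
    have := hcop.dvd_of_dvd_mul_right hdvd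
    have := Int.le_of_dvd (by omega) this
    have h1 := x.den_pos
    omega
  have h1 : (1 : ℝ) ≤ |(h' : ℝ) * x.num - n * x.den| := by
    have := Int.one_le_abs hint
    exact_mod_cast this
  have h2 : 1 / (x.den : ℝ) ≤ |(h' : ℝ) * x - n| := by
    rw [hxq, show (h' : ℝ) * (x.num / x.den) - n = (h' * x.num - n * x.den) / x.den by field_simp,
      abs_div, abs_of_pos hq]
    gcongr
  have h3 : |(h' : ℝ) * (α - x)| ≤ 1 / (2 * x.den) := by
    rw [abs_mul, Nat.abs_cast]
    have hle : (2 : ℝ) * h' ≤ x.den := by exact_mod_cast h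
    calc (h' : ℝ) * |α - x| ≤ (x.den / 2) * (1 / (x.den : ℝ) ^ 2) := by
          gcongr
          linarith
      _ = _ := by field_simp
  have h4 : |(h' : ℝ) * x - n| ≤ |(h' : ℝ) * α - n| + |(h' : ℝ) * (α - x)| := by
    have := abs_sub ((h' : ℝ) * α - n) (h' * (α - x))
    rwa [show (h' : ℝ) * α - n - h' * (α - x) = h' * x - n by ring] at this
  have h5 : 1 / (2 * (x.den : ℝ)) = 1 / x.den / 2 := by field_simp
  have h6 : 2 / (x.den : ℝ) = 2 * (1 / x.den) := by ring
  rw [h5] at h3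
  rw [h6]
  linarith

theorem sum_log_norm_sub_eq {ω : ℂ} {q : ℕ} (hq : 0 < q) (hω : IsPrimitiveRoot ω q) {v a : ℂ}
    (hne : ∀ i, ω ^ i * v - a ≠ 0) :
    ∑ i ∈ Finset.range q, Real.log ‖ω ^ i * v - a‖ = Real.log ‖a ^ q - v ^ q‖ := by
  rw [← prod_range_sub_pow_mul hq hω, norm_prod, Real.log_prod]
  · exact Finset.sum_congr rfl fun i _ => by rw [norm_sub_rev]
  · intro i _
    rw [norm_sub_rev]
    exact norm_ne_zero_iff.2 (hne i)

theorem neg_two_mul_le_log_one_sub {y : ℝ} (hy0 : 0 ≤ y) (hy : y ≤ 1 / 2) :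
    -(2 * y) ≤ Real.log (1 - y) := by
  have h1 := Real.one_sub_inv_le_log_of_pos (show 0 < 1 - y by linarith)
  have h2 : (1 - y)⁻¹ ≤ 1 + 2 * y := by
    rw [inv_le_iff_one_le_mul₀ (by linarith)]
    nlinarith
  linarith

/-- Contribution of a root away from the circle. -/
theorem sum_log_far_ge {ω : ℂ} {q : ℕ} (hq : 0 < q) (hω : IsPrimitiveRoot ω q) {r η : ℝ}
    (hr : 0 < r) (hr2 : r ≤ 2) (hη : 0 < η) (hη1 : η ≤ 1) (hqη : 28 ≤ q * η) {v : ℂ}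
    (hv : ‖v‖ = r) {w : ℕ → ℂ} (hw : ∀ i < q, ‖w i - ω ^ i * v‖ ≤ 7 * r / q) {a : ℂ}
    (ha : η ≤ |‖a‖ - r|) :
    -(31 / η) ≤ ∑ i ∈ Finset.range q, (Real.log ‖w i - a‖ - Real.log (max r ‖a‖)) := by
  have hq' : (0 : ℝ) < q := by exact_mod_cast hq
  have hω1 : ‖ω‖ = 1 := hω.norm'_eq_one hq.ne'
  have hl : ∀ i, ‖ω ^ i * v‖ = r := by
    intro i; rw [norm_mul, norm_pow, hω1, one_pow, one_mul, hv]
  have hla : ∀ i, η ≤ ‖ω ^ i * v - a‖ := by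
    intro i
    have := abs_norm_sub_norm_le (ω ^ i * v) a
    rw [hl, abs_sub_comm] at this
    linarith
  have hne : ∀ i, ω ^ i * v - a ≠ 0 := fun i => by
    rw [← norm_pos_iff]; linarith [hla i]
  set y := 14 / (q * η) with hy
  have hy0 : 0 ≤ y := by positivity
  have hy1 : y ≤ 1 / 2 := by
    rw [hy, div_le_iff₀ (by positivity)]; linarith
  have hterm : ∀ i ∈ Finset.range q, Real.log ‖ω ^ i * v - a‖ - 2 * y ≤ Real.log ‖w i - a‖ := by
    intro i hi
    have h1 := hw i (Finset.mem_range.1 hi)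
    have h2 : ‖ω ^ i * v - a‖ ≤ ‖w i - a‖ + ‖w i - ω ^ i * v‖ := by
      have := norm_sub_le (w i - a) (w i - ω ^ i * v)
      rwa [show w i - a - (w i - ω ^ i * v) = ω ^ i * v - a by ring] at this
    have h3 : 7 * r / q ≤ y * ‖ω ^ i * v - a‖ := by
      calc 7 * r / q ≤ 14 / q := by gcongr; linarith
        _ = y * η := by rw [hy]; field_simp
        _ ≤ _ := by gcongr; exact hla i
    have hpos : 0 < ‖ω ^ i * v - a‖ := by linarith [hla i]
    have h4 : ‖ω ^ i * v - a‖ * (1 - y) ≤ ‖w i - a‖ := by linarith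
    have h5 := Real.log_le_log (mul_pos hpos (by linarith)) h4
    rw [Real.log_mul hpos.ne' (by linarith)] at h5
    linarith [neg_two_mul_le_log_one_sub hy0 hy1]
  set m := max r ‖a‖ with hm
  have hm0 : 0 < m := lt_of_lt_of_le hr (le_max_left _ _)
  have hpow : m ^ q * (η / (r + η)) ≤ ‖a ^ q - v ^ q‖ := by
    have aux : ∀ s b : ℝ, 0 ≤ s → 0 < b → s ≤ b → η * b ≤ (b - s) * (r + η) →
        b ^ q * (η / (r + η)) ≤ b ^ q - s ^ q := by
      intro s b hs hb hsb h
      obtain ⟨k, rfl⟩ := Nat.exists_eq_succ_of_ne_zero hq.ne'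
      have h1 : s ^ (k + 1) ≤ b ^ k * s := by
        rw [pow_succ]; gcongr
      have h2 : b * (η / (r + η)) ≤ b - s := by
        rw [← mul_div_assoc, div_le_iff₀ (by positivity)]; linarith
      calc b ^ (k + 1) * (η / (r + η)) = b ^ k * (b * (η / (r + η))) := by ring
        _ ≤ b ^ k * (b - s) := by gcongr
        _ ≤ b ^ (k + 1) - s ^ (k + 1) := by rw [pow_succ b]; linarith
    rcases le_total r ‖a‖ with h | h
    · rw [hm, max_eq_right h]
      rw [abs_of_nonneg (by linarith)] at ha
      have := norm_sub_norm_le (a ^ q) (v ^ q)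
      rw [norm_pow, norm_pow, hv] at this
      refine (aux r ‖a‖ hr.le (by linarith) h ?_).trans this
      nlinarith
    · rw [hm, max_eq_left h]
      rw [abs_of_nonpos (by linarith)] at ha
      have := norm_sub_norm_le (v ^ q) (a ^ q)
      rw [norm_pow, norm_pow, hv, norm_sub_rev] at this
      refine (aux ‖a‖ r (norm_nonneg _) hr h ?_).trans this
      nlinarith [norm_nonneg a]
  have hη' : 0 < η / (r + η) := by positivity
  have hlog := Real.log_le_log (by positivity) hpow
  rw [Real.log_mul (by positivity) hη'.ne', Real.log_pow] at hlog
  have hlogη : -(3 / η) ≤ Real.log (η / (r + η)) := by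
    have h1 := Real.one_sub_inv_le_log_of_pos hη'
    rw [inv_div] at h1
    have h2 : (r + η) / η ≤ 3 / η := by gcongr; linarith
    linarith
  have hsum := Finset.sum_le_sum hterm
  rw [Finset.sum_sub_distrib, sum_log_norm_sub_eq hq hω hne, Finset.sum_const, Finset.card_range,
    nsmul_eq_mul] at hsum
  rw [Finset.sum_sub_distrib, Finset.sum_const, Finset.card_range, nsmul_eq_mul]
  have hqy : (q : ℝ) * (2 * y) = 28 / η := by rw [hy]; field_simp; norm_num
  have : 31 / η = 28 / η + 3 / η := by ring
  linarith

/-- Contribution of a root close to the circle. -/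
theorem sum_log_near_ge {ω : ℂ} {q : ℕ} (hq : 0 < q) (hω : IsPrimitiveRoot ω q) {r : ℝ}
    (hr : 0 < r) {v : ℂ}
    (hv : ‖v‖ = r) {w : ℕ → ℂ} (hw : ∀ i < q, ‖w i - ω ^ i * v‖ ≤ 7 * r / q)
    (hwr : ∀ i < q, ‖w i‖ = r) {a : ℂ}
    (ha0 : a ≠ 0) (ha : ‖a‖ ≤ 2 * r) {G : Finset ℕ} (hG : G ⊆ Finset.range q)
    (hGa : ∀ i ∈ G, r / q ≤ ‖w i - a‖) :
    -(4 * q : ℝ) ≤ ∑ i ∈ G, (Real.log ‖w i - a‖ - Real.log (max r ‖a‖)) := by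
  have hq' : (0 : ℝ) < q := by exact_mod_cast hq
  have hq1 : (1 : ℝ) ≤ q := by exact_mod_cast hq
  have hω1 : ‖ω‖ = 1 := hω.norm'_eq_one hq.ne'
  have hl : ∀ i, ‖ω ^ i * v‖ = r := by
    intro i; rw [norm_mul, norm_pow, hω1, one_pow, one_mul, hv]
  have hna : 0 < ‖a‖ := norm_pos_iff.2 ha0
  set u : ℂ := a / ‖a‖ with hu
  have hu1 : ‖u‖ = 1 := by
    rw [hu, norm_div, Complex.norm_real, norm_norm, div_self hna.ne']
  have hau : ‖a - r * u‖ = |‖a‖ - r| := by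
    have hnac : (‖a‖ : ℂ) ≠ 0 := by exact_mod_cast hna.ne'
    have : a - r * u = ((‖a‖ - r : ℝ) : ℂ) * u := by
      push_cast
      rw [sub_mul, hu, mul_div_cancel₀ _ hnac]
    rw [this, norm_mul, hu1, mul_one, Complex.norm_real, Real.norm_eq_abs]
  set a' : ℂ := ((r * (1 + 1 / q) : ℝ) : ℂ) * u with ha'
  have hr' : 0 < r * (1 + 1 / q) := by positivity
  have hna' : ‖a'‖ = r * (1 + 1 / q) := by
    rw [ha', norm_mul, hu1, mul_one, Complex.norm_real, Real.norm_eq_abs, abs_of_pos hr']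
  have hpos : ∀ i, 0 < ‖ω ^ i * v - a'‖ := by
    intro i
    have := norm_sub_norm_le a' (ω ^ i * v)
    rw [hna', hl, norm_sub_rev] at this
    have h1 : 0 < r * (1 / q) := by positivity
    linarith
  have hle3 : ∀ i, ‖ω ^ i * v - a'‖ ≤ 3 * r := by
    intro i
    have := norm_sub_le (ω ^ i * v) a'
    rw [hna', hl] at this
    have h1 : (1 : ℝ) / q ≤ 1 := by rw [div_le_one hq']; exact hq1
    nlinarith
  have hterm : ∀ i ∈ G, Real.log ‖ω ^ i * v - a'‖ - Real.log 10 ≤ Real.log ‖w i - a‖ := by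
    intro i hi
    have hiq := Finset.mem_range.1 (hG hi)
    have h1 := hw i hiq
    have h2 := hGa i hi
    have h3 : |‖a‖ - r| ≤ ‖w i - a‖ := by
      have := abs_norm_sub_norm_le (w i) a
      rwa [hwr i hiq, abs_sub_comm] at this
    have h4 : ‖r * u - a'‖ = r / q := by
      have : r * u - a' = -(((r / q : ℝ) : ℂ) * u) := by
        rw [ha']; push_cast; ring
      rw [this, norm_neg, norm_mul, hu1, mul_one, Complex.norm_real, Real.norm_eq_abs,
        abs_of_pos (by positivity)]
    have h5 : ‖ω ^ i * v - a'‖ ≤ 10 * ‖w i - a‖ := by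
      have e : ω ^ i * v - a' = -(w i - ω ^ i * v) + (w i - a) + (a - r * u) + (r * u - a') := by
        ring
      rw [e]
      have := norm_add₄_le (a := -(w i - ω ^ i * v)) (b := w i - a) (c := a - r * u)
        (d := r * u - a')
      rw [norm_neg, hau, h4] at this
      have e7 : 7 * r / q = 7 * (r / q) := by ring
      linarith
    have h6 : 0 < ‖w i - a‖ := lt_of_lt_of_le (by positivity) h2
    have := Real.log_le_log (hpos i) h5
    rw [Real.log_mul (by norm_num) h6.ne'] at this
    linarith
  have hall : (q : ℝ) * Real.log r ≤ ∑ i ∈ Finset.range q, Real.log ‖ω ^ i * v - a'‖ := by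
    rw [sum_log_norm_sub_eq hq hω fun i => norm_pos_iff.1 (hpos i), ← Real.log_pow]
    refine Real.log_le_log (by positivity) ?_
    have := norm_sub_norm_le (a' ^ q) (v ^ q)
    rw [norm_pow, norm_pow, hna', hv, mul_pow] at this
    have hb := one_add_mul_le_pow (show (-2 : ℝ) ≤ 1 / q by
      have : (0 : ℝ) ≤ 1 / q := by positivity
      linarith) q
    rw [mul_one_div_cancel hq'.ne'] at hb
    have hrq : 0 < r ^ q := by positivity
    nlinarith
  have hsplit : ∑ i ∈ Finset.range q, Real.log ‖ω ^ i * v - a'‖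
      = ∑ i ∈ Finset.range q \ G, Real.log ‖ω ^ i * v - a'‖
        + ∑ i ∈ G, Real.log ‖ω ^ i * v - a'‖ := (Finset.sum_sdiff hG).symm
  have hrem : ∑ i ∈ Finset.range q \ G, Real.log ‖ω ^ i * v - a'‖
      ≤ ((q : ℝ) - G.card) * (Real.log 3 + Real.log r) := by
    have hcard : ((Finset.range q \ G).card : ℝ) = q - G.card := by
      rw [Finset.card_sdiff_of_subset hG, Finset.card_range,
        Nat.cast_sub (by simpa using Finset.card_le_card hG)]
    rw [← hcard, ← nsmul_eq_mul, ← Real.log_mul (by norm_num) hr.ne']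
    exact Finset.sum_le_card_nsmul _ _ _ fun i _ => Real.log_le_log (hpos i) (hle3 i)
  have hmax : Real.log (max r ‖a‖) ≤ Real.log 2 + Real.log r := by
    rw [← Real.log_mul two_ne_zero hr.ne']
    exact Real.log_le_log (lt_of_lt_of_le hr (le_max_left _ _)) (max_le (by linarith) ha)
  have hsum := Finset.sum_le_sum hterm
  rw [Finset.sum_sub_distrib, Finset.sum_const, nsmul_eq_mul] at hsum
  rw [Finset.sum_sub_distrib, Finset.sum_const, nsmul_eq_mul]
  have hGc : (G.card : ℝ) ≤ q := by
    have := Finset.card_le_card hG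
    rw [Finset.card_range] at this
    exact_mod_cast this
  have hG0 : (0 : ℝ) ≤ G.card := by positivity
  have hlog2 := Real.log_two_lt_d9
  have h20 : Real.log 10 + Real.log 2 ≤ 4 := by
    rw [← Real.log_mul (by norm_num) (by norm_num)]
    calc Real.log (10 * 2) ≤ Real.log (2 ^ 5) := Real.log_le_log (by norm_num) (by norm_num)
      _ = 5 * Real.log 2 := by rw [Real.log_pow]; norm_num
      _ ≤ 4 := by linarith
  have h3 : Real.log 3 ≤ 4 := by
    calc Real.log 3 ≤ Real.log (2 ^ 2) := Real.log_le_log (by norm_num) (by norm_num)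
      _ = 2 * Real.log 2 := by rw [Real.log_pow]; norm_num
      _ ≤ 4 := by linarith
  have hm1 := mul_le_mul_of_nonneg_left hmax hG0
  have hm2 := mul_le_mul_of_nonneg_left h20 hG0
  have hm3 := mul_le_mul_of_nonneg_left h3 (sub_nonneg.2 hGc)
  nlinarith

end Paving

section PavingRadius

open Polynomial

theorem neg_le_multiset_sum {ι : Type*} (p : ι → Prop) [DecidablePred p] (f : ι → ℝ) (A B : ℝ)
    (s : Multiset ι) (h : ∀ a ∈ s, -(if p a then A else 0) - B ≤ f a) :
    -(A * s.countP p) - B * s.card ≤ (s.map f).sum := by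
  induction s using Multiset.induction_on with
  | empty => simp
  | cons a s ih =>
    have h1 := h a (Multiset.mem_cons_self a s)
    have h2 := ih fun b hb => h b (Multiset.mem_cons_of_mem hb)
    rw [Multiset.map_cons, Multiset.sum_cons, Multiset.card_cons, Multiset.countP_cons]
    split_ifs at h1 ⊢ <;> push_cast <;> linarith

theorem sum_countP_le_card {ι κ : Type*} (p : κ → ι → Prop) [∀ r, DecidablePred (p r)]
    (R : Finset κ) (hp : ∀ r ∈ R, ∀ r' ∈ R, ∀ a, p r a → p r' a → r = r') (s : Multiset ι) :
    ∑ r ∈ R, s.countP (p r) ≤ s.card := by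
  classical
  induction s using Multiset.induction_on with
  | empty => simp
  | cons a s ih =>
    simp only [Multiset.card_cons, Multiset.countP_cons, Finset.sum_add_distrib]
    refine add_le_add ih ?_
    rw [← Finset.card_filter]
    refine Finset.card_le_one.2 fun r hr r' hr' => ?_
    rw [Finset.mem_filter] at hr hr'
    exact hp r hr.1 r' hr'.1 a hr.2 hr'.2

theorem exists_countP_mul_card_le {ι κ : Type*} (p : κ → ι → Prop) [∀ r, DecidablePred (p r)]
    (R : Finset κ) (hR : R.Nonempty) (hp : ∀ r ∈ R, ∀ r' ∈ R, ∀ a, p r a → p r' a → r = r')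
    (s : Multiset ι) : ∃ r ∈ R, s.countP (p r) * R.card ≤ s.card := by
  by_contra! h
  have h1 := Finset.sum_lt_sum_of_nonempty hR h
  rw [Finset.sum_const, ← Finset.sum_mul, smul_eq_mul] at h1
  have h2 := Nat.mul_le_mul_right R.card (sum_countP_le_card p R hp s)
  rw [mul_comm s.card] at h2
  omega

theorem card_close_le_two {α : ℝ} {x : ℚ} (hx : |α - x| < 1 / (x.den : ℝ) ^ 2) {r : ℝ}
    (hr : 0 < r) {v : ℂ} (hv : ‖v‖ = r) (a : ℂ) :
    ((Finset.range x.den).filter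
      fun i => ‖circleMap 0 1 (2 * π * α) ^ i * v - a‖ < r / x.den).card ≤ 2 := by
  classical
  set σ := circleMap 0 1 (2 * π * α)
  set S := (Finset.range x.den).filter fun i => ‖σ ^ i * v - a‖ < r / x.den with hS
  have hq : (0 : ℝ) < x.den := by exact_mod_cast x.den_pos
  have key : ∀ i ∈ S, ∀ j ∈ S, i < j → x.den < 2 * (j - i) := by
    intro i hi j hj hij
    by_contra! hle
    rw [hS, Finset.mem_filter] at hi hj
    have h1 := norm_pow_sub_pow_ge hx hij hle
    have h2 : ‖(σ ^ j - σ ^ i) * v‖ ≤ ‖σ ^ j * v - a‖ + ‖σ ^ i * v - a‖ := by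
      have := norm_sub_le (σ ^ j * v - a) (σ ^ i * v - a)
      rwa [show σ ^ j * v - a - (σ ^ i * v - a) = (σ ^ j - σ ^ i) * v by ring] at this
    rw [norm_mul, hv] at h2
    have h3 := mul_le_mul_of_nonneg_right h1 hr.le
    have h4 : 2 / (x.den : ℝ) * r = r / x.den + r / x.den := by ring
    linarith [hi.2, hj.2]
  have hsplit := Finset.card_filter_add_card_filter_not (s := S) (fun i => 2 * i < x.den)
  have hlow : (S.filter fun i => 2 * i < x.den).card ≤ 1 := by
    refine Finset.card_le_one.2 fun i hi j hj => ?_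
    rw [Finset.mem_filter] at hi hj
    rcases lt_trichotomy i j with h | h | h
    · have := key i hi.1 j hj.1 h; omega
    · exact h
    · have := key j hj.1 i hi.1 h; omega
  have hhigh : (S.filter fun i => ¬ 2 * i < x.den).card ≤ 1 := by
    refine Finset.card_le_one.2 fun i hi j hj => ?_
    rw [Finset.mem_filter] at hi hj
    have hi' := Finset.mem_range.1 (Finset.mem_filter.1 (hS ▸ hi.1)).1
    have hj' := Finset.mem_range.1 (Finset.mem_filter.1 (hS ▸ hj.1)).1
    rcases lt_trichotomy i j with h | h | h
    · have := key i hi.1 j hj.1 h; omega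
    · exact h
    · have := key j hj.1 i hi.1 h; omega
  omega

/-- Every orbit segment of length `q` on a suitable circle contains a point at which a polynomial
of degree `O(q)` is not much smaller than its geometric mean. -/
theorem exists_paving_radius {α : ℝ} {x : ℚ} (hx : |α - x| < 1 / (x.den : ℝ) ^ 2)
    {R : Finset ℝ} (hR : ∀ r ∈ R, 1 / 2 ≤ r ∧ r ≤ 2) {η : ℝ} (hη : 0 < η) (hη4 : η ≤ 1 / 4)
    (hsep : ∀ r ∈ R, ∀ r' ∈ R, r ≠ r' → 2 * η ≤ |r - r'|) {δ : ℝ} (hδ : 0 < δ)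
    (hJ : 1024 ≤ δ * R.card) (hJ' : 32 ≤ R.card) (hq1 : 1000 ≤ δ * η * x.den)
    (hq2 : 28 ≤ x.den * η) {F : ℂ[X]} (hF : F ≠ 0) (hdeg : F.natDegree ≤ 8 * x.den) :
    ∃ r ∈ R, ∀ v : ℂ, ‖v‖ = r → ∃ i < x.den,
      F.eval (circleMap 0 1 (2 * π * α) ^ i * v) ≠ 0 ∧
      avgLog F r - δ * x.den ≤ Real.log ‖F.eval (circleMap 0 1 (2 * π * α) ^ i * v)‖ := by
  classical
  set q := x.den with hq
  set σ := circleMap 0 1 (2 * π * α) with hσ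
  have hq0 : 0 < q := x.den_pos
  have hq' : (0 : ℝ) < q := by exact_mod_cast hq0
  obtain ⟨r, hrR, hcount⟩ := exists_countP_mul_card_le
    (fun (r : ℝ) (a : ℂ) => |‖a‖ - r| < η) R (Finset.card_pos.1 (by omega)) (by
      intro r hr r' hr' a h h'
      by_contra hne
      have h1 := hsep r hr r' hr' hne
      have h2 : |r - r'| ≤ |‖a‖ - r'| + |‖a‖ - r| := by
        have := abs_sub (‖a‖ - r') (‖a‖ - r)
        rwa [show ‖a‖ - r' - (‖a‖ - r) = r - r' by ring] at this
      linarith) F.roots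
  refine ⟨r, hrR, fun v hv => ?_⟩
  obtain ⟨hr12, hr2⟩ := hR r hrR
  have hr : 0 < r := by linarith
  set near : ℂ → Prop := fun a => |‖a‖ - r| < η with hnear
  set m := F.roots.countP near with hm
  have hcard : F.roots.card = F.natDegree := (IsAlgClosed.splits F).natDegree_eq_card_roots.symm
  rw [hcard] at hcount
  have hω := isPrimitiveRoot_circleMap x
  set ω := circleMap 0 1 (2 * π * (x : ℝ)) with hωdef
  have hσ1 : ‖σ‖ = 1 := by simp [hσ]
  have hwr : ∀ i, ‖σ ^ i * v‖ = r := by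
    intro i; rw [norm_mul, norm_pow, hσ1, one_pow, one_mul, hv]
  have hw : ∀ i < q, ‖σ ^ i * v - ω ^ i * v‖ ≤ 7 * r / q := by
    intro i hi
    rw [← sub_mul, norm_mul, hv, hσ, hωdef, ← circleMap_one_nat_mul, ← circleMap_one_nat_mul]
    have h1 := norm_circleMap_sub_le (2 * π * (i * α)) (2 * π * (i * (x : ℝ)))
    have h2 : |2 * π * (i * α) - 2 * π * (i * (x : ℝ))| ≤ 7 / q := by
      rw [show 2 * π * (i * α) - 2 * π * (i * (x : ℝ)) = (2 * π) * (i * (α - x)) by ring,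
        abs_mul (2 * π), abs_of_pos (by positivity : (0 : ℝ) < 2 * π), abs_mul (i : ℝ),
        Nat.abs_cast]
      have hi' : (i : ℝ) ≤ q := by exact_mod_cast hi.le
      have h3 : (i : ℝ) * |α - x| ≤ 1 / q := by
        calc (i : ℝ) * |α - x| ≤ q * (1 / (q : ℝ) ^ 2) := by gcongr
          _ = 1 / q := by field_simp
      have hpi := Real.pi_lt_d2
      calc 2 * π * (i * |α - x|) ≤ 7 * (1 / q) := by
            gcongr
            linarith
        _ = 7 / q := by ring
    calc _ ≤ 7 / q * r := by gcongr; exact h1.trans h2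
      _ = _ := by ring
  set G := (Finset.range q).filter fun i => ∀ a ∈ F.roots, near a → r / q ≤ ‖σ ^ i * v - a‖
    with hG
  have hGsub : G ⊆ Finset.range q := Finset.filter_subset _ _
  have hrem : (Finset.range q \ G).card ≤ 2 * m := by
    have hsub : Finset.range q \ G ⊆ (F.roots.filter near).toFinset.biUnion fun a =>
        (Finset.range q).filter fun i => ‖σ ^ i * v - a‖ < r / q := by
      intro i hi
      rw [Finset.mem_sdiff, hG, Finset.mem_filter, not_and] at hi
      have := hi.2 hi.1
      push Not at this
      obtain ⟨a, ha, hna, hlt⟩ := this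
      rw [Finset.mem_biUnion]
      exact ⟨a, by simpa using ⟨mem_roots'.1 ha, hna⟩, Finset.mem_filter.2 ⟨hi.1, hlt⟩⟩
    refine (Finset.card_le_card hsub).trans ((Finset.card_biUnion_le_card_mul _ _ 2
      fun a _ => card_close_le_two hx hr hv a).trans ?_)
    rw [mul_comm, hm, Multiset.countP_eq_card_filter]
    exact Nat.mul_le_mul_left 2 (Multiset.toFinset_card_le _)
  have hcardG : (Finset.range q \ G).card + G.card = q := by
    rw [Finset.card_sdiff_add_card_eq_card hGsub, Finset.card_range]
  have hroot_near : ∀ i ∈ G, F.eval (σ ^ i * v) ≠ 0 := by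
    intro i hi h0
    have hi2 := (Finset.mem_filter.1 hi).2 (σ ^ i * v) ((mem_roots hF).2 h0)
      (by simp only [hnear, hwr, sub_self, abs_zero]; exact hη)
    rw [sub_self, norm_zero] at hi2
    have : 0 < r / q := by positivity
    linarith
  have hlog2 := Real.log_two_lt_d9
  have hlog2' := Real.log_two_gt_d9
  have hper : ∀ a ∈ F.roots, -(if near a then (4 * q : ℝ) else 0) - (31 / η + 2 * m)
      ≤ ∑ i ∈ G, (Real.log ‖σ ^ i * v - a‖ - Real.log (max r ‖a‖)) := by
    intro a ha
    by_cases hna : near a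
    · rw [if_pos hna]
      have hlt := abs_lt.1 hna
      have := sum_log_near_ge hq0 hω hr hv hw (fun i _ => hwr i)
        (a := a) (by rw [← norm_pos_iff]; linarith [hlt.1]) (by linarith [hlt.2]) hGsub
        (fun i hi => (Finset.mem_filter.1 hi).2 a ha hna)
      have h31 : 0 < 31 / η := by positivity
      have hm0 : (0 : ℝ) ≤ m := by positivity
      linarith
    · rw [if_neg hna]
      have hfar := sum_log_far_ge hq0 hω hr hr2 hη (by linarith) hq2 hv hw (not_lt.1 hna)
      rw [← Finset.sum_sdiff hGsub] at hfar
      have hup : ∑ i ∈ Finset.range q \ G, (Real.log ‖σ ^ i * v - a‖ - Real.log (max r ‖a‖))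
          ≤ (Finset.range q \ G).card * Real.log 2 := by
        rw [← nsmul_eq_mul]
        refine Finset.sum_le_card_nsmul _ _ _ fun i _ => ?_
        have hmax : 0 < max r ‖a‖ := lt_of_lt_of_le hr (le_max_left _ _)
        have h1 : 0 < ‖σ ^ i * v - a‖ := by
          have := abs_norm_sub_norm_le (σ ^ i * v) a
          rw [hwr, abs_sub_comm] at this
          linarith [not_lt.1 hna]
        have h2 : ‖σ ^ i * v - a‖ ≤ 2 * max r ‖a‖ := by
          have := norm_sub_le (σ ^ i * v) a
          rw [hwr] at this
          linarith [le_max_left r ‖a‖, le_max_right r ‖a‖]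
        have := Real.log_le_log h1 h2
        rw [Real.log_mul two_ne_zero hmax.ne'] at this
        linarith
      have hcr : ((Finset.range q \ G).card : ℝ) ≤ 2 * m := by exact_mod_cast hrem
      have : ((Finset.range q \ G).card : ℝ) * Real.log 2 ≤ 2 * m := by
        have h0 : (0 : ℝ) ≤ (Finset.range q \ G).card := by positivity
        nlinarith
      linarith
  have htotal := neg_le_multiset_sum near _ _ _ F.roots hper
  rw [Multiset.sum_map_sum] at htotal
  by_contra! hfail
  have hlt : ∀ i ∈ G, (F.roots.map fun a => Real.log ‖σ ^ i * v - a‖ -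
      Real.log (max r ‖a‖)).sum < -(δ * q) := by
    intro i hi
    have h0 := hroot_near i hi
    have h1 := hfail i (Finset.mem_range.1 (hGsub hi)) h0
    rw [avgLog_eq hF hr, log_norm_eval_eq h0] at h1
    rw [Multiset.sum_map_sub]
    linarith
  have hsum : ∑ i ∈ G, (F.roots.map fun a => Real.log ‖σ ^ i * v - a‖ -
      Real.log (max r ‖a‖)).sum ≤ G.card * -(δ * q) := by
    rw [← nsmul_eq_mul]
    exact Finset.sum_le_card_nsmul _ _ _ fun i hi => (hlt i hi).le
  have hmJ : (m : ℝ) * R.card ≤ 8 * q := by exact_mod_cast hcount.trans hdeg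
  have hJr : (32 : ℝ) ≤ R.card := by exact_mod_cast hJ'
  have hm0 : (0 : ℝ) ≤ m := by positivity
  have hm4 : (4 : ℝ) * m ≤ q := by nlinarith
  have hGc : (q : ℝ) ≤ 2 * G.card := by
    have h1 : ((Finset.range q \ G).card : ℝ) + G.card = q := by exact_mod_cast hcardG
    have h2 : ((Finset.range q \ G).card : ℝ) ≤ 2 * m := by exact_mod_cast hrem
    linarith
  have hdeg' : (F.roots.card : ℝ) ≤ 8 * q := by rw [hcard]; exact_mod_cast hdeg
  have hm128 : 128 * (m : ℝ) ≤ δ * q := by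
    have : (1024 : ℝ) * m ≤ δ * (8 * q) := by
      calc (1024 : ℝ) * m ≤ δ * R.card * m := by gcongr
        _ = δ * (m * R.card) := by ring
        _ ≤ δ * (8 * q) := by gcongr
    linarith
  have h250 : 248 / η ≤ δ * q * (248 / 1000) := by
    rw [div_le_iff₀ hη]; nlinarith
  have hBd : (31 / η + 2 * m) * F.roots.card ≤ (31 / η + 2 * m) * (8 * q) := by gcongr
  have h31 : (31 / η + 2 * m) * (8 * q) = q * (248 / η + 16 * m) := by ring
  have hfin : (4 * q : ℝ) * m + q * (248 / η + 16 * m) ≤ q * (δ * q * (248 / 1000 + 20 / 128)) := by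
    nlinarith
  have hmain : (G.card : ℝ) * (δ * q) ≤ (4 * q : ℝ) * m + q * (248 / η + 16 * m) := by
    linarith
  have hbig : (q : ℝ) / 2 * (δ * q) ≤ G.card * (δ * q) := by
    have : (q : ℝ) / 2 ≤ G.card := by linarith
    gcongr
  have hδq : 0 < q * (δ * q) := by positivity
  nlinarith

end PavingRadius

section Chambers

open Polynomial ComplexConjugate

theorem trace_mulIter_rotate (B : ℂ → Matrix (Fin 2) (Fin 2) ℂ) {σ : ℂ} {Q : ℕ} (hσ : σ ^ Q = 1)
    (w : ℂ) : (mulIter B σ Q (σ * w)).trace = (mulIter B σ Q w).trace := by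
  cases Q with
  | zero => simp [mulIter]
  | succ n =>
    rw [mulIter_succ_left, ← mul_assoc, ← pow_succ, hσ, one_mul, mulIter, Matrix.trace_mul_comm]

theorem eval_eq_of_rotation_invariant {f : ℂ[X]} {ω : ℂ} {Q : ℕ} (hQ : 0 < Q)
    (hω : IsPrimitiveRoot ω Q) (hdeg : f.natDegree ≤ 2 * Q)
    (hf : ∀ w, f.eval (ω * w) = f.eval w) (w : ℂ) :
    f.eval w = f.coeff 0 + f.coeff Q * w ^ Q + f.coeff (2 * Q) * w ^ (2 * Q) := by
  have hcomp : f.comp (C ω * X) = f := by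
    refine Polynomial.funext fun z => ?_
    simp [eval_comp, hf]
  have hzero : ∀ k, ¬ Q ∣ k → f.coeff k = 0 := by
    intro k hk
    have h1 := congrArg (fun p => p.coeff k) hcomp
    simp only [comp_C_mul_X_coeff] at h1
    by_contra h0
    apply hk
    rw [← hω.pow_eq_one_iff_dvd]
    exact mul_left_cancel₀ h0 (by rw [h1, mul_one])
  rw [eval_eq_sum_range' (n := 2 * Q + 1) (by omega)]
  have hsub : ({0, Q, 2 * Q} : Finset ℕ) ⊆ Finset.range (2 * Q + 1) := by
    intro k hk
    simp only [Finset.mem_insert, Finset.mem_singleton] at hk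
    rw [Finset.mem_range]
    omega
  rw [← Finset.sum_subset hsub]
  · rw [Finset.sum_insert (by simp; omega), Finset.sum_insert (by simp; omega),
      Finset.sum_singleton, pow_zero, mul_one, add_assoc]
  · intro k hk hk'
    rw [hzero k, zero_mul]
    rintro ⟨m, rfl⟩
    simp only [Finset.mem_insert, Finset.mem_singleton, not_or, Finset.mem_range] at hk hk'
    have hm : m < 3 := by
      by_contra! h
      nlinarith
    interval_cases m
    · simp at hk'
    · simp at hk'
    · exact hk'.2.2 (mul_comm _ _)

/-- Chambers' formula: the trace over a period is controlled on every circle by a single value. -/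
theorem norm_trace_harperIter_le {l1 l2 l3 : ℝ} {ρ : ℂ} (hρ : ‖ρ‖ = 1) (E : ℂ) (h1 : 0 ≤ l1)
    (h3 : 0 ≤ l3) (h : 4 * l1 * l3 ≤ 1) {Q : ℕ} (hQ : 0 < Q) (hω : IsPrimitiveRoot (ρ ^ 2) Q)
    {w₀ : ℂ} (hw₀ : ‖w₀‖ = 1)
    (htr : ‖(harperIter l1 l2 l3 ρ E Q w₀).trace‖ ≤ 8 * harperMu l1 l3 ^ Q) (w : ℂ) :
    ‖(harperIter l1 l2 l3 ρ E Q w).trace‖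
      ≤ 16 * harperMu l1 l3 ^ Q * (max 1 ‖w‖) ^ (2 * Q) := by
  set P := polyIter (harperPoly l1 l2 l3 ρ E) (ρ ^ 2) Q with hP
  set f := P.trace with hf
  have hBdeg := natDegree_harperPoly_le l1 l2 l3 ρ E
  have heval : ∀ z, f.eval z = (harperIter l1 l2 l3 ρ E Q z).trace := by
    intro z
    rw [harperIter, ← matEval_polyIter, hf, Matrix.trace_fin_two, Matrix.trace_fin_two, eval_add]
    rfl
  have hdeg : f.natDegree ≤ 2 * Q := by
    rw [hf, Matrix.trace_fin_two]
    exact (natDegree_add_le _ _).trans (max_le (natDegree_polyIter_le hBdeg _ _ _ _)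
      (natDegree_polyIter_le hBdeg _ _ _ _))
  have hrot : ∀ z, f.eval (ρ ^ 2 * z) = f.eval z := by
    intro z
    rw [heval, heval]
    exact trace_mulIter_rotate _ hω.pow_eq_one z
  have hcoeff : ∀ k, f.coeff k = (coeffMat P k).trace := by
    intro k
    rw [hf, Matrix.trace_fin_two, Matrix.trace_fin_two, coeff_add]
    rfl
  have hmu := harperMu_pos l1 l3
  have hb0 : ‖f.coeff 0‖ ≤ 2 * harperMu l1 l3 ^ Q := by
    rw [hcoeff, coeffMat_polyIter_zero, coeffMat_harperPoly_zero]
    refine norm_trace_pow_le h1 h3 h ?_ Q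
    linear_combination (l1 * l3 : ℂ) * mul_conj_eq_one hρ
  have hb2 : ‖f.coeff (2 * Q)‖ ≤ 2 * harperMu l1 l3 ^ Q := by
    obtain ⟨u, hu, hu'⟩ := coeffMat_polyIter_top hBdeg (σ := ρ ^ 2) (by simp [hρ]) Q
    rw [hcoeff, hP, hu', coeffMat_harperPoly_two, Matrix.trace_smul, norm_smul, hu, one_mul]
    refine norm_trace_pow_le h1 h3 h ?_ Q
    linear_combination (l1 * l3 : ℂ) * mul_conj_eq_one hρ
  have hform := eval_eq_of_rotation_invariant hQ hω hdeg hrot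
  have ha : ‖f.coeff Q‖ ≤ 12 * harperMu l1 l3 ^ Q := by
    have e : f.coeff Q * w₀ ^ Q = f.eval w₀ - f.coeff 0 - f.coeff (2 * Q) * w₀ ^ (2 * Q) := by
      rw [hform w₀]; ring
    have e2 := congrArg norm e
    rw [norm_mul, norm_pow, hw₀, one_pow, mul_one] at e2
    rw [e2]
    refine (norm_sub_le _ _).trans ?_
    have h5 := norm_sub_le (f.eval w₀) (f.coeff 0)
    rw [norm_mul, norm_pow, hw₀, one_pow, mul_one]
    rw [heval] at h5 ⊢
    linarith
  rw [← heval, hform w]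
  set m := max 1 ‖w‖ with hm
  have hm1 : 1 ≤ m := le_max_left _ _
  have hwm : ‖w‖ ≤ m := le_max_right _ _
  have hX : 0 < harperMu l1 l3 ^ Q := by positivity
  have t0 : ‖f.coeff 0‖ ≤ 2 * harperMu l1 l3 ^ Q * m ^ (2 * Q) :=
    hb0.trans (le_mul_of_one_le_right (by positivity) (one_le_pow₀ hm1))
  have t1 : ‖f.coeff Q * w ^ Q‖ ≤ 12 * harperMu l1 l3 ^ Q * m ^ (2 * Q) := by
    rw [norm_mul, norm_pow]
    have : ‖w‖ ^ Q ≤ m ^ (2 * Q) :=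
      (pow_le_pow_left₀ (norm_nonneg _) hwm Q).trans (pow_le_pow_right₀ hm1 (by omega))
    gcongr
  have t2 : ‖f.coeff (2 * Q) * w ^ (2 * Q)‖ ≤ 2 * harperMu l1 l3 ^ Q * m ^ (2 * Q) := by
    rw [norm_mul, norm_pow]
    gcongr
  have := norm_add₃_le (a := f.coeff 0) (b := f.coeff Q * w ^ Q)
    (c := f.coeff (2 * Q) * w ^ (2 * Q))
  linarith

end Chambers

section Dichotomy

open Polynomial ComplexConjugate

theorem frobenius_norm_smul (z : ℂ) (M : Matrix (Fin 2) (Fin 2) ℂ) : ‖z • M‖ = ‖z‖ * ‖M‖ := by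
  refine (sq_eq_sq₀ (norm_nonneg _) (by positivity)).1 ?_
  rw [mul_pow, frobenius_norm_sq, frobenius_norm_sq]
  simp only [Matrix.smul_apply, norm_smul]
  ring

theorem exponent_alternative {q k l L d a τ : ℝ} (ha : 0 < a) (hqa : 1 ≤ q * a) (hqk : q ≤ k)
    (hk2 : k ≤ 2 * q) (hlk : l + k = 4 * q)
    (h : Real.exp (4 * q * (L - a)) ≤ Real.exp (τ * l + k * (L + a)) +
      Real.exp (l * (L + a) + k * (d + a) - τ * k)) :
    L - 4 * a ≤ τ ∨ τ ≤ d - L + 9 * a := by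
  have hq : 0 < q := by
    by_contra! h
    nlinarith
  have hlog : ∀ y, Real.exp (4 * q * (L - a)) ≤ 2 * Real.exp y → 4 * q * (L - a) - q * a ≤ y := by
    intro y hy
    have h2 : (2 : ℝ) ≤ Real.exp 1 := by linarith [Real.add_one_le_exp (1 : ℝ)]
    have : Real.exp (4 * q * (L - a)) ≤ Real.exp (1 + y) := by
      rw [Real.exp_add]
      refine hy.trans ?_
      gcongr
    have := Real.exp_le_exp.1 this
    linarith
  rcases le_total (Real.exp (τ * l + k * (L + a)))
    (Real.exp (l * (L + a) + k * (d + a) - τ * k)) with hc | hc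
  · right
    have h1 := hlog (l * (L + a) + k * (d + a) - τ * k) (by linarith)
    have hll : l = 4 * q - k := by linarith
    rw [hll] at h1
    have h2 : k * τ ≤ k * (d - L + 9 * a) := by nlinarith
    exact le_of_mul_le_mul_left h2 (by linarith)
  · left
    have h1 := hlog (τ * l + k * (L + a)) (by linarith)
    have hll : k = 4 * q - l := by linarith
    have h2 : l * (L - 4 * a) ≤ l * τ := by
      have h3 : 2 * q ≤ l := by linarith
      rw [hll] at h1
      nlinarith
    exact le_of_mul_le_mul_left h2 (by linarith)

/-- A block of the cocycle whose norm is close to maximal forces the exponent of every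
quasi-periodic solution to be close to one of the two extreme exponents. -/
theorem exponent_dichotomy {B : ℂ → Matrix (Fin 2) (Fin 2) ℂ} {σ : ℂ} {Q : ℕ} (hQ : 0 < Q)
    (hσ : σ ^ Q = 1) {r : ℝ} {w : ℂ} (hw : ‖w‖ = r) {W : Matrix (Fin 2) (Fin 2) ℂ} (hW0 : W ≠ 0)
    {Θ : ℂ} (hΘ : Θ ≠ 0) (hW : mulIter B σ Q w * W = Θ • W) {q : ℕ} {L d a : ℝ} (ha : 0 < a)
    (hqa : 1 ≤ q * a)
    (hpave : ∀ v, ‖v‖ = r → ∃ k, q ≤ k ∧ k < 2 * q ∧ ∃ u, σ ^ k * u = v ∧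
      Real.exp (4 * q * (L - a)) ≤ ‖mulIter B σ (4 * q) u‖)
    (hup : ∀ n, q ≤ n → n ≤ 3 * q → ∀ v, ‖v‖ = r → ‖mulIter B σ n v‖ ≤ Real.exp (n * (L + a)))
    (hdet : ∀ n, q ≤ n → n ≤ 3 * q → ∀ v, ‖v‖ = r →
      ‖(mulIter B σ n v).det‖ ≤ Real.exp (n * (d + a))) :
    Q * (L - 4 * a) ≤ Real.log ‖Θ‖ ∨ Real.log ‖Θ‖ ≤ Q * (d - L + 9 * a) := by
  have hσ1 : ‖σ‖ = 1 := Complex.norm_eq_one_of_pow_eq_one hσ hQ.ne'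
  have hσ0 : σ ≠ 0 := by rw [← norm_pos_iff, hσ1]; exact one_pos
  have hQ' : (0 : ℝ) < Q := by exact_mod_cast hQ
  have hq' : (0 : ℝ) < q := by
    by_contra! h
    nlinarith
  set V : ℕ → Matrix (Fin 2) (Fin 2) ℂ := fun n => mulIter B σ n w * W with hV
  obtain ⟨τ, hτ⟩ : ∃ τ, τ = Real.log ‖Θ‖ / Q := ⟨_, rfl⟩
  have hτΘ : Real.exp (τ * Q) = ‖Θ‖ := by
    rw [hτ, div_mul_cancel₀ _ hQ'.ne', Real.exp_log (norm_pos_iff.2 hΘ)]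
  have hVper : ∀ n, V (n + Q) = Θ • V n := by
    intro n
    simp only [hV]
    rw [mulIter_add, hσ, one_mul, mul_assoc, hW, mul_smul_comm]
  set g : ℕ → ℝ := fun n => ‖V n‖ * Real.exp (-(τ * n)) with hg
  have hgper : ∀ n, g (n + Q) = g n := by
    intro n
    simp only [hg]
    rw [hVper, frobenius_norm_smul, ← hτΘ]
    push_cast
    rw [show -(τ * (n + Q)) = -(τ * Q) + -(τ * n) by ring, Real.exp_add, Real.exp_neg (τ * Q)]
    have := Real.exp_pos (τ * Q)
    field_simp
  have hgper' : ∀ m n, g (n + m * Q) = g n := by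
    intro m
    induction m with
    | zero => simp
    | succ m ih => intro n; rw [add_mul, one_mul, ← add_assoc, hgper, ih]
  obtain ⟨n₀, hn₀, hmax₀⟩ := Finset.exists_max_image (Finset.range Q) g ⟨0, Finset.mem_range.2 hQ⟩
  obtain ⟨n, hn⟩ : ∃ n, n = n₀ + 2 * q * Q := ⟨_, rfl⟩
  have hmax : ∀ m, g m ≤ g n := by
    intro m
    rw [hn, hgper' (2 * q) n₀, ← Nat.mod_add_div m Q, mul_comm Q, hgper']
    exact hmax₀ _ (Finset.mem_range.2 (Nat.mod_lt _ hQ))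
  have hgle : ∀ m, ‖V m‖ ≤ ‖V n‖ * Real.exp (τ * (m - n)) := by
    intro m
    have := hmax m
    simp only [hg] at this
    have e : ‖V n‖ * Real.exp (τ * (m - n)) = (‖V n‖ * Real.exp (-(τ * n))) * Real.exp (τ * m) := by
      rw [mul_assoc, ← Real.exp_add]; ring_nf
    have e2 : ‖V m‖ = (‖V m‖ * Real.exp (-(τ * m))) * Real.exp (τ * m) := by
      rw [mul_assoc, ← Real.exp_add]; simp
    rw [e, e2]
    gcongr
  have hVn : 0 < ‖V n‖ := by
    have h1 := hgle 0
    have h2 : 0 < ‖V 0‖ := by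
      simp only [hV, mulIter, one_mul]
      exact norm_pos_iff.2 hW0
    by_contra! h
    have := mul_nonpos_of_nonpos_of_nonneg h (Real.exp_pos (τ * ((0 : ℕ) - n))).le
    linarith
  have hnorm : ∀ m, ‖σ ^ m * w‖ = r := by
    intro m; rw [norm_mul, norm_pow, hσ1, one_pow, one_mul, hw]
  obtain ⟨k, hqk, hk2, u, hu, hbig⟩ := hpave (σ ^ n * w) (hnorm n)
  have hkn : k ≤ n := by
    have : 2 * q ≤ 2 * q * Q := Nat.le_mul_of_pos_right _ hQ
    omega
  obtain ⟨p, hp⟩ := Nat.exists_eq_add_of_le' hkn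
  have hu' : u = σ ^ p * w := by
    refine mul_left_cancel₀ (pow_ne_zero k hσ0) ?_
    rw [hu, hp, pow_add]; ring
  obtain ⟨l, hl⟩ := Nat.exists_eq_add_of_le' (show k ≤ 4 * q by omega)
  set M1 := mulIter B σ k (σ ^ p * w) with hM1
  set M2 := mulIter B σ l (σ ^ n * w) with hM2
  have hprod : mulIter B σ (4 * q) u = M2 * M1 := by
    rw [hl, mulIter_add, hM2, hM1, ← hu, hu']
  have hV1 : M1 * V p = V n := by
    simp only [hV, hM1]
    rw [← mul_assoc, hp, add_comm p k, mulIter_add B σ k p w]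
  have hV2 : M2 * V n = V (l + n) := by
    simp only [hV, hM2]
    rw [← mul_assoc, mulIter_add B σ l n w]
  have hadj : M1.adjugate * V n = M1.det • V p := by
    rw [← hV1, ← mul_assoc, Matrix.adjugate_mul, Matrix.smul_mul, one_mul]
  have hkey := frobenius_norm_mul_product_le M1 M2 (V n)
  rw [hV2, hadj, frobenius_norm_smul, ← hprod] at hkey
  have b1 : ‖V (l + n)‖ ≤ ‖V n‖ * Real.exp (τ * l) := by
    have := hgle (l + n)
    push_cast at this
    rwa [add_sub_cancel_right] at this
  have b2 : ‖V p‖ ≤ ‖V n‖ * Real.exp (-(τ * k)) := by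
    have := hgle p
    rw [hp] at this
    push_cast at this
    rw [hp]
    convert this using 3
    ring
  have b3 : ‖M1‖ ≤ Real.exp (k * (L + a)) := hup k hqk (by omega) _ (hnorm p)
  have b4 : ‖M2‖ ≤ Real.exp (l * (L + a)) := hup l (by omega) (by omega) _ (hnorm n)
  have b5 : ‖M1.det‖ ≤ Real.exp (k * (d + a)) := hdet k hqk (by omega) _ (hnorm p)
  have hfin : Real.exp (4 * q * (L - a)) ≤ Real.exp (τ * l + k * (L + a)) +
      Real.exp (l * (L + a) + k * (d + a) - τ * k) := by
    refine le_of_mul_le_mul_left ?_ hVn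
    calc ‖V n‖ * Real.exp (4 * q * (L - a)) ≤ ‖V n‖ * ‖mulIter B σ (4 * q) u‖ := by gcongr
      _ ≤ _ := hkey
      _ ≤ (‖V n‖ * Real.exp (τ * l)) * Real.exp (k * (L + a)) +
          Real.exp (l * (L + a)) * (Real.exp (k * (d + a)) *
            (‖V n‖ * Real.exp (-(τ * k)))) := by gcongr
      _ = _ := by
        rw [sub_eq_add_neg, Real.exp_add, Real.exp_add, Real.exp_add]
        ring
  have hτQ : Real.log ‖Θ‖ = Q * τ := by rw [hτ]; field_simp
  rw [hτQ]
  refine (exponent_alternative ha hqa (by exact_mod_cast hqk) (by exact_mod_cast hk2.le)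
    (by exact_mod_cast hl.symm) hfin).imp (fun h => ?_) fun h => ?_
  · gcongr
  · gcongr

theorem norm_det_harperIter {l1 l2 l3 : ℝ} {ρ : ℂ} (hρ : ‖ρ‖ = 1) (E : ℂ) (n : ℕ) (w : ℂ) :
    ‖(harperIter l1 l2 l3 ρ E n w).det‖ =
      (∏ k ∈ Finset.range n, ‖(harperG l1 l2 l3).eval ((ρ ^ 2) ^ k * (ρ * w))‖) *
      ∏ k ∈ Finset.range n, ‖(harperG l3 l2 l1).eval ((ρ ^ 2) ^ k * (conj ρ * w))‖ := by
  rw [harperIter, det_mulIter, norm_prod, ← Finset.prod_mul_distrib]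
  refine Finset.prod_congr rfl fun k _ => ?_
  rw [norm_det_harperPoly hρ]
  congr 3 <;> ring

/-- Over a rational rotation, positivity of the exponent gap is incompatible with an energy at
which the trace over a period is small. -/
theorem false_of_rational_approximant {l1 l2 l3 : ℝ} {ρ : ℂ} (hρ : ‖ρ‖ = 1) (E : ℂ) (h1 : 0 ≤ l1)
    (h3 : 0 ≤ l3) (h : 4 * l1 * l3 ≤ 1) (hpos : l1 ≠ 0 ∨ l2 ≠ 0 ∨ l3 ≠ 0) {Q : ℕ} (hQ : 0 < Q)
    (hω : IsPrimitiveRoot (ρ ^ 2) Q) {w₀ : ℂ} (hw₀ : ‖w₀‖ = 1)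
    (htr : ‖(harperIter l1 l2 l3 ρ E Q w₀).trace‖ ≤ 8 * harperMu l1 l3 ^ Q)
    {r : ℝ} (hr : 0 < r) {q : ℕ} {L a : ℝ} (ha : 0 < a) (hqa : 1 ≤ q * a) (hQa : 3 ≤ Q * a)
    (hL : Real.log (harperMu l1 l3) + 2 * Real.posLog r + 16 * a ≤ L)
    (hd : avgLog (harperG l1 l2 l3) r + avgLog (harperG l3 l2 l1) r + 32 * a ≤ 2 * L)
    (hpave : ∀ v, ‖v‖ = r → ∃ k, q ≤ k ∧ k < 2 * q ∧ ∃ u, (ρ ^ 2) ^ k * u = v ∧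
      Real.exp (4 * q * (L - a)) ≤ ‖harperIter l1 l2 l3 ρ E (4 * q) u‖)
    (hup : ∀ n, q ≤ n → n ≤ 3 * q → ∀ v, ‖v‖ = r →
      ‖harperIter l1 l2 l3 ρ E n v‖ ≤ Real.exp (n * (L + a)))
    (hdet : ∀ n, q ≤ n → n ≤ 3 * q → ∀ v, ‖v‖ = r → ‖(harperIter l1 l2 l3 ρ E n v).det‖ ≤
      Real.exp (n * (avgLog (harperG l1 l2 l3) r + avgLog (harperG l3 l2 l1) r + a)))
    (hlow1 : ∀ u : ℂ, ‖u‖ = r → (2⁻¹) ^ (harperG l1 l2 l3).natDegree *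
      Real.exp (Q * avgLog (harperG l1 l2 l3) r) ≤
        ∏ k ∈ Finset.range Q, ‖(harperG l1 l2 l3).eval ((ρ ^ 2) ^ k * u)‖)
    (hlow3 : ∀ u : ℂ, ‖u‖ = r → (2⁻¹) ^ (harperG l3 l2 l1).natDegree *
      Real.exp (Q * avgLog (harperG l3 l2 l1) r) ≤
        ∏ k ∈ Finset.range Q, ‖(harperG l3 l2 l1).eval ((ρ ^ 2) ^ k * u)‖) : False := by
  set d1 := avgLog (harperG l1 l2 l3) r with hd1
  set d3 := avgLog (harperG l3 l2 l1) r with hd3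
  have hQ' : (0 : ℝ) < Q := by exact_mod_cast hQ
  have hmu := harperMu_pos l1 l3
  obtain ⟨w, hw⟩ : ∃ w : ℂ, ‖w‖ = r := ⟨r, by simp [abs_of_pos hr]⟩
  have hρc : ‖conj ρ‖ = 1 := by simp [hρ]
  have hG1 : harperG l1 l2 l3 ≠ 0 := harperG_ne_zero hpos
  have hG3 : harperG l3 l2 l1 ≠ 0 := harperG_ne_zero (by tauto)
  have hn1 : (harperG l1 l2 l3).natDegree ≤ 2 := natDegree_harperG_le _ _ _
  have hn3 : (harperG l3 l2 l1).natDegree ≤ 2 := natDegree_harperG_le _ _ _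
  have hu1 : ‖ρ * w‖ = r := by rw [norm_mul, hρ, one_mul, hw]
  have hu3 : ‖conj ρ * w‖ = r := by rw [norm_mul, hρc, one_mul, hw]
  have hdetUp : ‖(harperIter l1 l2 l3 ρ E Q w).det‖ ≤ 16 * Real.exp (Q * (d1 + d3)) := by
    rw [norm_det_harperIter hρ]
    have t1 := prod_norm_eval_rotation_le hQ hω hG1 hr hu1
    have t3 := prod_norm_eval_rotation_le hQ hω hG3 hr hu3
    have p1 : (2 : ℝ) ^ (harperG l1 l2 l3).natDegree ≤ 2 ^ 2 := pow_le_pow_right₀ (by norm_num) hn1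
    have p3 : (2 : ℝ) ^ (harperG l3 l2 l1).natDegree ≤ 2 ^ 2 := pow_le_pow_right₀ (by norm_num) hn3
    calc _ ≤ (2 ^ 2 * Real.exp (Q * d1)) * (2 ^ 2 * Real.exp (Q * d3)) := by
          refine mul_le_mul (t1.trans ?_) (t3.trans ?_) (Finset.prod_nonneg fun _ _ => norm_nonneg _)
            (by positivity)
          · gcongr
          · gcongr
      _ = _ := by rw [mul_add, Real.exp_add]; ring
  have hdetLow : 16⁻¹ * Real.exp (Q * (d1 + d3)) ≤ ‖(harperIter l1 l2 l3 ρ E Q w).det‖ := by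
    rw [norm_det_harperIter hρ]
    have p1 : (2⁻¹ : ℝ) ^ 2 ≤ (2⁻¹) ^ (harperG l1 l2 l3).natDegree :=
      pow_le_pow_of_le_one (by norm_num) (by norm_num) hn1
    have p3 : (2⁻¹ : ℝ) ^ 2 ≤ (2⁻¹) ^ (harperG l3 l2 l1).natDegree :=
      pow_le_pow_of_le_one (by norm_num) (by norm_num) hn3
    calc _ = ((2⁻¹) ^ 2 * Real.exp (Q * d1)) * ((2⁻¹) ^ 2 * Real.exp (Q * d3)) := by
          rw [mul_add, Real.exp_add]; ring
      _ ≤ _ := by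
          refine mul_le_mul (le_trans ?_ (hlow1 _ hu1)) (le_trans ?_ (hlow3 _ hu3))
            (by positivity) (Finset.prod_nonneg fun _ _ => norm_nonneg _)
          · gcongr
          · gcongr
  have htrace := norm_trace_harperIter_le hρ E h1 h3 h hQ hω hw₀ htr w
  set M := harperIter l1 l2 l3 ρ E Q w with hM
  set Y := Real.exp (Q * (L - 16 * a)) with hY
  have hY0 : 0 < Y := Real.exp_pos _
  have hTY : ‖M.trace‖ ≤ 16 * Y := by
    refine htrace.trans ?_
    rw [mul_assoc]
    gcongr
    rw [hw, hY, ← Real.exp_log hmu, ← Real.exp_log (show 0 < max 1 r by positivity),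
      ← Real.exp_nat_mul, ← Real.exp_nat_mul, ← Real.exp_add, Real.exp_le_exp,
      ← Real.posLog_eq_log_max_one hr.le]
    push_cast
    nlinarith
  have hDY : ‖M.det‖ ≤ 16 * Y ^ 2 := by
    refine hdetUp.trans ?_
    gcongr
    rw [hY, ← Real.exp_nat_mul, Real.exp_le_exp]
    push_cast
    nlinarith
  obtain ⟨x, y, hxy, hxy', ⟨W1, hW1, hx⟩, ⟨W2, hW2, hy⟩⟩ := exists_eigenvalues M
  have hdet0 : M.det ≠ 0 := by
    rw [← norm_pos_iff]
    exact lt_of_lt_of_le (by positivity) hdetLow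
  have hx0 : x ≠ 0 := by rintro rfl; exact hdet0 (by rw [← hxy', zero_mul])
  have hy0 : y ≠ 0 := by rintro rfl; exact hdet0 (by rw [← hxy', mul_zero])
  have hsize : ∀ z z' : ℂ, z + z' = M.trace → z * z' = M.det → z ≠ 0 →
      ¬ Q * (L - 4 * a) ≤ Real.log ‖z‖ := by
    intro z z' hs hp hz hle
    have hz0 := norm_pos_iff.2 hz
    have e : z ^ 2 = z * M.trace - M.det := by rw [← hs, ← hp]; ring
    have e2 : ‖z‖ ^ 2 ≤ ‖z‖ * ‖M.trace‖ + ‖M.det‖ := by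
      rw [← norm_pow, e]
      exact (norm_sub_le _ _).trans (by rw [norm_mul])
    have hz17 : ‖z‖ ≤ 17 * Y := by
      by_contra! hlt
      nlinarith [mul_le_mul_of_nonneg_left hTY hz0.le]
    have hexp : Real.exp (Q * (L - 4 * a)) ≤ ‖z‖ := by
      rw [← Real.exp_log hz0]; exact Real.exp_le_exp.2 hle
    have e3 : Real.exp (Q * (L - 4 * a)) = Real.exp (Q * a * 12) * Y := by
      rw [hY, ← Real.exp_add]; ring_nf
    rw [e3] at hexp
    have h36 : Real.exp (Q * a * 12) ≤ 17 := le_of_mul_le_mul_right (hexp.trans hz17) hY0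
    linarith [Real.add_one_le_exp (Q * a * 12)]
  have hdx := exponent_dichotomy hQ hω.pow_eq_one hw hW1 hx0 hx ha hqa hpave hup hdet
  have hdy := exponent_dichotomy hQ hω.pow_eq_one hw hW2 hy0 hy ha hqa hpave hup hdet
  have hdx' := hdx.resolve_left (hsize x y hxy hxy' hx0)
  have hdy' := hdy.resolve_left (hsize y x (by rw [add_comm, hxy]) (by rw [mul_comm, hxy']) hy0)
  have hlogdet : Real.log ‖x‖ + Real.log ‖y‖ = Real.log ‖M.det‖ := by
    rw [← hxy', norm_mul, Real.log_mul (norm_ne_zero_iff.2 hx0) (norm_ne_zero_iff.2 hy0)]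
  have hlogLow : Q * (d1 + d3) - 3 ≤ Real.log ‖M.det‖ := by
    have := Real.log_le_log (by positivity) hdetLow
    rw [Real.log_mul (by norm_num) (Real.exp_pos _).ne', Real.log_exp, Real.log_inv,
      show (16 : ℝ) = 2 ^ 4 by norm_num, Real.log_pow] at this
    push_cast at this
    linarith [Real.log_two_lt_d9]
  nlinarith

end Dichotomy

section ApproximateEigenvectors

open ComplexConjugate

theorem exists_approximate_eigenvector {F : Type*} [NormedAddCommGroup F] [InnerProductSpace ℂ F]
    [CompleteSpace F] {T : F →L[ℂ] F} (hT : IsSelfAdjoint T) {E : ℝ}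
    (hE : (E : ℂ) ∈ spectrum ℂ T) {ε : ℝ} (hε : 0 < ε) :
    ∃ ψ, ‖T ψ - (E : ℂ) • ψ‖ < ε * ‖ψ‖ := by
  by_contra! h
  apply hE
  set S := algebraMap ℂ (F →L[ℂ] F) E - T with hS
  have hSapp : ∀ x, S x = (E : ℂ) • x - T x := fun x => by simp [hS, Algebra.algebraMap_eq_smul_one]
  have hSsa : IsSelfAdjoint S := by
    refine IsSelfAdjoint.sub ?_ hT
    rw [IsSelfAdjoint, ← algebraMap_star_comm]
    simp
  have hnormal : IsStarNormal S := hSsa.isStarNormal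
  have hbelow : ∀ x, ε * ‖x‖ ≤ ‖S x‖ := fun x => by
    rw [hSapp, norm_sub_rev]
    exact h x
  change IsUnit S
  rw [ContinuousLinearMap.isUnit_iff_bijective,
    ContinuousLinearMap.bijective_iff_dense_range_and_antilipschitz]
  refine ⟨?_, (Real.toNNReal ε)⁻¹, ?_⟩
  · rw [Submodule.topologicalClosure_eq_top_iff, ContinuousLinearMap.IsStarNormal.orthogonal_range hnormal, Submodule.eq_bot_iff]
    intro x hx
    have h1 := hbelow x
    rw [show S x = 0 from hx, norm_zero] at h1
    by_contra hx0
    have := mul_pos hε (norm_pos_iff.2 hx0)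
    linarith
  · refine AddMonoidHomClass.antilipschitz_of_bound S fun x => ?_
    have h1 := hbelow x
    rw [NNReal.coe_inv, Real.coe_toNNReal _ hε.le, inv_mul_eq_div, le_div_iff₀ hε, mul_comm]
    exact h1

/-- A Jacobi operator acting on sequences. -/
def jacobi (V : ℤ → ℝ) (c : ℤ → ℂ) (ψ : ℤ → ℂ) (k : ℤ) : ℂ :=
  V k * ψ k + c k * ψ (k + 1) + conj (c (k - 1)) * ψ (k - 1)

theorem isSelfAdjoint_of_jacobi {V : ℤ → ℝ} {c : ℤ → ℂ}
    {H : lp (fun _ : ℤ => ℂ) 2 →L[ℂ] lp (fun _ : ℤ => ℂ) 2}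
    (hH : ∀ (ψ : lp (fun _ : ℤ => ℂ) 2) (k : ℤ), H ψ k = jacobi V c ψ k) : IsSelfAdjoint H := by
  rw [ContinuousLinearMap.isSelfAdjoint_iff']
  have hent : ∀ (j k : ℤ) (a : ℂ), H (lp.single 2 j a) k =
      (if k = j then (V k : ℂ) else 0) * a + (if k + 1 = j then c k else 0) * a +
      (if k = j + 1 then conj (c j) else 0) * a := by
    intro j k a
    rw [hH, jacobi]
    simp only [lp.single_apply, Pi.single_apply]
    congr 1
    · congr 1 <;> split_ifs <;> simp
    · by_cases h : k = j + 1
      · subst h; simp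
      · rw [if_neg (by omega), if_neg h]; simp
  refine lp.ext_continuousLinearMap (by norm_num) fun j => ?_
  refine ContinuousLinearMap.ext fun a => lp.ext (funext fun k => ?_)
  have h1 : (ContinuousLinearMap.adjoint H (lp.single 2 j a)) k =
      inner ℂ (lp.single 2 k (1 : ℂ)) (ContinuousLinearMap.adjoint H (lp.single 2 j a)) := by
    rw [lp.inner_single_left]; simp
  have h2 : ContinuousLinearMap.adjoint H (lp.single 2 j a) k = H (lp.single 2 j a) k := by
    rw [h1, ContinuousLinearMap.adjoint_inner_right, lp.inner_single_right, hent, hent]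
    simp only [RCLike.inner_apply, map_add, mul_one]
    rcases eq_or_ne k j with rfl | h
    · simp [mul_comm]
    · rcases eq_or_ne (k + 1) j with rfl | h'
      · simp [mul_comm, add_assoc]
      · rcases eq_or_ne k (j + 1) with rfl | h''
        · simp [mul_comm, add_assoc]
        · rw [if_neg h.symm, if_neg h, if_neg h'', if_neg h', if_neg (Ne.symm h''),
            if_neg (Ne.symm h')]
          simp
  exact h2

theorem norm_sq_eq_sum_of_support (f : lp (fun _ : ℤ => ℂ) 2) (s : Finset ℤ)
    (hs : ∀ k ∉ s, f k = 0) : ‖f‖ ^ 2 = ∑ k ∈ s, ‖f k‖ ^ 2 := by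
  have h := lp.norm_rpow_eq_tsum (p := 2) (by norm_num) f
  simp only [ENNReal.toReal_ofNat, Real.rpow_ofNat] at h
  rw [h, tsum_eq_sum fun k hk => by rw [hs k hk]; simp]

theorem exists_finite_approximate_eigenvector {V : ℤ → ℝ} {c : ℤ → ℂ}
    {H : lp (fun _ : ℤ => ℂ) 2 →L[ℂ] lp (fun _ : ℤ => ℂ) 2}
    (hH : ∀ (ψ : lp (fun _ : ℤ => ℂ) 2) (k : ℤ), H ψ k = jacobi V c ψ k) {E : ℝ}
    (hE : (E : ℂ) ∈ spectrum ℂ H) {ε : ℝ} (hε : 0 < ε) :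
    ∃ (n : ℕ) (ψ : ℤ → ℂ), (∀ k, n < k.natAbs → ψ k = 0) ∧
      ∑ k ∈ Finset.Icc (-(n + 1 : ℤ)) (n + 1), ‖jacobi V c ψ k - E * ψ k‖ ^ 2 <
        ε ^ 2 * ∑ k ∈ Finset.Icc (-(n + 1 : ℤ)) (n + 1), ‖ψ k‖ ^ 2 := by
  obtain ⟨ψ₀, hψ₀⟩ := exists_approximate_eigenvector (isSelfAdjoint_of_jacobi hH) hE hε
  have hopen : IsOpen {ψ : lp (fun _ : ℤ => ℂ) 2 | ‖H ψ - (E : ℂ) • ψ‖ < ε * ‖ψ‖} :=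
    isOpen_lt (by fun_prop) (by fun_prop)
  have hlim := lp.hasSum_single (p := 2) (by norm_num) ψ₀
  obtain ⟨s, hs⟩ := (hlim.eventually (hopen.mem_nhds hψ₀)).exists
  set φ := ∑ i ∈ s, lp.single (E := fun _ : ℤ => ℂ) 2 i (ψ₀ i) with hφ
  have hφs : ∀ k ∉ s, φ k = 0 := by
    intro k hk
    rw [hφ, lp.coeFn_sum, Finset.sum_apply]
    refine Finset.sum_eq_zero fun i hi => ?_
    exact lp.single_apply_ne 2 i _ (by rintro rfl; exact hk hi)
  set n := s.sup Int.natAbs with hn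
  have hφn : ∀ k, n < k.natAbs → φ k = 0 := by
    intro k hk
    refine hφs k fun hks => ?_
    have : k.natAbs ≤ n := Finset.le_sup (f := Int.natAbs) hks
    omega
  refine ⟨n, φ, hφn, ?_⟩
  have hval : ∀ k, (H φ - (E : ℂ) • φ) k = jacobi V c φ k - E * φ k := by
    intro k
    rw [lp.coeFn_sub, Pi.sub_apply, hH, lp.coeFn_smul, Pi.smul_apply, smul_eq_mul]
  have e1 := norm_sq_eq_sum_of_support (H φ - (E : ℂ) • φ) (Finset.Icc (-(n + 1 : ℤ)) (n + 1)) (by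
    intro k hk
    rw [Finset.mem_Icc] at hk
    rw [hval, jacobi, hφn k (by omega), hφn (k + 1) (by omega), hφn (k - 1) (by omega)]
    simp)
  have e2 := norm_sq_eq_sum_of_support φ (Finset.Icc (-(n + 1 : ℤ)) (n + 1)) (by
    intro k hk
    rw [Finset.mem_Icc] at hk
    exact hφn k (by omega))
  simp only [hval] at e1
  rw [← e1, ← e2, ← mul_pow]
  exact pow_lt_pow_left₀ hs (norm_nonneg _) two_ne_zero

theorem LinearMap.IsSymmetric.exists_eigenvector_near {F : Type*} [NormedAddCommGroup F]
    [InnerProductSpace ℂ F] [FiniteDimensional ℂ F] {T : F →ₗ[ℂ] F} (hT : T.IsSymmetric) {E ε : ℝ}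
    (hε : 0 < ε) {v : F} (hv : ‖T v - (E : ℂ) • v‖ ^ 2 < ε ^ 2 * ‖v‖ ^ 2) :
    ∃ (E' : ℝ) (u : F), |E' - E| < ε ∧ u ≠ 0 ∧ T u = (E' : ℂ) • u := by
  set b := hT.eigenvectorBasis rfl with hb
  set l := hT.eigenvalues rfl with hl
  by_contra! hcon
  have hlarge : ∀ i, ε ≤ |l i - E| := by
    intro i
    by_contra! hi
    exact hcon (l i) (b i) hi (b.orthonormal.ne_zero i) (hT.apply_eigenvectorBasis rfl i)
  have hrep : ∀ y : F, ‖y‖ ^ 2 = ∑ i, ‖b.repr y i‖ ^ 2 := by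
    intro y
    rw [← b.repr.norm_map, EuclideanSpace.norm_sq_eq]
  rw [hrep, hrep v, Finset.mul_sum] at hv
  refine absurd hv (not_lt.2 (Finset.sum_le_sum fun i _ => ?_))
  have e : b.repr (T v - (E : ℂ) • v) i = ((l i - E : ℝ) : ℂ) * b.repr v i := by
    rw [map_sub, map_smul, PiLp.sub_apply, PiLp.smul_apply, smul_eq_mul, hb,
      hT.eigenvectorBasis_apply_self_apply rfl v i]
    push_cast
    exact (sub_mul _ _ _).symm
  rw [e, norm_mul, mul_pow, Complex.norm_real, Real.norm_eq_abs]
  gcongr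
  exact hlarge i

end ApproximateEigenvectors

section PeriodicJacobi

open ComplexConjugate

theorem Function.Periodic.apply_zmod_val {α : Type*} {f : ℤ → α} {Q : ℕ} [NeZero Q]
    (hf : Function.Periodic f Q) (a : ℤ) : f ((a : ZMod Q).val : ℤ) = f a := by
  rw [ZMod.val_intCast]
  have h := hf.int_mul (a / Q) (a % Q)
  rw [← h]
  congr 1
  rw [Int.cast_id, mul_comm]
  exact Int.emod_add_mul_ediv a Q

theorem sum_zmod_val {Q : ℕ} [NeZero Q] (f : ℕ → ℝ) :
    ∑ j : ZMod Q, f j.val = ∑ k ∈ Finset.range Q, f k := by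
  refine Finset.sum_bij' (fun j _ => j.val) (fun k _ => (k : ZMod Q)) ?_ ?_ ?_ ?_ ?_
  · intro j _; exact Finset.mem_range.2 (ZMod.val_lt j)
  · intro k _; exact Finset.mem_univ _
  · intro j _; exact ZMod.natCast_zmod_val j
  · intro k hk; exact ZMod.val_cast_of_lt (Finset.mem_range.1 hk)
  · intro j _; rfl

/-- The Jacobi operator on a discrete circle. -/
def ringJacobi {Q : ℕ} (V : ZMod Q → ℝ) (c : ZMod Q → ℂ) :
    EuclideanSpace ℂ (ZMod Q) →ₗ[ℂ] EuclideanSpace ℂ (ZMod Q) where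
  toFun v := WithLp.toLp 2 fun j => V j * v j + c j * v (j + 1) + conj (c (j - 1)) * v (j - 1)
  map_add' v w := by
    ext j
    simp only [PiLp.add_apply]
    ring
  map_smul' z v := by
    ext j
    simp only [PiLp.smul_apply, smul_eq_mul, RingHom.id_apply]
    ring

theorem ringJacobi_apply {Q : ℕ} (V : ZMod Q → ℝ) (c : ZMod Q → ℂ)
    (v : EuclideanSpace ℂ (ZMod Q)) (j : ZMod Q) :
    ringJacobi V c v j = V j * v j + c j * v (j + 1) + conj (c (j - 1)) * v (j - 1) := rfl

theorem isSymmetric_ringJacobi {Q : ℕ} [NeZero Q] (V : ZMod Q → ℝ) (c : ZMod Q → ℂ) :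
    (ringJacobi V c).IsSymmetric := by
  intro x y
  simp only [PiLp.inner_apply, RCLike.inner_apply, ringJacobi_apply, map_add, map_mul,
    Complex.conj_conj, Complex.conj_ofReal, mul_add, add_mul, Finset.sum_add_distrib]
  have e1 := (Equiv.subRight (1 : ZMod Q)).sum_comp fun j => y (j + 1) * (c j * conj (x j))
  have e2 := (Equiv.subRight (1 : ZMod Q)).sum_comp fun j => conj (c j) * y j * conj (x (j + 1))
  simp only [Equiv.subRight_apply, sub_add_cancel] at e1 e2
  rw [e1]
  have h1 : ∀ j, y j * ((V j : ℂ) * conj (x j)) = V j * y j * conj (x j) := fun j => by ring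
  have h2 : ∑ j, y j * (conj (c j) * conj (x (j + 1))) =
      ∑ j, conj (c (j - 1)) * y (j - 1) * conj (x j) := by
    rw [e2]
    exact Finset.sum_congr rfl fun j _ => by ring
  have h3 : ∑ j, y (j + 1) * (c j * conj (x j)) = ∑ j, c j * y (j + 1) * conj (x j) :=
    Finset.sum_congr rfl fun j _ => by ring
  rw [h2, h3]
  simp only [h1]
  ring

theorem exists_periodic_eigenvector {Q m : ℕ} (hQ : m + 2 ≤ Q) {V : ℤ → ℝ} {c : ℤ → ℂ}
    (hV : Function.Periodic V Q) (hc : Function.Periodic c Q) {ψ : ℤ → ℂ}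
    (hψ : ∀ k, k < 1 ∨ (m : ℤ) < k → ψ k = 0) {E ε : ℝ} (hε : 0 < ε)
    (h : ∑ k ∈ Finset.range (m + 2), ‖jacobi V c ψ k - E * ψ k‖ ^ 2 <
      ε ^ 2 * ∑ k ∈ Finset.range (m + 2), ‖ψ k‖ ^ 2) :
    ∃ (E' : ℝ) (u : ℤ → ℂ), |E' - E| < ε ∧ (∃ k, u k ≠ 0) ∧ Function.Periodic u Q ∧
      ∀ k, jacobi V c u k = E' * u k := by
  have : NeZero Q := ⟨by omega⟩
  set T := ringJacobi (fun j : ZMod Q => V j.val) (fun j => c j.val) with hT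
  have hTk : ∀ (v : EuclideanSpace ℂ (ZMod Q)) (k : ℤ),
      T v k = jacobi V c (fun i : ℤ => v (i : ZMod Q)) k := by
    intro v k
    rw [hT, ringJacobi_apply, jacobi, hV.apply_zmod_val, hc.apply_zmod_val]
    have := hc.apply_zmod_val (k - 1)
    push_cast at this ⊢
    rw [this]
  set v : EuclideanSpace ℂ (ZMod Q) := WithLp.toLp 2 fun j => ψ j.val with hv
  have hvv : ∀ j : ZMod Q, v j = ψ j.val := fun j => rfl
  have hTv : ∀ j : ZMod Q, T v j = jacobi V c ψ j.val := by
    intro j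
    have hj := ZMod.val_lt j
    have e := hTk v (j.val : ℤ)
    rw [Int.cast_natCast, ZMod.natCast_zmod_val] at e
    rw [e, jacobi, jacobi, hvv, hvv, hvv, ZMod.val_intCast, ZMod.val_intCast, ZMod.val_intCast]
    have a0 : (j.val : ℤ) % Q = j.val := Int.emod_eq_of_lt (by omega) (by omega)
    have a1 : ψ (((j.val : ℤ) + 1) % Q) = ψ (j.val + 1) := by
      rcases eq_or_ne (j.val + 1) Q with hq | hq
      · have : (j.val : ℤ) + 1 = Q := by exact_mod_cast hq
        rw [this, Int.emod_self, hψ 0 (by omega), hψ Q (by omega)]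
      · rw [Int.emod_eq_of_lt (by omega) (by omega)]
    have a2 : ψ (((j.val : ℤ) - 1) % Q) = ψ (j.val - 1) := by
      rcases eq_or_ne j.val 0 with hq | hq
      · have : ((j.val : ℤ) - 1) % Q = Q - 1 := by
          rw [hq, ← Int.add_emod_right]
          exact Int.emod_eq_of_lt (by omega) (by omega)
        rw [this, hψ (Q - 1) (by omega), hψ _ (by omega)]
      · rw [Int.emod_eq_of_lt (by omega) (by omega)]
    rw [a0, a1, a2]
  have hsub : Finset.range (m + 2) ⊆ Finset.range Q := Finset.range_subset_range.2 hQ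
  have hnv : ‖v‖ ^ 2 = ∑ k ∈ Finset.range (m + 2), ‖ψ k‖ ^ 2 := by
    rw [EuclideanSpace.norm_sq_eq]
    simp only [hvv]
    rw [sum_zmod_val fun k : ℕ => ‖ψ k‖ ^ 2]
    refine (Finset.sum_subset hsub fun k _ hk => ?_).symm
    rw [Finset.mem_range] at hk
    rw [hψ k (by omega)]
    simp
  have hnT : ‖T v - (E : ℂ) • v‖ ^ 2 =
      ∑ k ∈ Finset.range (m + 2), ‖jacobi V c ψ k - E * ψ k‖ ^ 2 := by
    rw [EuclideanSpace.norm_sq_eq]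
    simp only [PiLp.sub_apply, PiLp.smul_apply, smul_eq_mul, hTv, hvv]
    rw [sum_zmod_val fun k : ℕ => ‖jacobi V c ψ k - E * ψ k‖ ^ 2]
    refine (Finset.sum_subset hsub fun k _ hk => ?_).symm
    rw [Finset.mem_range] at hk
    rw [jacobi, hψ k (by omega), hψ (k + 1) (by omega), hψ (k - 1) (by omega)]
    simp
  rw [← hnv, ← hnT] at h
  obtain ⟨E', u, hE', hu, hTu⟩ := (isSymmetric_ringJacobi _ _).exists_eigenvector_near hε h
  refine ⟨E', fun k => u (k : ZMod Q), hE', ?_, ?_, ?_⟩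
  · by_contra! h0
    apply hu
    ext j
    have := h0 j.val
    rwa [Int.cast_natCast, ZMod.natCast_zmod_val] at this
  · intro k
    simp
  · intro k
    rw [← hTk, hT, hTu]
    rfl

theorem mulIter_mulVec {B : ℂ → Matrix (Fin 2) (Fin 2) ℂ} {σ w : ℂ} {v : ℕ → Fin 2 → ℂ}
    {p : ℕ → ℂ} (h : ∀ n, (B (σ ^ n * w)).mulVec (v n) = p n • v (n + 1)) (n : ℕ) :
    (mulIter B σ n w).mulVec (v 0) = (∏ i ∈ Finset.range n, p i) • v n := by
  induction n with
  | zero => simp [mulIter]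
  | succ n ih =>
    rw [mulIter_succ_left, ← Matrix.mulVec_mulVec, ih, Matrix.mulVec_smul, h, smul_smul,
      Finset.prod_range_succ]

theorem trace_eq_of_mulVec_eq_smul {M : Matrix (Fin 2) (Fin 2) ℂ} {v : Fin 2 → ℂ} (hv : v ≠ 0)
    {p p' : ℂ} (hp : p ≠ 0) (h : M.mulVec v = p • v) (hdet : M.det = p * p') :
    M.trace = p + p' := by
  have h0 : (M - p • (1 : Matrix (Fin 2) (Fin 2) ℂ)).det = 0 := by
    rw [← Matrix.exists_mulVec_eq_zero_iff]
    exact ⟨v, hv, by rw [Matrix.sub_mulVec, h, Matrix.smul_mulVec, Matrix.one_mulVec, sub_self]⟩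
  rw [Matrix.det_fin_two] at h0 hdet
  simp only [Matrix.sub_apply, Matrix.smul_apply, Matrix.one_apply, smul_eq_mul] at h0
  rw [Matrix.trace_fin_two]
  refine mul_left_cancel₀ hp ?_
  simp at h0
  linear_combination hdet - h0

end PeriodicJacobi

section Bridge

open Polynomial
open scoped ComplexConjugate

theorem circleMap_zero_one (t : ℝ) : circleMap 0 1 t = Complex.exp (t * Complex.I) := by
  simp [circleMap]

theorem norm_circleMap_one (t : ℝ) : ‖circleMap 0 1 t‖ = 1 := by simp

theorem conj_circleMap_one (t : ℝ) : conj (circleMap 0 1 t) = (circleMap 0 1 t)⁻¹ := by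
  rw [Complex.inv_def, Complex.normSq_eq_norm_sq, norm_circleMap_one]
  simp

theorem harperC_ofReal (l1 l2 l3 β t : ℝ) :
    harperC l1 l2 l3 β (t : ℂ) =
      l3 * ((circleMap 0 1 (2 * π * t))⁻¹ * (circleMap 0 1 (π * β))⁻¹) + l2 +
        l1 * (circleMap 0 1 (2 * π * t) * circleMap 0 1 (π * β)) := by
  simp only [circleMap_zero_one, ← Complex.exp_neg, ← Complex.exp_add, harperC]
  congr 3 <;> congr 1 <;> push_cast <;> ring_nf

theorem harperCt_ofReal_sub (l1 l2 l3 β t : ℝ) :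
    harperCt l1 l2 l3 β ((t : ℂ) - β) =
      l3 * (circleMap 0 1 (2 * π * t) * (circleMap 0 1 (π * β))⁻¹) + l2 +
        l1 * ((circleMap 0 1 (2 * π * t))⁻¹ * circleMap 0 1 (π * β)) := by
  simp only [circleMap_zero_one, ← Complex.exp_neg, ← Complex.exp_add, harperCt]
  congr 3 <;> congr 1 <;> push_cast <;> ring_nf

theorem conj_harperC_ofReal (l1 l2 l3 β t : ℝ) :
    conj (harperC l1 l2 l3 β (t : ℂ)) = harperCt l1 l2 l3 β t := by
  simp only [harperC, harperCt, map_add, map_mul, Complex.conj_ofReal, ← Complex.exp_conj, map_neg,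
    Complex.conj_I, map_div₀, map_ofNat]
  congr 3 <;> congr 1 <;> ring_nf

theorem circleMap_pi_mul_sq (β : ℝ) :
    circleMap 0 1 (π * β) ^ 2 = circleMap 0 1 (2 * π * β) := by
  simp only [circleMap_zero_one, ← Complex.exp_nat_mul]
  congr 1
  push_cast
  ring

theorem circleMap_one_mul_harperC (l1 l2 l3 β E t : ℝ) :
    circleMap 0 1 (2 * π * t) * harperC l1 l2 l3 β (t : ℂ) =
      (harperPoly l1 l2 l3 (circleMap 0 1 (π * β)) E 1 0).eval (circleMap 0 1 (2 * π * t)) := by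
  have h : circleMap 0 1 (2 * π * t) ≠ 0 := circleMap_ne_center one_ne_zero
  rw [harperC_ofReal]
  simp [harperPoly, conj_circleMap_one]
  field_simp

theorem smul_harperA (l1 l2 l3 β E t : ℝ) :
    circleMap 0 1 (2 * π * t) • harperA l1 l2 l3 β E (t : ℂ) =
      matEval (harperPoly l1 l2 l3 (circleMap 0 1 (π * β)) E) (circleMap 0 1 (2 * π * t)) := by
  have h : circleMap 0 1 (2 * π * t) ≠ 0 := circleMap_ne_center one_ne_zero
  have hc : Complex.cos (2 * π * t) =
      (circleMap 0 1 (2 * π * t) + (circleMap 0 1 (2 * π * t))⁻¹) / 2 := by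
    simp only [circleMap_zero_one, ← Complex.exp_neg, Complex.cos]
    congr 3 <;> push_cast <;> ring
  ext i j
  rw [matEval_apply, Matrix.smul_apply, smul_eq_mul]
  fin_cases i <;> fin_cases j
  · simp [harperA, harperPoly, hc]
    field_simp
  · simp [harperA, harperPoly, harperCt_ofReal_sub, conj_circleMap_one]
    field_simp
  · exact circleMap_one_mul_harperC l1 l2 l3 β E t
  · simp [harperA, harperPoly]

/-- The diagonal of the extended Harper operator. -/
def harperV (β θ : ℝ) (k : ℤ) : ℝ := 2 * Real.cos (2 * π * (θ + β * k))

/-- The off-diagonal of the extended Harper operator. -/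
def harperOff (l1 l2 l3 β θ : ℝ) (k : ℤ) : ℂ := harperC l1 l2 l3 β ((θ + β * k : ℝ) : ℂ)

theorem harperA_mulVec_of_jacobi {l1 l2 l3 β θ E : ℝ} {u : ℤ → ℂ} {k : ℤ}
    (h : jacobi (harperV β θ) (harperOff l1 l2 l3 β θ) u k = E * u k) :
    (harperA l1 l2 l3 β E ((θ + β * k : ℝ) : ℂ)).mulVec ![u k, u (k - 1)] =
      harperOff l1 l2 l3 β θ k • ![u (k + 1), u k] := by
  have e : conj (harperOff l1 l2 l3 β θ (k - 1)) =
      harperCt l1 l2 l3 β (((θ + β * k : ℝ) : ℂ) - β) := by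
    rw [harperOff, conj_harperC_ofReal]
    congr 1
    push_cast
    ring
  rw [jacobi, e, harperV] at h
  ext i
  fin_cases i
  · simp only [harperA, Matrix.mulVec, dotProduct, Fin.sum_univ_two]
    simp
    push_cast at h ⊢
    linear_combination -h
  · simp [harperA, Matrix.mulVec, dotProduct, Fin.sum_univ_two, harperOff]

theorem circleMap_one_add_mul (θ x : ℝ) (k : ℤ) (n : ℕ) :
    circleMap 0 1 (2 * π * (θ + x * ((k + n : ℤ) : ℝ))) =
      (circleMap 0 1 (π * x) ^ 2) ^ n * circleMap 0 1 (2 * π * (θ + x * k)) := by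
  rw [circleMap_pi_mul_sq, ← circleMap_one_nat_mul, mul_comm (circleMap 0 1 _), ← circleMap_two_pi_mul_add]
  congr 2
  push_cast
  ring

theorem det_matEval_harperPoly (l1 l2 l3 : ℝ) (ρ E w : ℂ) :
    (matEval (harperPoly l1 l2 l3 ρ E) w).det =
      (harperPoly l1 l2 l3 ρ E 1 0).eval w * -(harperPoly l1 l2 l3 ρ E 0 1).eval w := by
  rw [Matrix.det_fin_two]
  simp only [matEval_apply]
  simp [harperPoly]
  ring

theorem prod_norm_eval_harperG_le {l1 l2 l3 : ℝ} (h1 : 0 ≤ l1) (h2 : 0 ≤ l2) (h3 : 0 ≤ l3)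
    (hpos : l1 ≠ 0 ∨ l2 ≠ 0 ∨ l3 ≠ 0) (h13 : l1 + l3 ≤ 1) (h2' : l2 ≤ 1) {σ : ℂ} {Q : ℕ}
    (hQ : 0 < Q) (hω : IsPrimitiveRoot σ Q) {u : ℂ} (hu : ‖u‖ = 1) :
    ∏ k ∈ Finset.range Q, ‖(harperG l1 l2 l3).eval (σ ^ k * u)‖ ≤ 4 * harperMu l1 l3 ^ Q := by
  have h := prod_norm_eval_rotation_le hQ hω (harperG_ne_zero hpos) one_pos hu
  have ha := avgLog_harperG_one_le h1 h2 h3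
    (by rcases hpos with h | h | h
        · exact Or.inl (h1.lt_of_ne' h)
        · exact Or.inr (Or.inl (h2.lt_of_ne' h))
        · exact Or.inr (Or.inr (h3.lt_of_ne' h))) h13 h2'
  refine h.trans (mul_le_mul ?_ ?_ (Real.exp_pos _).le (by norm_num))
  · calc (2 : ℝ) ^ (harperG l1 l2 l3).natDegree ≤ 2 ^ 2 :=
        pow_le_pow_right₀ (by norm_num) (natDegree_harperG_le l1 l2 l3)
      _ = 4 := by norm_num
  · rw [← Real.exp_log (harperMu_pos l1 l3), ← Real.exp_nat_mul]
    gcongr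

theorem trace_harperIter_le_of_periodic {l1 l2 l3 : ℝ} (h1 : 0 ≤ l1) (h2 : 0 ≤ l2) (h3 : 0 ≤ l3)
    (hpos : l1 ≠ 0 ∨ l2 ≠ 0 ∨ l3 ≠ 0) (h13 : l1 + l3 ≤ 1) (h2' : l2 ≤ 1) {x : ℚ} {θ E : ℝ}
    (hgen : ∀ k, harperOff l1 l2 l3 x θ k ≠ 0) {u : ℤ → ℂ} (hu : ∃ k, u k ≠ 0)
    (hper : Function.Periodic u x.den)
    (heig : ∀ k, jacobi (harperV x θ) (harperOff l1 l2 l3 x θ) u k = E * u k) :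
    ∃ w, ‖w‖ = 1 ∧ ‖(harperIter l1 l2 l3 (circleMap 0 1 (π * x)) E x.den w).trace‖ ≤
      8 * harperMu l1 l3 ^ x.den := by
  obtain ⟨k₀, hk₀⟩ := hu
  obtain ⟨ρ, hρ⟩ : ∃ ρ, ρ = circleMap 0 1 (π * (x : ℝ)) := ⟨_, rfl⟩
  have hρ1 : ‖ρ‖ = 1 := hρ ▸ norm_circleMap_one _
  have hω : IsPrimitiveRoot (ρ ^ 2) x.den := by
    rw [hρ, circleMap_pi_mul_sq]
    exact isPrimitiveRoot_circleMap x
  obtain ⟨w, hw⟩ : ∃ w, w = circleMap 0 1 (2 * π * (θ + x * k₀)) := ⟨_, rfl⟩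
  have hw1 : ‖w‖ = 1 := hw ▸ norm_circleMap_one _
  refine ⟨w, hw1, ?_⟩
  rw [← hρ]
  have hwn : ∀ n : ℕ, circleMap 0 1 (2 * π * (θ + x * ((k₀ + n : ℤ) : ℝ))) = (ρ ^ 2) ^ n * w := by
    intro n
    rw [hρ, hw, circleMap_one_add_mul]
  have hstep : ∀ n : ℕ, (matEval (harperPoly l1 l2 l3 ρ E) ((ρ ^ 2) ^ n * w)).mulVec
      ![u (k₀ + n), u (k₀ + n - 1)] =
      (harperPoly l1 l2 l3 ρ E 1 0).eval ((ρ ^ 2) ^ n * w) •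
        ![u (k₀ + (n + 1 : ℕ)), u (k₀ + (n + 1 : ℕ) - 1)] := by
    intro n
    have e := harperA_mulVec_of_jacobi (heig (k₀ + n))
    rw [← hwn, hρ, ← smul_harperA, ← circleMap_one_mul_harperC, Matrix.smul_mulVec, e, smul_smul,
      show k₀ + ((n + 1 : ℕ) : ℤ) - 1 = k₀ + n by push_cast; ring,
      show k₀ + ((n + 1 : ℕ) : ℤ) = k₀ + n + 1 by push_cast; ring, harperOff]
  have hne : ∀ n : ℕ, (harperPoly l1 l2 l3 ρ E 1 0).eval ((ρ ^ 2) ^ n * w) ≠ 0 := by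
    intro n
    rw [← hwn, hρ, ← circleMap_one_mul_harperC]
    exact mul_ne_zero (circleMap_ne_center one_ne_zero) (hgen (k₀ + n))
  have hvec := mulIter_mulVec hstep x.den
  have hend : ![u (k₀ + x.den), u (k₀ + x.den - 1)] = ![u (k₀ + (0 : ℕ)), u (k₀ + (0 : ℕ) - 1)] := by
    have e1 := hper k₀
    have e2 := hper (k₀ - 1)
    rw [e1, show k₀ + (x.den : ℤ) - 1 = k₀ - 1 + x.den by ring, e2]
    simp
  rw [hend] at hvec
  have hv0 : ![u (k₀ + (0 : ℕ)), u (k₀ + (0 : ℕ) - 1)] ≠ 0 := by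
    intro h
    apply hk₀
    have := congrFun h 0
    simpa using this
  have hdet : (mulIter (matEval (harperPoly l1 l2 l3 ρ E)) (ρ ^ 2) x.den w).det =
      (∏ n ∈ Finset.range x.den, (harperPoly l1 l2 l3 ρ E 1 0).eval ((ρ ^ 2) ^ n * w)) *
      ∏ n ∈ Finset.range x.den, -(harperPoly l1 l2 l3 ρ E 0 1).eval ((ρ ^ 2) ^ n * w) := by
    rw [det_mulIter, ← Finset.prod_mul_distrib]
    exact Finset.prod_congr rfl fun n _ => det_matEval_harperPoly _ _ _ _ _ _
  have htr := trace_eq_of_mulVec_eq_smul hv0 (Finset.prod_ne_zero_iff.2 fun n _ => hne n) hvec hdet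
  rw [harperIter, htr]
  have b1 := prod_norm_eval_harperG_le h1 h2 h3 hpos h13 h2' x.den_pos hω (u := ρ * w)
    (by rw [norm_mul, hρ1, hw1, one_mul])
  have b3 := prod_norm_eval_harperG_le h3 h2 h1 (by tauto) (by linarith) h2' x.den_pos hω
    (u := conj ρ * w) (by rw [norm_mul, RCLike.norm_conj, hρ1, hw1, one_mul])
  rw [harperMu_comm] at b3
  have e1 : ‖∏ n ∈ Finset.range x.den, (harperPoly l1 l2 l3 ρ E 1 0).eval ((ρ ^ 2) ^ n * w)‖ =
      ∏ k ∈ Finset.range x.den, ‖(harperG l1 l2 l3).eval ((ρ ^ 2) ^ k * (ρ * w))‖ := by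
    rw [norm_prod]
    refine Finset.prod_congr rfl fun n _ => ?_
    rw [norm_eval_harperPoly_one_zero hρ1]
    congr 2
    ring
  have e3 : ‖∏ n ∈ Finset.range x.den, -(harperPoly l1 l2 l3 ρ E 0 1).eval ((ρ ^ 2) ^ n * w)‖ =
      ∏ k ∈ Finset.range x.den, ‖(harperG l3 l2 l1).eval ((ρ ^ 2) ^ k * (conj ρ * w))‖ := by
    rw [norm_prod]
    refine Finset.prod_congr rfl fun n _ => ?_
    rw [norm_neg, norm_eval_harperPoly_zero_one hρ1]
    congr 2
    ring
  refine (norm_add_le _ _).trans ?_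
  rw [e1, e3]
  linarith

theorem periodic_harperV (x : ℚ) (θ : ℝ) : Function.Periodic (harperV x θ) (x.den : ℤ) := by
  intro k
  have e : (x : ℝ) * x.den = x.num := by exact_mod_cast x.mul_den_eq_num
  have := (Real.cos_periodic.int_mul x.num) (2 * π * (θ + x * k))
  rw [harperV, harperV, ← this]
  congr 2
  push_cast
  linear_combination (2 * π) * e

theorem periodic_harperOff (l1 l2 l3 : ℝ) (x : ℚ) (θ : ℝ) :
    Function.Periodic (harperOff l1 l2 l3 x θ) (x.den : ℤ) := by
  intro k
  have e : (x : ℝ) * x.den = x.num := by exact_mod_cast x.mul_den_eq_num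
  have h := ((periodic_circleMap 0 1).int_mul x.num) (2 * π * (θ + x * k))
  rw [harperOff, harperOff, harperC_ofReal, harperC_ofReal, ← h]
  have e2 : 2 * π * (θ + x * ((k + x.den : ℤ) : ℝ)) = 2 * π * (θ + x * k) + x.num * (2 * π) := by
    push_cast
    linear_combination (2 * π) * e
  rw [e2]

theorem ae_harperOff_ne_zero {l1 l2 l3 : ℝ} (hpos : l1 ≠ 0 ∨ l2 ≠ 0 ∨ l3 ≠ 0) (β : ℝ) :
    ∀ᵐ θ : ℝ, ∀ k, harperOff l1 l2 l3 β θ k ≠ 0 := by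
  refine ae_all_iff.2 fun k => ?_
  obtain ⟨b, hb⟩ : ∃ b, b = circleMap 0 1 (π * β) * circleMap 0 1 (2 * π * (β * k)) := ⟨_, rfl⟩
  have hb0 : b ≠ 0 :=
    hb ▸ mul_ne_zero (circleMap_ne_center one_ne_zero) (circleMap_ne_center one_ne_zero)
  have hS : {w : ℂ | (harperG l1 l2 l3).eval (b * w) = 0}.Countable := by
    have hf : {z : ℂ | (harperG l1 l2 l3).eval z = 0}.Countable :=
      (finite_setOfPred_isRoot (harperG_ne_zero hpos)).countable
    exact hf.preimage (mul_right_injective₀ hb0)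
  have h := ae_circleMap_notMem hS one_ne_zero Set.univ
  rw [Measure.restrict_univ] at h
  filter_upwards [h] with θ hθ h0
  apply hθ
  have e := circleMap_one_mul_harperC l1 l2 l3 β 0 (θ + β * k)
  rw [← harperOff, h0, mul_zero] at e
  have e' := norm_eval_harperPoly_one_zero (l1 := l1) (l2 := l2) (l3 := l3)
    (norm_circleMap_one (π * β)) (0 : ℝ) (circleMap 0 1 (2 * π * (θ + β * k)))
  rw [← e, norm_zero, eq_comm, norm_eq_zero, circleMap_two_pi_mul_add] at e'
  refine Eq.trans ?_ e'
  rw [hb]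
  congr 1
  ring

theorem continuous_sum_jacobi_harper (l1 l2 l3 E : ℝ) (ψ : ℤ → ℂ) (m : ℕ) :
    Continuous fun p : ℝ × ℝ => ∑ k ∈ Finset.range m,
      ‖jacobi (harperV p.1 p.2) (harperOff l1 l2 l3 p.1 p.2) ψ k - E * ψ k‖ ^ 2 := by
  unfold jacobi harperV harperOff harperC
  fun_prop

theorem sum_Icc_eq_sum_range_sub (f : ℤ → ℝ) (n : ℕ) :
    ∑ k ∈ Finset.Icc (-(n + 1 : ℤ)) (n + 1), f k =
      ∑ k ∈ Finset.range (2 * n + 1 + 2), f ((k : ℤ) - (n + 1)) := by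
  symm
  refine Finset.sum_bij (fun k _ => (k : ℤ) - (n + 1)) ?_ ?_ ?_ fun _ _ => rfl
  · intro k hk
    rw [Finset.mem_range] at hk
    rw [Finset.mem_Icc]
    omega
  · intro a _ b _ h
    simpa using h
  · intro b hb
    rw [Finset.mem_Icc] at hb
    exact ⟨(b + (n + 1)).toNat, by rw [Finset.mem_range]; omega, by omega⟩

theorem jacobi_harper_sub (l1 l2 l3 β θ : ℝ) (ψ : ℤ → ℂ) (n k : ℤ) :
    jacobi (harperV β (θ - β * n)) (harperOff l1 l2 l3 β (θ - β * n)) (fun j => ψ (j - n)) k =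
      jacobi (harperV β θ) (harperOff l1 l2 l3 β θ) ψ (k - n) := by
  have a1 : ∀ j : ℤ, harperV β (θ - β * n) j = harperV β θ (j - n) := by
    intro j
    rw [harperV, harperV]
    push_cast
    ring_nf
  have a2 : ∀ j : ℤ, harperOff l1 l2 l3 β (θ - β * n) j = harperOff l1 l2 l3 β θ (j - n) := by
    intro j
    rw [harperOff, harperOff]
    congr 1
    push_cast
    ring_nf
  rw [jacobi, jacobi, a1, a2, a2, show k + 1 - n = k - n + 1 by ring,
    show k - 1 - n = k - n - 1 by ring]

theorem exists_periodic_harper_eigenvector {l1 l2 l3 β θ E ε : ℝ}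
    (hpos : l1 ≠ 0 ∨ l2 ≠ 0 ∨ l3 ≠ 0) (hε : 0 < ε) {m : ℕ} {ψ : ℤ → ℂ}
    (hψ : ∀ k, k < 1 ∨ (m : ℤ) < k → ψ k = 0)
    (h : ∑ k ∈ Finset.range (m + 2),
      ‖jacobi (harperV β θ) (harperOff l1 l2 l3 β θ) ψ k - E * ψ k‖ ^ 2 <
      ε ^ 2 * ∑ k ∈ Finset.range (m + 2), ‖ψ k‖ ^ 2) :
    ∃ δ > 0, ∀ x : ℚ, |(x : ℝ) - β| < δ → m + 2 ≤ x.den → ∃ (E' θ' : ℝ) (u : ℤ → ℂ),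
      |E' - E| < ε ∧ (∀ k, harperOff l1 l2 l3 x θ' k ≠ 0) ∧ (∃ k, u k ≠ 0) ∧
      Function.Periodic u x.den ∧
      ∀ k, jacobi (harperV x θ') (harperOff l1 l2 l3 x θ') u k = E' * u k := by
  obtain ⟨b, hb⟩ : ∃ b, b = ε ^ 2 * ∑ k ∈ Finset.range (m + 2), ‖ψ k‖ ^ 2 := ⟨_, rfl⟩
  rw [← hb] at h
  have hev := (continuous_sum_jacobi_harper l1 l2 l3 E ψ (m + 2)).continuousAt.eventually_lt
    (continuousAt_const (x := (β, θ)) (y := b)) h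
  obtain ⟨δ, hδ, hball⟩ := Metric.eventually_nhds_iff.1 hev
  refine ⟨δ, hδ, fun x hx hden => ?_⟩
  obtain ⟨θ', hgen, hθ'⟩ :=
    (Measure.dense_of_ae (ae_harperOff_ne_zero hpos (x : ℝ))).exists_mem_open
      (Metric.isOpen_ball (x := θ) (ε := δ)) ⟨_, Metric.mem_ball_self hδ⟩
  have hmem : dist ((x : ℝ), θ') (β, θ) < δ := by
    rw [Prod.dist_eq, max_lt_iff]
    exact ⟨by rwa [Real.dist_eq], hθ'⟩
  have hlt := hball hmem
  rw [hb] at hlt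
  obtain ⟨E', u, hE', hu, hper, heig⟩ := exists_periodic_eigenvector hden (periodic_harperV x θ')
    (periodic_harperOff l1 l2 l3 x θ') hψ hε hlt
  exact ⟨E', θ', u, hE', hgen, hu, hper, heig⟩

/-- Rational approximants of the frequency have energies near `E` at which the trace of the
monodromy matrix is small. -/
theorem exists_rational_approximant {l1 l2 l3 β θ E : ℝ} (h1 : 0 ≤ l1) (h2 : 0 ≤ l2) (h3 : 0 ≤ l3)
    (hpos : l1 ≠ 0 ∨ l2 ≠ 0 ∨ l3 ≠ 0) (h13 : l1 + l3 ≤ 1) (h2' : l2 ≤ 1)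
    {H : lp (fun _ : ℤ => ℂ) 2 →L[ℂ] lp (fun _ : ℤ => ℂ) 2}
    (hH : ∀ ψ k, H ψ k = jacobi (harperV β θ) (harperOff l1 l2 l3 β θ) ψ k)
    (hE : (E : ℂ) ∈ spectrum ℂ H) {ε : ℝ} (hε : 0 < ε) :
    ∃ δ > 0, ∃ M : ℕ, ∀ x : ℚ, |(x : ℝ) - β| < δ → M ≤ x.den → ∃ E' : ℝ, |E' - E| < ε ∧
      ∃ w, ‖w‖ = 1 ∧ ‖(harperIter l1 l2 l3 (circleMap 0 1 (π * x)) E' x.den w).trace‖ ≤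
        8 * harperMu l1 l3 ^ x.den := by
  obtain ⟨n, ψ, hψ, hlt⟩ := exists_finite_approximate_eigenvector hH hE hε
  rw [sum_Icc_eq_sum_range_sub (fun k => ‖jacobi _ _ ψ k - E * ψ k‖ ^ 2),
    sum_Icc_eq_sum_range_sub (fun k => ‖ψ k‖ ^ 2)] at hlt
  have hsub := fun k => jacobi_harper_sub l1 l2 l3 β θ ψ (n + 1) k
  simp only [← hsub] at hlt
  obtain ⟨δ, hδ, h⟩ := exists_periodic_harper_eigenvector (ψ := fun j => ψ (j - (n + 1)))
    (m := 2 * n + 1) hpos hε (fun k hk => hψ _ (by push_cast at hk; omega)) hlt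
  refine ⟨δ, hδ, 2 * n + 1 + 2, fun x hx hden => ?_⟩
  obtain ⟨E', θ', u, hE', hgen, hu, hper, heig⟩ := h x hx hden
  exact ⟨E', hE', trace_harperIter_le_of_periodic h1 h2 h3 hpos h13 h2' hgen hu hper heig⟩

end Bridge

section PositiveExponent

open Polynomial Topology
open scoped ComplexConjugate

theorem continuous_harperIter_apply {X : Type*} [TopologicalSpace X] (l1 l2 l3 : ℝ) {ρ E w : X → ℂ}
    (hρ : Continuous ρ) (hE : Continuous E) (hw : Continuous w) (n : ℕ) (i j : Fin 2) :
    Continuous fun p => harperIter l1 l2 l3 (ρ p) (E p) n (w p) i j := by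
  induction n generalizing w i j with
  | zero =>
    simp only [harperIter, mulIter]
    exact continuous_const
  | succ n ih =>
    have e : ∀ p, harperIter l1 l2 l3 (ρ p) (E p) (n + 1) (w p) =
        harperIter l1 l2 l3 (ρ p) (E p) n ((ρ p) ^ 2 * w p) *
          matEval (harperPoly l1 l2 l3 (ρ p) (E p)) (w p) := fun p => rfl
    have hB : ∀ i j, Continuous fun p => matEval (harperPoly l1 l2 l3 (ρ p) (E p)) (w p) i j := by
      intro i j
      simp only [matEval_apply]
      fin_cases i <;> fin_cases j <;> simp [harperPoly] <;> fun_prop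
    have hw' : Continuous fun p => (ρ p) ^ 2 * w p := by fun_prop
    simp only [e, Matrix.mul_apply, Fin.sum_univ_two]
    exact ((ih hw' i 0).mul (hB 0 j)).add ((ih hw' i 1).mul (hB 1 j))

theorem continuous_norm_harperIter {X : Type*} [TopologicalSpace X] (l1 l2 l3 : ℝ) {ρ E w : X → ℂ}
    (hρ : Continuous ρ) (hE : Continuous E) (hw : Continuous w) (n : ℕ) :
    Continuous fun p => ‖harperIter l1 l2 l3 (ρ p) (E p) n (w p)‖ := by
  have h := continuous_harperIter_apply l1 l2 l3 hρ hE hw n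
  have h00 := h 0 0
  have h01 := h 0 1
  have h10 := h 1 0
  have h11 := h 1 1
  simp only [frobenius_norm_eq_sqrt]
  fun_prop

theorem continuous_norm_det_harperIter {X : Type*} [TopologicalSpace X] (l1 l2 l3 : ℝ)
    {ρ E w : X → ℂ} (hρ : Continuous ρ) (hE : Continuous E) (hw : Continuous w) (n : ℕ) :
    Continuous fun p => ‖(harperIter l1 l2 l3 (ρ p) (E p) n (w p)).det‖ := by
  have h := continuous_harperIter_apply l1 l2 l3 hρ hE hw n
  have h00 := h 0 0
  have h01 := h 0 1
  have h10 := h 1 0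
  have h11 := h 1 1
  simp only [Matrix.det_fin_two]
  fun_prop

theorem natDegree_combo_le {P : Matrix (Fin 2) (Fin 2) ℂ[X]} {N : ℕ}
    (hP : ∀ i j, (P i j).natDegree ≤ N) (t : ℂ) : (combo P t).natDegree ≤ N := by
  unfold combo
  refine (natDegree_add_le_of_degree_le (natDegree_add_le_of_degree_le
    (natDegree_add_le_of_degree_le (hP 0 0) ?_) ?_) ?_) <;>
  exact (natDegree_C_mul_le _ _).trans (hP _ _)

/-- The exponent of the transfer cocycle on the circle of radius `r`. -/
def harperLyap (l1 l2 l3 β E r : ℝ) : ℝ :=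
  radialLyap (harperPoly l1 l2 l3 (circleMap 0 1 (π * β)) E) (circleMap 0 1 (π * β) ^ 2) r

theorem exists_harperIter_paving {l1 l2 l3 β E : ℝ} (hβ : Irrational β) (h1 : 0 ≤ l1) (h3 : 0 ≤ l3)
    (h : 4 * l1 * l3 ≤ 1) {R : Finset ℝ} (hR : ∀ r ∈ R, 1 / 2 ≤ r ∧ r ≤ 2) {η : ℝ} (hη : 0 < η)
    (hη4 : η ≤ 1 / 4) (hsep : ∀ r ∈ R, ∀ r' ∈ R, r ≠ r' → 2 * η ≤ |r - r'|) {δ : ℝ} (hδ : 0 < δ)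
    (hJ : 1024 ≤ δ * R.card) (hJ' : 32 ≤ R.card) (M : ℕ) :
    ∃ q, M < q ∧ ∃ r ∈ R, ∀ v : ℂ, ‖v‖ = r → ∃ k, q ≤ k ∧ k < 2 * q ∧
      Real.exp (4 * q * (harperLyap l1 l2 l3 β E r - δ)) <
        ‖harperIter l1 l2 l3 (circleMap 0 1 (π * β)) E (4 * q)
          ((conj (circleMap 0 1 (π * β)) ^ 2) ^ k * v)‖ := by
  obtain ⟨M', hM'⟩ := exists_nat_ge
    (max (1000 / (δ * η)) (max (28 / η) ((R.card * Real.log 12 + Real.log 2) / δ)))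
  obtain ⟨x, hxM, hx⟩ := exists_rat_approx hβ (max M M')
  have hxM1 : M < x.den := lt_of_le_of_lt (le_max_left _ _) hxM
  have hxM2 : (M' : ℝ) < x.den := by exact_mod_cast lt_of_le_of_lt (le_max_right _ _) hxM
  have hq0 : (0 : ℝ) < x.den := by exact_mod_cast x.den_pos
  have hb1 : 1000 / (δ * η) ≤ x.den := (le_max_left _ _).trans (hM'.trans hxM2.le)
  have hb2 : 28 / η ≤ x.den :=
    (le_max_left _ _).trans ((le_max_right _ _).trans (hM'.trans hxM2.le))
  have hb3 : (R.card * Real.log 12 + Real.log 2) / δ ≤ x.den :=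
    (le_max_right _ _).trans ((le_max_right _ _).trans (hM'.trans hxM2.le))
  rw [div_le_iff₀ (by positivity)] at hb1 hb2 hb3
  obtain ⟨ρ, hρ⟩ : ∃ ρ, ρ = circleMap 0 1 (π * β) := ⟨_, rfl⟩
  have hρ1 : ‖ρ‖ = 1 := hρ ▸ norm_circleMap_one _
  have hlow : ∀ r : ℝ, 0 < r → ∀ n : ℕ, n * Real.log (harperMu l1 l3) ≤
      avgLogMat (polyIter (harperPoly l1 l2 l3 ρ E) (ρ ^ 2) n) r :=
    fun r hr n => mul_log_harperMu_le hρ1 E h1 h3 h hr n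
  obtain ⟨P, hP⟩ : ∃ P, P = polyIter (harperPoly l1 l2 l3 ρ E) (ρ ^ 2) (4 * x.den) := ⟨_, rfl⟩
  have hP0 : P 0 0 ≠ 0 := hP ▸ polyIter_harper_ne_zero hρ1 E h1 h3 h _
  obtain ⟨t, ht, hF, hFR⟩ := exists_combo_avgLog_ge hP0 R fun r hr => by
    have := (hR r hr).1
    intro h0
    linarith
  have hdeg : (combo P t).natDegree ≤ 8 * (-x).den := by
    refine (natDegree_combo_le (N := 2 * (4 * x.den)) (fun i j => ?_) t).trans ?_
    · rw [hP]
      exact natDegree_polyIter_le (natDegree_harperPoly_le l1 l2 l3 ρ E) _ _ i j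
    · rw [Rat.den_neg_eq_den]
      omega
  have hx' : |-β - ((-x : ℚ) : ℝ)| < 1 / ((-x).den : ℝ) ^ 2 := by
    rw [Rat.den_neg_eq_den, Rat.cast_neg, ← neg_sub', abs_neg]
    exact hx
  obtain ⟨r, hr, hpave⟩ := exists_paving_radius hx' hR hη hη4 hsep hδ hJ hJ'
    (by rw [Rat.den_neg_eq_den]; linarith) (by rw [Rat.den_neg_eq_den]; linarith) hF hdeg
  rw [Rat.den_neg_eq_den] at hpave
  have hr0 : 0 < r := by linarith [(hR r hr).1]
  refine ⟨x.den, hxM1, r, hr, fun v hv => ?_⟩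
  have hτ : circleMap 0 1 (2 * π * -β) = conj ρ ^ 2 := by
    rw [hρ, conj_circleMap_one, inv_pow, circleMap_pi_mul_sq, circleMap_zero_one,
      circleMap_zero_one, ← Complex.exp_neg]
    congr 1
    push_cast
    ring
  have hcn : ‖conj ρ ^ 2‖ = 1 := by rw [norm_pow, RCLike.norm_conj, hρ1, one_pow]
  obtain ⟨i, hi, hne, hge⟩ := hpave ((conj ρ ^ 2) ^ x.den * v) (by
    rw [norm_mul, norm_pow, hcn, one_pow, one_mul, hv])
  rw [hτ, ← mul_assoc, ← pow_add] at hne hge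
  refine ⟨i + x.den, by omega, by omega, ?_⟩
  rw [← hρ]
  have hle : ‖(combo P t).eval ((conj ρ ^ 2) ^ (i + x.den) * v)‖ ≤
      2 * ‖harperIter l1 l2 l3 ρ E (4 * x.den) ((conj ρ ^ 2) ^ (i + x.den) * v)‖ := by
    rw [eval_combo, hP, matEval_polyIter]
    exact norm_eval_comboPoly_le _ ht
  have hpos : 0 < ‖harperIter l1 l2 l3 ρ E (4 * x.den) ((conj ρ ^ 2) ^ (i + x.den) * v)‖ := by
    have := norm_pos_iff.2 hne
    linarith
  have hL := mul_radialLyap_le (hlow r hr0) (n := 4 * x.den) (by have := x.den_pos; omega)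
  rw [← hP] at hL
  have hlog := Real.log_le_log (norm_pos_iff.2 hne) hle
  rw [Real.log_mul two_ne_zero hpos.ne'] at hlog
  rw [← Real.lt_log_iff_exp_lt hpos, harperLyap, ← hρ]
  have := hFR r hr
  push_cast at hL
  have := mul_pos hδ hq0
  nlinarith

end PositiveExponent

section Contradiction

open Polynomial Topology
open scoped ComplexConjugate

theorem eventually_norm_harperIter_le {l1 l2 l3 β E : ℝ} (hβ : Irrational β)
    {r : ℝ} (hr : 0 < r)
    (hr1 : ∀ a ∈ (harperG l1 l2 l3).roots, ‖a‖ ≠ r)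
    (hr3 : ∀ a ∈ (harperG l3 l2 l1).roots, ‖a‖ ≠ r) (hpos : l1 ≠ 0 ∨ l2 ≠ 0 ∨ l3 ≠ 0)
    {a : ℝ} (ha : 0 < a) :
    ∀ᶠ n : ℕ in atTop, ∀ w, ‖w‖ = r →
      ‖harperIter l1 l2 l3 (circleMap 0 1 (π * β)) E n w‖ ≤
        Real.exp (n * (harperLyap l1 l2 l3 β E r + a)) ∧
      ‖(harperIter l1 l2 l3 (circleMap 0 1 (π * β)) E n w).det‖ ≤
        Real.exp (n * (avgLog (harperG l1 l2 l3) r + avgLog (harperG l3 l2 l1) r + a)) := by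
  obtain ⟨ρ, hρ⟩ : ∃ ρ, ρ = circleMap 0 1 (π * β) := ⟨_, rfl⟩
  have hρ1 : ‖ρ‖ = 1 := hρ ▸ norm_circleMap_one _
  have hσ : circleMap 0 1 (2 * π * β) = ρ ^ 2 := by rw [hρ, circleMap_pi_mul_sq]
  have hG1 := harperG_ne_zero hpos
  have hG3 : harperG l3 l2 l1 ≠ 0 := harperG_ne_zero (by tauto)
  have hev : ∀ w : ℂ, ‖w‖ = r → (harperG l1 l2 l3).eval w ≠ 0 ∧ (harperG l3 l2 l1).eval w ≠ 0 :=
    fun w hw => ⟨fun h0 => hr1 w ((mem_roots hG1).2 h0) hw, fun h0 => hr3 w ((mem_roots hG3).2 h0) hw⟩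
  have hdet0 : ∀ (n : ℕ) (w : ℂ), ‖w‖ = r → 0 < ‖(harperIter l1 l2 l3 ρ E n w).det‖ := by
    intro n w hw
    rw [norm_det_harperIter hρ1]
    refine mul_pos (Finset.prod_pos fun k _ => norm_pos_iff.2 (hev _ ?_).1)
      (Finset.prod_pos fun k _ => norm_pos_iff.2 (hev _ ?_).2) <;>
    simp [hρ1, hw]
  have hnorm0 : ∀ (n : ℕ) (w : ℂ), ‖w‖ = r → 0 < ‖harperIter l1 l2 l3 ρ E n w‖ := by
    intro n w hw
    have h := hdet0 n w hw
    have h' := norm_det_le_frobenius_norm_sq (harperIter l1 l2 l3 ρ E n w)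
    have : 0 ≤ ‖harperIter l1 l2 l3 ρ E n w‖ := norm_nonneg _
    nlinarith
  obtain ⟨m, hm, hlt⟩ := exists_avgLogMat_lt (harperPoly l1 l2 l3 ρ E) (ρ ^ 2) r ha
  have hU := eventually_le_exp_of_submultiplicative hβ hr
    (fun n w => ‖harperIter l1 l2 l3 ρ E n w‖) hnorm0
    (fun n => continuous_norm_harperIter l1 l2 l3 continuous_const continuous_const continuous_id n)
    (fun n k w _ => by rw [hσ]; exact norm_mulIter_add_le _ _ n k w) hm
    (l := harperLyap l1 l2 l3 β E r + a) (by
      rw [harperLyap, ← hρ]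
      refine lt_of_le_of_lt (le_of_eq ?_) hlt
      simp only [avgLogMat, matEval_polyIter, harperIter])
  have hD := eventually_le_exp_of_submultiplicative hβ hr
    (fun n w => ‖(harperIter l1 l2 l3 ρ E n w).det‖) hdet0
    (fun n =>
      continuous_norm_det_harperIter l1 l2 l3 continuous_const continuous_const continuous_id n)
    (fun n k w _ => by rw [hσ, harperIter, mulIter_add, Matrix.det_mul, norm_mul]; rfl) one_pos
    (l := avgLog (harperG l1 l2 l3) r + avgLog (harperG l3 l2 l1) r + a) (by
      have e1 := circleAverage_rotate (fun w => Real.log ‖(harperG l1 l2 l3).eval w‖) hρ1 r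
      have e3 := circleAverage_rotate (fun w => Real.log ‖(harperG l3 l2 l1).eval w‖)
        (σ := conj ρ) (by rw [RCLike.norm_conj, hρ1]) r
      have i1 := circleIntegrable_log_norm_eval ((harperG l1 l2 l3).comp (C ρ * X)) 0 r
      have i3 := circleIntegrable_log_norm_eval ((harperG l3 l2 l1).comp (C (conj ρ) * X)) 0 r
      simp only [eval_comp, eval_mul, eval_C, eval_X] at i1 i3
      have key : Real.circleAverage (fun w => Real.log ‖(harperIter l1 l2 l3 ρ E 1 w).det‖) 0 r =
          avgLog (harperG l1 l2 l3) r + avgLog (harperG l3 l2 l1) r := by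
        rw [avgLog, avgLog, ← e1, ← e3, ← Real.circleAverage_fun_add i1 i3]
        refine Real.circleAverage_congr_sphere fun w hw => ?_
        rw [abs_of_pos hr, mem_sphere_zero_iff_norm] at hw
        have hn := hev (ρ * w) (by rw [norm_mul, hρ1, one_mul, hw])
        have hn' := hev (conj ρ * w) (by rw [norm_mul, RCLike.norm_conj, hρ1, one_mul, hw])
        rw [norm_det_harperIter hρ1, Finset.prod_range_one, Finset.prod_range_one, pow_zero, one_mul,
          one_mul, Real.log_mul (norm_ne_zero_iff.2 hn.1) (norm_ne_zero_iff.2 hn'.2)]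
      rw [key]
      push_cast
      linarith)
  filter_upwards [hU, hD] with n h1 h2 w hw
  rw [← hρ]
  exact ⟨h1 w hw, h2 w hw⟩

theorem exists_radii {Λ : ℝ → ℝ} {b κ : ℝ} (hκ : 0 < κ) (h1 : b + κ ≤ Λ 1)
    (hΛ : ∀ r : ℝ, 0 < r → 2 * Λ 1 ≤ Λ r + Λ r⁻¹) {S : Set ℝ} (hS : S.Finite) (J : ℕ) :
    ∃ R : Finset ℝ, R.card = J ∧ ∀ r ∈ R, (1 / 2 ≤ r ∧ r ≤ 2) ∧ r ∉ S ∧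
      b + 2 * Real.posLog r + κ / 2 ≤ Λ r := by
  obtain ⟨W, hW⟩ : ∃ W : Set ℝ, W = {r | (1 / 2 ≤ r ∧ r ≤ 2) ∧ r ∉ S ∧
    b + 2 * Real.posLog r + κ / 2 ≤ Λ r} := ⟨_, rfl⟩
  have hinf : W.Infinite := by
    intro hfin
    have hT : (W ∪ S ∪ (fun r : ℝ => r⁻¹) '' (W ∪ S)).Finite :=
      (hfin.union hS).union ((hfin.union hS).image _)
    have hI : (Set.Ioo (1 : ℝ) (min 2 (Real.exp (κ / 4)))).Infinite :=
      Set.Ioo_infinite (lt_min (by norm_num) (Real.one_lt_exp_iff.2 (by linarith)))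
    apply hI
    refine hT.subset fun t ht => ?_
    obtain ⟨ht1, ht2⟩ := ht
    have ht3 := ht2.trans_le (min_le_left _ _)
    have ht4 := ht2.trans_le (min_le_right _ _)
    have ht0 : 0 < t := by linarith
    have hlog : Real.log t < κ / 4 := (Real.log_lt_iff_lt_exp ht0).2 ht4
    have hp1 : Real.posLog t = Real.log t := by
      rw [Real.posLog_eq_log_max_one ht0.le, max_eq_right ht1.le]
    have hp2 : Real.posLog t⁻¹ = 0 := by
      rw [Real.posLog_eq_log_max_one (inv_pos.2 ht0).le, max_eq_left (inv_le_one_of_one_le₀ ht1.le),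
        Real.log_one]
    have hinv1 : t⁻¹ ≤ 1 := inv_le_one_of_one_le₀ ht1.le
    have hinv2 : 1 / 2 ≤ t⁻¹ := by
      rw [one_div]
      exact inv_anti₀ ht0 ht3.le
    by_cases hs : t ∈ S
    · exact Or.inl (Or.inr hs)
    by_cases hs' : t⁻¹ ∈ S
    · exact Or.inr ⟨t⁻¹, Or.inr hs', inv_inv t⟩
    have hc := hΛ t ht0
    rcases le_total (Λ 1) (Λ t) with hle | hle
    · refine Or.inl (Or.inl ?_)
      rw [hW]
      exact ⟨⟨by linarith, ht3.le⟩, hs, by rw [hp1]; linarith⟩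
    · refine Or.inr ⟨t⁻¹, Or.inl ?_, inv_inv t⟩
      rw [hW]
      exact ⟨⟨hinv2, by linarith⟩, hs', by rw [hp2]; linarith⟩
  obtain ⟨R, hR, hcard⟩ := hinf.exists_subset_card_eq J
  refine ⟨R, hcard, fun r hr => ?_⟩
  have := hR hr
  rwa [hW] at this

theorem Finset.exists_pos_separation (R : Finset ℝ) :
    ∃ η : ℝ, 0 < η ∧ η ≤ 1 / 4 ∧ ∀ r ∈ R, ∀ r' ∈ R, r ≠ r' → 2 * η ≤ |r - r'| := by
  have h : ∀ᶠ η : ℝ in 𝓝[>] 0, ∀ p ∈ R ×ˢ R, p.1 ≠ p.2 → 2 * η ≤ |p.1 - p.2| := by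
    rw [Filter.eventually_all_finset]
    intro p _
    by_cases hp : p.1 = p.2
    · simp [hp]
    have h0 : 0 < |p.1 - p.2| := abs_pos.2 (sub_ne_zero.2 hp)
    filter_upwards [Ioo_mem_nhdsGT (show 0 < |p.1 - p.2| / 2 by linarith)] with η hη _
    linarith [hη.2]
  obtain ⟨η, h, h0, h4⟩ := (h.and (Ioo_mem_nhdsGT (show (0 : ℝ) < 1 / 4 by norm_num))).exists
  exact ⟨η, h0, h4.le, fun r hr r' hr' hne => h (r, r') (Finset.mem_product.2 ⟨hr, hr'⟩) hne⟩

theorem eventually_forall_norm_eq_lt {f : (ℝ × ℝ) × ℂ → ℝ} (hf : Continuous f) {p : ℝ × ℝ}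
    {r b : ℝ} (h : ∀ v : ℂ, ‖v‖ = r → f (p, v) < b) :
    ∀ᶠ p' in 𝓝 p, ∀ v : ℂ, ‖v‖ = r → f (p', v) < b := by
  have := (isCompact_sphere (0 : ℂ) r).eventually_forall_of_forall_eventually (x₀ := p)
    (P := fun p' v => f (p', v) < b) fun v hv =>
      hf.continuousAt.eventually_lt continuousAt_const (h v (mem_sphere_zero_iff_norm.1 hv))
  filter_upwards [this] with p' hp' v hv
  exact hp' v (mem_sphere_zero_iff_norm.2 hv)

theorem eventually_harperIter_bounds {l1 l2 l3 β E r L d a : ℝ} {q : ℕ}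
    (hpave : ∀ v : ℂ, ‖v‖ = r → ∃ k, q ≤ k ∧ k < 2 * q ∧ Real.exp (4 * q * (L - a)) <
      ‖harperIter l1 l2 l3 (circleMap 0 1 (π * β)) E (4 * q)
          ((conj (circleMap 0 1 (π * β)) ^ 2) ^ k * v)‖)
    (hup : ∀ n, q ≤ n → ∀ v : ℂ, ‖v‖ = r →
      ‖harperIter l1 l2 l3 (circleMap 0 1 (π * β)) E n v‖ < Real.exp (n * (L + a)) ∧
      ‖(harperIter l1 l2 l3 (circleMap 0 1 (π * β)) E n v).det‖ < Real.exp (n * (d + a))) :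
    ∀ᶠ p : ℝ × ℝ in 𝓝 (β, E),
      (∀ v : ℂ, ‖v‖ = r → ∃ k, q ≤ k ∧ k < 2 * q ∧ Real.exp (4 * q * (L - a)) <
        ‖harperIter l1 l2 l3 (circleMap 0 1 (π * p.1)) p.2 (4 * q)
          ((conj (circleMap 0 1 (π * p.1)) ^ 2) ^ k * v)‖) ∧
      ∀ n, q ≤ n → n ≤ 3 * q → ∀ v : ℂ, ‖v‖ = r →
        ‖harperIter l1 l2 l3 (circleMap 0 1 (π * p.1)) p.2 n v‖ < Real.exp (n * (L + a)) ∧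
        ‖(harperIter l1 l2 l3 (circleMap 0 1 (π * p.1)) p.2 n v).det‖ <
          Real.exp (n * (d + a)) := by
  have hcirc : Continuous fun z : (ℝ × ℝ) × ℂ => circleMap 0 1 (π * z.1.1) :=
    (continuous_circleMap 0 1).comp (by fun_prop)
  have hen : Continuous fun z : (ℝ × ℝ) × ℂ => (z.1.2 : ℂ) := by fun_prop
  have hsnd : Continuous fun z : (ℝ × ℝ) × ℂ => z.2 := continuous_snd
  refine Filter.Eventually.and ?_ ?_
  · have := (isCompact_sphere (0 : ℂ) r).eventually_forall_of_forall_eventually (x₀ := (β, E))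
      (P := fun p v => ∃ k, q ≤ k ∧ k < 2 * q ∧ Real.exp (4 * q * (L - a)) <
        ‖harperIter l1 l2 l3 (circleMap 0 1 (π * p.1)) p.2 (4 * q)
          ((conj (circleMap 0 1 (π * p.1)) ^ 2) ^ k * v)‖) fun v hv => by
        obtain ⟨k, hk1, hk2, hk⟩ := hpave v (mem_sphere_zero_iff_norm.1 hv)
        have hw : Continuous fun z : (ℝ × ℝ) × ℂ =>
            (conj (circleMap 0 1 (π * z.1.1)) ^ 2) ^ k * z.2 := by
          have := Complex.continuous_conj.comp hcirc
          exact ((this.pow 2).pow k).mul hsnd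
        have hc := continuous_norm_harperIter l1 l2 l3 hcirc hen hw (4 * q)
        filter_upwards [continuousAt_const.eventually_lt (hc.continuousAt (x := ((β, E), v))) hk]
          with z hz
        exact ⟨k, hk1, hk2, hz⟩
    filter_upwards [this] with p hp v hv
    exact hp v (mem_sphere_zero_iff_norm.2 hv)
  · have : ∀ᶠ p : ℝ × ℝ in 𝓝 (β, E), ∀ n ∈ Finset.Icc q (3 * q),
        (∀ v : ℂ, ‖v‖ = r →
          ‖harperIter l1 l2 l3 (circleMap 0 1 (π * p.1)) p.2 n v‖ < Real.exp (n * (L + a))) ∧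
        ∀ v : ℂ, ‖v‖ = r → ‖(harperIter l1 l2 l3 (circleMap 0 1 (π * p.1)) p.2 n v).det‖ <
          Real.exp (n * (d + a)) := by
      rw [Filter.eventually_all_finset]
      intro n hn
      have hn' := (Finset.mem_Icc.1 hn).1
      have c1 := continuous_norm_harperIter l1 l2 l3 hcirc hen hsnd n
      have c2 := continuous_norm_det_harperIter l1 l2 l3 hcirc hen hsnd n
      have u1 := eventually_forall_norm_eq_lt (p := (β, E)) c1 fun v hv => (hup n hn' v hv).1
      have u2 := eventually_forall_norm_eq_lt (p := (β, E)) c2 fun v hv => (hup n hn' v hv).2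
      exact u1.and u2
    filter_upwards [this] with p hp n hn hn' v hv
    exact ⟨(hp n (Finset.mem_Icc.2 ⟨hn, hn'⟩)).1 v hv, (hp n (Finset.mem_Icc.2 ⟨hn, hn'⟩)).2 v hv⟩

/-- If the exponent at `E` exceeds `log μ`, some circle of radius near `1` carries uniform bounds
that persist for nearby frequencies and energies. -/
theorem exists_persistent_bounds {l1 l2 l3 β E : ℝ} (hβ : Irrational β) (h1 : 0 ≤ l1)
    (h3 : 0 ≤ l3) (hpos : l1 ≠ 0 ∨ l2 ≠ 0 ∨ l3 ≠ 0) (h13 : l1 + l3 ≤ 1)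
    (hlt : Real.log (harperMu l1 l3) < harperLyap l1 l2 l3 β E 1) :
    ∃ (r L a : ℝ) (q : ℕ), 0 < r ∧ 0 < a ∧ 1 ≤ q * a ∧
      Real.log (harperMu l1 l3) + 2 * Real.posLog r + 16 * a ≤ L ∧
      (∀ z ∈ (harperG l1 l2 l3).roots, ‖z‖ ≠ r) ∧ (∀ z ∈ (harperG l3 l2 l1).roots, ‖z‖ ≠ r) ∧
      ∀ᶠ p : ℝ × ℝ in 𝓝 (β, E),
        (∀ v : ℂ, ‖v‖ = r → ∃ k, q ≤ k ∧ k < 2 * q ∧ Real.exp (4 * q * (L - a)) <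
          ‖harperIter l1 l2 l3 (circleMap 0 1 (π * p.1)) p.2 (4 * q)
            ((conj (circleMap 0 1 (π * p.1)) ^ 2) ^ k * v)‖) ∧
        ∀ n, q ≤ n → n ≤ 3 * q → ∀ v : ℂ, ‖v‖ = r →
          ‖harperIter l1 l2 l3 (circleMap 0 1 (π * p.1)) p.2 n v‖ < Real.exp (n * (L + a)) ∧
          ‖(harperIter l1 l2 l3 (circleMap 0 1 (π * p.1)) p.2 n v).det‖ <
            Real.exp (n * (avgLog (harperG l1 l2 l3) r + avgLog (harperG l3 l2 l1) r + a)) := by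
  have h4 : 4 * l1 * l3 ≤ 1 := by nlinarith [sq_nonneg (l1 - l3)]
  obtain ⟨κ, hκ, hκ1⟩ : ∃ κ, 0 < κ ∧ Real.log (harperMu l1 l3) + κ ≤ harperLyap l1 l2 l3 β E 1 :=
    ⟨harperLyap l1 l2 l3 β E 1 - Real.log (harperMu l1 l3), by linarith, by linarith⟩
  obtain ⟨a, ha⟩ : ∃ a, a = κ / 32 := ⟨_, rfl⟩
  have ha0 : 0 < a := by rw [ha]; linarith
  obtain ⟨J, hJ⟩ := exists_nat_ge (max 32 (1024 / a))
  have hJ1 : 32 ≤ J := by exact_mod_cast (le_max_left _ _).trans hJ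
  have hJ2 : 1024 ≤ a * J := by
    have := (le_max_right _ _).trans hJ
    rwa [div_le_iff₀ ha0, mul_comm] at this
  have hρ1 : ‖circleMap 0 1 (π * β)‖ = 1 := norm_circleMap_one _
  have hconv : ∀ r : ℝ, 0 < r → 2 * harperLyap l1 l2 l3 β E 1 ≤
      harperLyap l1 l2 l3 β E r + harperLyap l1 l2 l3 β E r⁻¹ := fun r hr =>
    two_mul_radialLyap_one_le (by rw [norm_pow, hρ1, one_pow])
      (polyIter_harper_ne_zero hρ1 E h1 h3 h4)
      (fun s hs n => mul_log_harperMu_le hρ1 E h1 h3 h4 hs n) hr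
  obtain ⟨R, hRc, hR⟩ := exists_radii hκ hκ1 hconv
    (S := (fun z => ‖z‖) '' {z | z ∈ (harperG l1 l2 l3).roots} ∪
      (fun z => ‖z‖) '' {z | z ∈ (harperG l3 l2 l1).roots})
    (((Multiset.finite_toSet _).image _).union ((Multiset.finite_toSet _).image _)) J
  have hroots : ∀ r ∈ R, (∀ z ∈ (harperG l1 l2 l3).roots, ‖z‖ ≠ r) ∧
      ∀ z ∈ (harperG l3 l2 l1).roots, ‖z‖ ≠ r := fun r hr =>
    ⟨fun z hz h0 => (hR r hr).2.1 (Or.inl ⟨z, hz, h0⟩),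
      fun z hz h0 => (hR r hr).2.1 (Or.inr ⟨z, hz, h0⟩)⟩
  obtain ⟨η, hη, hη4, hsep⟩ := R.exists_pos_separation
  have hupper := (Filter.eventually_all_finset R).2 fun r hr =>
    eventually_norm_harperIter_le (E := E) hβ (by linarith [(hR r hr).1.1]) (hroots r hr).1
      (hroots r hr).2 hpos (half_pos ha0)
  obtain ⟨N, hN⟩ := Filter.eventually_atTop.1 hupper
  obtain ⟨N', hN'⟩ := exists_nat_ge (1 / a)
  obtain ⟨q, hq, r, hr, hpave⟩ := exists_harperIter_paving (l2 := l2) (E := E) hβ h1 h3 h4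
    (fun r hr => (hR r hr).1) hη hη4 hsep ha0 (by rwa [hRc]) (by rwa [hRc]) (max N N')
  have hqN : N < q := lt_of_le_of_lt (le_max_left _ _) hq
  have hqN' : (N' : ℝ) < q := by exact_mod_cast lt_of_le_of_lt (le_max_right _ _) hq
  refine ⟨r, harperLyap l1 l2 l3 β E r, a, q, by linarith [(hR r hr).1.1], ha0, ?_, ?_,
    (hroots r hr).1, (hroots r hr).2, eventually_harperIter_bounds hpave fun n hn v hv => ?_⟩
  · have := hN'.trans hqN'.le
    rwa [div_le_iff₀ ha0] at this
  · rw [ha]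
    linarith [(hR r hr).2.2]
  · obtain ⟨e1, e2⟩ := hN n (by omega) r hr v hv
    have hn0 : (0 : ℝ) < n := by
      have : 0 < n := by omega
      exact_mod_cast this
    exact ⟨e1.trans_lt (Real.exp_lt_exp.2 (mul_lt_mul_of_pos_left (by linarith) hn0)),
      e2.trans_lt (Real.exp_lt_exp.2 (mul_lt_mul_of_pos_left (by linarith) hn0))⟩

theorem harperLyap_one_le {l1 l2 l3 β θ E : ℝ} (hβ : Irrational β) (h1 : 0 ≤ l1) (h2 : 0 ≤ l2)
    (h3 : 0 ≤ l3) (hpos : l1 ≠ 0 ∨ l2 ≠ 0 ∨ l3 ≠ 0) (h13 : l1 + l3 ≤ 1) (h2' : l2 ≤ 1)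
    {H : lp (fun _ : ℤ => ℂ) 2 →L[ℂ] lp (fun _ : ℤ => ℂ) 2}
    (hH : ∀ ψ k, H ψ k = jacobi (harperV β θ) (harperOff l1 l2 l3 β θ) ψ k)
    (hE : (E : ℂ) ∈ spectrum ℂ H) :
    harperLyap l1 l2 l3 β E 1 ≤ Real.log (harperMu l1 l3) := by
  by_contra! hlt
  have h4 : 4 * l1 * l3 ≤ 1 := by nlinarith [sq_nonneg (l1 - l3)]
  obtain ⟨r, L, a, q, hr, ha, hqa, hL, hr1, hr3, hev⟩ :=
    exists_persistent_bounds hβ h1 h3 hpos h13 hlt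
  obtain ⟨ε, hε, hball⟩ := Metric.eventually_nhds_iff.1 hev
  obtain ⟨δ, hδ, M, hM⟩ := exists_rational_approximant h1 h2 h3 hpos h13 h2' hH hE hε
  obtain ⟨N, hN⟩ := Filter.eventually_atTop.1
    ((eventually_prod_norm_eval_rotation_ge (harperG_ne_zero hpos) hr hr1).and
      (eventually_prod_norm_eval_rotation_ge (harperG_ne_zero (by tauto)) hr hr3))
  obtain ⟨K, hK⟩ := exists_nat_ge (max (3 / a) (max (1 / ε) (1 / δ)))
  obtain ⟨x, hxM, hx⟩ := exists_rat_approx hβ (max M (max N K))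
  have hxM1 : M ≤ x.den := ((le_max_left _ _).trans_lt hxM).le
  have hxN : N ≤ x.den := ((le_max_left _ _).trans_lt ((le_max_right _ _).trans_lt hxM)).le
  have hxK : (K : ℝ) ≤ x.den := by
    exact_mod_cast ((le_max_right _ _).trans_lt ((le_max_right _ _).trans_lt hxM)).le
  have hq0 : (1 : ℝ) ≤ x.den := by exact_mod_cast x.den_pos
  have hk1 : 3 / a ≤ x.den := (le_max_left _ _).trans (hK.trans hxK)
  have hk2 : 1 / ε ≤ x.den := (le_max_left _ _).trans ((le_max_right _ _).trans (hK.trans hxK))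
  have hk3 : 1 / δ ≤ x.den := (le_max_right _ _).trans ((le_max_right _ _).trans (hK.trans hxK))
  rw [div_le_iff₀ (by positivity)] at hk1 hk2 hk3
  have hclose : |(x : ℝ) - β| < 1 / x.den := by
    rw [abs_sub_comm]
    refine hx.trans_le (one_div_le_one_div_of_le (by linarith) ?_)
    nlinarith
  have hxε : |(x : ℝ) - β| < ε := hclose.trans_le (by rw [div_le_iff₀ (by linarith)]; linarith)
  have hxδ : |(x : ℝ) - β| < δ := hclose.trans_le (by rw [div_le_iff₀ (by linarith)]; linarith)
  obtain ⟨E', hE', w, hw, htr⟩ := hM x hxδ hxM1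
  have hmem : dist ((x : ℝ), E') (β, E) < ε := by
    rw [Prod.dist_eq, max_lt_iff, Real.dist_eq, Real.dist_eq]
    exact ⟨hxε, hE'⟩
  obtain ⟨hpave, hup⟩ := hball hmem
  obtain ⟨ρ, hρ⟩ : ∃ ρ, ρ = circleMap 0 1 (π * (x : ℝ)) := ⟨_, rfl⟩
  have hρ1 : ‖ρ‖ = 1 := hρ ▸ norm_circleMap_one _
  have hω : IsPrimitiveRoot (ρ ^ 2) x.den := by
    rw [hρ, circleMap_pi_mul_sq]
    exact isPrimitiveRoot_circleMap x
  simp only [← hρ] at hpave hup htr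
  obtain ⟨low1, low3⟩ := hN x.den hxN
  have hd1 := avgLog_le_avgLog_one_add (harperG_ne_zero hpos) hr
  have hd3 := avgLog_le_avgLog_one_add (harperG_ne_zero (l1 := l3) (l2 := l2) (l3 := l1)
    (by tauto)) hr
  have hpos' : 0 < l1 ∨ 0 < l2 ∨ 0 < l3 := by
    rcases hpos with h | h | h
    · exact Or.inl (h1.lt_of_ne' h)
    · exact Or.inr (Or.inl (h2.lt_of_ne' h))
    · exact Or.inr (Or.inr (h3.lt_of_ne' h))
  have hm1 := avgLog_harperG_one_le h1 h2 h3 hpos' h13 h2'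
  have hm3 := avgLog_harperG_one_le h3 h2 h1 (by tauto) (by linarith) h2'
  rw [harperMu_comm] at hm3
  have hn1 : ((harperG l1 l2 l3).natDegree : ℝ) * Real.posLog r ≤ 2 * Real.posLog r :=
    mul_le_mul_of_nonneg_right (by exact_mod_cast natDegree_harperG_le l1 l2 l3) Real.posLog_nonneg
  have hn3 : ((harperG l3 l2 l1).natDegree : ℝ) * Real.posLog r ≤ 2 * Real.posLog r :=
    mul_le_mul_of_nonneg_right (by exact_mod_cast natDegree_harperG_le l3 l2 l1) Real.posLog_nonneg
  refine false_of_rational_approximant hρ1 E' h1 h3 h4 hpos x.den_pos hω hw htr hr ha hqa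
    (by linarith) hL (by linarith) (fun v hv => ?_) (fun n hn hn' v hv => (hup n hn hn' v hv).1.le)
    (fun n hn hn' v hv => (hup n hn hn' v hv).2.le) (low1 _ hω) (low3 _ hω)
  obtain ⟨k, hk, hk', hlow⟩ := hpave v hv
  refine ⟨k, hk, hk', _, ?_, hlow.le⟩
  rw [← mul_assoc, ← mul_pow, ← mul_pow, mul_conj_eq_one hρ1, one_pow, one_pow, one_mul]

end Contradiction

section LyapunovExponent

open Polynomial

theorem exists_harperIter_eq_smul (l1 l2 l3 β E : ℝ) (n : ℕ) (x : ℝ) :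
    ∃ s : ℂ, ‖s‖ = 1 ∧
      harperIter l1 l2 l3 (circleMap 0 1 (π * β)) E n (circleMap 0 1 (2 * π * x)) =
        s • cocycleIter (fun y : ℝ => harperA l1 l2 l3 β E y) β n x := by
  induction n generalizing x with
  | zero => exact ⟨1, norm_one, by simp [harperIter, mulIter, cocycleIter]⟩
  | succ n ih =>
    obtain ⟨s, hs, e⟩ := ih (x + β)
    refine ⟨s * circleMap 0 1 (2 * π * x), by rw [norm_mul, hs, norm_circleMap_one, one_mul], ?_⟩
    rw [circleMap_two_pi_mul_add, mul_comm (circleMap 0 1 (2 * π * x)), ← circleMap_pi_mul_sq] at e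
    rw [harperIter] at e
    rw [harperIter, mulIter, e, ← smul_harperA, cocycleIter, Matrix.smul_mul, Matrix.mul_smul,
      smul_smul]

theorem norm_cocycleIter_harperA (l1 l2 l3 β E : ℝ) (n : ℕ) (x : ℝ) :
    ‖cocycleIter (fun y : ℝ => harperA l1 l2 l3 β E y) β n x‖ =
      ‖harperIter l1 l2 l3 (circleMap 0 1 (π * β)) E n (circleMap 0 1 (2 * π * x))‖ := by
  obtain ⟨s, hs, e⟩ := exists_harperIter_eq_smul l1 l2 l3 β E n x
  rw [e, frobenius_norm_smul, hs, one_mul]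

theorem logIntegral_eq_coe {g : ℝ → ℝ} (hg : ∀ᵐ x ∂volume.restrict (Set.Ioc (0 : ℝ) 1), g x ≠ 0)
    (hint : IntegrableOn (fun x => Real.log (g x)) (Set.Ioc 0 1)) :
    logIntegral g = ((∫ x in Set.Ioc (0 : ℝ) 1, Real.log (g x) : ℝ) : EReal) := by
  have e : (∫⁻ x in Set.Ioc (0 : ℝ) 1,
      if g x = 0 then (⊤ : ℝ≥0∞) else ENNReal.ofReal (-Real.log (g x))) =
      ∫⁻ x in Set.Ioc (0 : ℝ) 1, ENNReal.ofReal (-Real.log (g x)) := by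
    refine lintegral_congr_ae ?_
    filter_upwards [hg] with x hx
    rw [if_neg hx]
  have hneg := hint.neg.lintegral_lt_top.ne
  simp only [Pi.neg_apply] at hneg
  rw [logIntegral, e, integral_eq_lintegral_pos_part_sub_lintegral_neg_part hint, EReal.coe_sub,
    EReal.coe_ennreal_toReal hint.lintegral_lt_top.ne,
    EReal.coe_ennreal_toReal hneg]

theorem logIntegral_norm_matEval {P : Matrix (Fin 2) (Fin 2) ℂ[X]} (hP : P 0 0 ≠ 0) :
    logIntegral (fun x => ‖matEval P (circleMap 0 1 (2 * π * x))‖) = (avgLogMat P 1 : EReal) := by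
  rw [logIntegral_eq_coe]
  · rw [avgLogMat, circleAverage_eq_setIntegral]
  · filter_upwards [ae_circleMap_notMem (countable_matEval_eq_zero hP) one_ne_zero
      (Set.Ioc (0 : ℝ) 1)] with x hx
    exact norm_ne_zero_iff.2 hx
  · exact (circleIntegrable_log_norm_matEval P 1).integrableOn_Ioc

theorem lyapunov_harperA {l1 l2 l3 β E : ℝ} (h1 : 0 ≤ l1) (h3 : 0 ≤ l3) (h : 4 * l1 * l3 ≤ 1) :
    lyapunov β (fun x : ℝ => harperA l1 l2 l3 β (E : ℂ) (x : ℂ)) =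
      (harperLyap l1 l2 l3 β E 1 : EReal) := by
  obtain ⟨ρ, hρ⟩ : ∃ ρ, ρ = circleMap 0 1 (π * β) := ⟨_, rfl⟩
  have hρ1 : ‖ρ‖ = 1 := hρ ▸ norm_circleMap_one _
  have hlog : ∀ n, logIntegral
      (fun x => ‖cocycleIter (fun y : ℝ => harperA l1 l2 l3 β (E : ℂ) (y : ℂ)) β n x‖) =
      (avgLogMat (polyIter (harperPoly l1 l2 l3 ρ E) (ρ ^ 2) n) 1 : EReal) := by
    intro n
    rw [← logIntegral_norm_matEval (polyIter_harper_ne_zero hρ1 E h1 h3 h n)]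
    simp only [norm_cocycleIter_harperA, matEval_polyIter, hρ, harperIter]
  have hb : ∀ n : ℕ, n * Real.log (harperMu l1 l3) ≤
      avgLogMat (polyIter (harperPoly l1 l2 l3 ρ E) (ρ ^ 2) n) 1 :=
    fun n => mul_log_harperMu_le hρ1 E h1 h3 h one_pos n
  rw [lyapunov, harperLyap, ← hρ]
  simp only [hlog, ← EReal.coe_mul]
  refine le_antisymm (le_of_forall_gt fun c hc => ?_) (le_iInf fun n => ?_)
  · obtain ⟨z, hz, hzc⟩ := EReal.lt_iff_exists_real_btwn.1 hc
    rw [EReal.coe_lt_coe_iff] at hz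
    obtain ⟨m, hm, hlt⟩ :=
      exists_avgLogMat_lt (harperPoly l1 l2 l3 ρ E) (ρ ^ 2) 1 (sub_pos.2 hz)
    obtain ⟨n, rfl⟩ := Nat.exists_eq_add_of_lt hm
    rw [zero_add] at hlt
    refine ((iInf_le _ n).trans (EReal.coe_le_coe_iff.2 ?_)).trans_lt hzc
    rw [inv_mul_le_iff₀ (by positivity)]
    push_cast at hlt
    linarith
  · have := mul_radialLyap_le hb (n := n + 1) (by omega)
    rw [EReal.coe_le_coe_iff, le_inv_mul_iff₀ (by positivity)]
    push_cast at this
    exact this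

theorem log_harperMu_le_harperLyap {l1 l2 l3 β E : ℝ} (h1 : 0 ≤ l1) (h3 : 0 ≤ l3)
    (h : 4 * l1 * l3 ≤ 1) : Real.log (harperMu l1 l3) ≤ harperLyap l1 l2 l3 β E 1 := by
  refine le_csInf ((Set.nonempty_Ici (a := 1)).image _) ?_
  rintro _ ⟨n, hn, rfl⟩
  have hn0 : (0 : ℝ) < n := by exact_mod_cast (Set.mem_Ici.1 hn)
  rw [le_div_iff₀ hn0, mul_comm]
  exact mul_log_harperMu_le (norm_circleMap_one _) E h1 h3 h one_pos n

end LyapunovExponent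


/-- For irrational `β` and coupling `λ` in region I
(`λ₁ + λ₃ ≤ 1` and `λ₂ ≤ 1`), for every real energy `E` in the spectrum of the extended
Harper operator, the Lyapunov exponent of the transfer-matrix cocycle equals
`log ((1 + √(1 - 4λ₁λ₃))/2)`. -/
theorem extendedHarper_lyapunov_regionI
    (β lam1 lam2 lam3 θ : ℝ) (hβ : Irrational β)
    (h1 : 0 ≤ lam1) (h2 : 0 ≤ lam2) (h3 : 0 ≤ lam3)
    (hpos : 0 < lam1 ∨ 0 < lam2 ∨ 0 < lam3)
    (hI : lam1 + lam3 ≤ 1 ∧ lam2 ≤ 1)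
    (H : lp (fun _ : ℤ => ℂ) 2 →L[ℂ] lp (fun _ : ℤ => ℂ) 2)
    (hH : ∀ (ψ : lp (fun _ : ℤ => ℂ) 2) (k : ℤ),
      H ψ k = ((2 * Real.cos (2 * π * (θ + β * k)) : ℝ) : ℂ) * ψ k +
        harperC lam1 lam2 lam3 β ((θ + β * k : ℝ) : ℂ) * ψ (k + 1) +
        (starRingEnd ℂ) (harperC lam1 lam2 lam3 β ((θ + β * (k - 1) : ℝ) : ℂ)) * ψ (k - 1))
    (E : ℝ) (hE : (E : ℂ) ∈ spectrum ℂ H) :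
    lyapunov β (fun x : ℝ => harperA lam1 lam2 lam3 β (E : ℂ) (x : ℂ)) =
      ((Real.log ((1 + Real.sqrt (1 - 4 * lam1 * lam3)) / 2) : ℝ) : EReal) := by
  have h13 := hI.1
  have h4 : 4 * lam1 * lam3 ≤ 1 := by nlinarith [sq_nonneg (lam1 - lam3)]
  have hpos' : lam1 ≠ 0 ∨ lam2 ≠ 0 ∨ lam3 ≠ 0 := by
    rcases hpos with h | h | h
    · exact Or.inl h.ne'
    · exact Or.inr (Or.inl h.ne')
    · exact Or.inr (Or.inr h.ne')
  have hH' : ∀ ψ k, H ψ k = jacobi (harperV β θ) (harperOff lam1 lam2 lam3 β θ) ψ k := by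
    intro ψ k
    rw [hH, jacobi, harperV, harperOff, harperOff]
    push_cast
    rfl
  have hle := harperLyap_one_le hβ h1 h2 h3 hpos' h13 hI.2 hH' hE
  have hge : Real.log (harperMu lam1 lam3) ≤ harperLyap lam1 lam2 lam3 β E 1 :=
    log_harperMu_le_harperLyap h1 h3 h4
  rw [lyapunov_harperA h1 h3 h4, le_antisymm hle hge, harperMu]
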